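/- Case (A2) with multiplicity one: assume I = I_q is the orbit of q (so q ∈ I), p ∉ I, p is not a root of unity, and ν ∈ ᶿNI has multiplicity one (ν_i ≤ 1 for all i ∈ I) and ν_q = 1. Then the VV algebra 𝔚_ν is affine cellular with respect to the k-involution of 𝔚_ν that fixes each generator x_k, each σ_k, π, and each idempotent e(i) (and reverses products). -/

import Mathlib

open scoped TensorProduct
open CategoryTheory

noncomputable section

namespace VVPaper

variable {k : Type} [Field k]

/-! ## Quiver combinatorics -/

/-- There is an arrow `a → b` in the quiver `Γ` iff `a = p² b` (arrows `p² i → i`). -/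
def Arrow (p a b : kˣ) : Prop := a = p ^ 2 * b

/-- The orbit of `lam` under the `ℤ ⋊ ℤ/2`-action `(n, ε) · λ = p^(2n) λ^ε` on `kˣ`. -/
def orbit (p lam : kˣ) : Set kˣ :=
  {x | ∃ n : ℤ, x = p ^ (2 * n) * lam ∨ x = p ^ (2 * n) * lam⁻¹}

/-- The half-orbit `I⁺ = {p^(2n) λ : n ∈ ℤ}`. -/
def halfOrbit (p lam : kˣ) : Set kˣ := {x | ∃ n : ℤ, x = p ^ (2 * n) * lam}

/-- `ν ∈ ᶿℕI`: a finitely supported dimension vector, supported on `I` and `θ`-invariant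
(`θ i = i⁻¹`). -/
def IsDimVec (I : Set kˣ) (ν : kˣ →₀ ℕ) : Prop :=
  (∀ a : kˣ, ν a ≠ 0 → a ∈ I) ∧ (∀ a : kˣ, ν a⁻¹ = ν a)

/-- The height `|ν|` of a dimension vector. -/
def height (ν : kˣ →₀ ℕ) : ℕ := ν.sum fun _ n => n

/-- `i = (i₁, …, i_m) ∈ ᶿI^ν`, i.e. `Σ i_k + Σ i_k⁻¹ = ν`. -/
def IsThetaSeq (ν : kˣ →₀ ℕ) {m : ℕ} (i : Fin m → kˣ) : Prop :=
  (∑ j : Fin m, (Finsupp.single (i j) 1 + Finsupp.single (i j)⁻¹ 1)) = ν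

/-- `i = (i₁, …, i_m) ∈ I^ν̃`, i.e. `Σ i_k = ν̃` (for KLR algebras). -/
def IsSeq (ν : kˣ →₀ ℕ) {m : ℕ} (i : Fin m → kˣ) : Prop :=
  (∑ j : Fin m, Finsupp.single (i j) 1) = ν

open Classical in
/-- The (finite) set of all sequences in `ᶿI^ν`. -/
def thetaSeqs (ν : kˣ →₀ ℕ) (m : ℕ) : Finset (Fin m → kˣ) :=
  (Fintype.piFinset fun _ : Fin m => ν.support).filter fun i => IsThetaSeq ν i

open Classical in
/-- The (finite) set of all sequences in `I^ν̃`. -/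
def seqs (ν : kˣ →₀ ℕ) (m : ℕ) : Finset (Fin m → kˣ) :=
  (Fintype.piFinset fun _ : Fin m => ν.support).filter fun i => IsSeq ν i

/-! ## Generators and relations for VV and KLR algebras -/

/-- Generators of a VV algebra (or of a KLR algebra, discarding `pi`):
polynomial generators `x`, intertwiners `sig`, idempotents `idem` and the extra generator `pi`. -/
inductive Gen (V : Type) (m : ℕ) : Type
  | x : Fin m → Gen V m
  | sig : Fin (m - 1) → Gen V m
  | idem : (Fin m → V) → Gen V m
  | pi : Gen V m

/-- The free algebra on the generators. -/
abbrev FA (k : Type) [Field k] (m : ℕ) : Type := FreeAlgebra k (Gen kˣ m)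

def X {m : ℕ} (j : Fin m) : FA k m := FreeAlgebra.ι k (Gen.x j)
def Sg {m : ℕ} (s : Fin (m - 1)) : FA k m := FreeAlgebra.ι k (Gen.sig s)
def E {m : ℕ} (i : Fin m → kˣ) : FA k m := FreeAlgebra.ι k (Gen.idem i)
def Pg {m : ℕ} : FA k m := FreeAlgebra.ι k (Gen.pi : Gen kˣ m)

/-- `σ_k` exchanges positions `k` and `k+1`: the lower position. -/
def lo {m : ℕ} (s : Fin (m - 1)) : Fin m := ⟨s.1, by have := s.2; omega⟩

/-- The upper position `k+1`. -/
def hi {m : ℕ} (s : Fin (m - 1)) : Fin m := ⟨s.1 + 1, by have := s.2; omega⟩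

/-- The action of the simple transposition `s_k` on sequences. -/
def swapAt {V : Type} {m : ℕ} (s : Fin (m - 1)) (i : Fin m → V) : Fin m → V :=
  i ∘ Equiv.swap (lo s) (hi s)

/-- The defining relations of the VV algebra (when `withPi = true`) and of the KLR algebra
(when `withPi = false`), for the quiver with arrows `p² i → i`, parameter `q`, sequences
satisfying `P` (whose collection is the finite set `T`). -/
inductive Rel (p q : kˣ) {m : ℕ} (P : (Fin m → kˣ) → Prop) (T : Finset (Fin m → kˣ))
    (withPi : Bool) : FA k m → FA k m → Prop
  -- the e(i) are orthogonal idempotents summing to 1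
  | idem_mul (i : Fin m → kˣ) : Rel p q P T withPi (E i * E i) (E i)
  | idem_orth (i j : Fin m → kˣ) (h : i ≠ j) : Rel p q P T withPi (E i * E j) 0
  | idem_zero (i : Fin m → kˣ) (h : ¬ P i) : Rel p q P T withPi (E i) 0
  | idem_sum : Rel p q P T withPi (∑ i ∈ T, E i) 1
  -- the x's commute with each other and with the idempotents
  | x_mul_comm (a b : Fin m) : Rel p q P T withPi (X a * X b) (X b * X a)
  | x_idem (a : Fin m) (i : Fin m → kˣ) : Rel p q P T withPi (X a * E i) (E i * X a)
  -- σ_k e(i) = e(s_k i) σ_k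
  | sig_idem (s : Fin (m - 1)) (i : Fin m → kˣ) :
      Rel p q P T withPi (Sg s * E i) (E (swapAt s i) * Sg s)
  -- quadratic relations for σ_k
  | sig_sq_eq (s : Fin (m - 1)) (i : Fin m → kˣ) (h : i (lo s) = i (hi s)) :
      Rel p q P T withPi (Sg s * Sg s * E i) 0
  | sig_sq_none (s : Fin (m - 1)) (i : Fin m → kˣ) (hne : i (lo s) ≠ i (hi s))
      (h1 : ¬ Arrow p (i (lo s)) (i (hi s))) (h2 : ¬ Arrow p (i (hi s)) (i (lo s))) :
      Rel p q P T withPi (Sg s * Sg s * E i) (E i)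
  | sig_sq_from (s : Fin (m - 1)) (i : Fin m → kˣ)
      (h1 : Arrow p (i (hi s)) (i (lo s))) (h2 : ¬ Arrow p (i (lo s)) (i (hi s))) :
      Rel p q P T withPi (Sg s * Sg s * E i) ((X (hi s) - X (lo s)) * E i)
  | sig_sq_to (s : Fin (m - 1)) (i : Fin m → kˣ)
      (h1 : Arrow p (i (lo s)) (i (hi s))) (h2 : ¬ Arrow p (i (hi s)) (i (lo s))) :
      Rel p q P T withPi (Sg s * Sg s * E i) ((X (lo s) - X (hi s)) * E i)
  | sig_sq_both (s : Fin (m - 1)) (i : Fin m → kˣ)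
      (h1 : Arrow p (i (lo s)) (i (hi s))) (h2 : Arrow p (i (hi s)) (i (lo s))) :
      Rel p q P T withPi (Sg s * Sg s * E i) ((X (hi s) - X (lo s)) * (X (lo s) - X (hi s)) * E i)
  -- far-apart σ's commute
  | sig_comm (s t : Fin (m - 1)) (h : s.1 + 1 < t.1) :
      Rel p q P T withPi (Sg s * Sg t) (Sg t * Sg s)
  -- braid relations
  | braid_triv (s : Fin (m - 1)) (hs : s.1 + 1 < m - 1) (i : Fin m → kˣ)
      (h : i (lo s) ≠ i ⟨s.1 + 2, by omega⟩ ∨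
        (¬ Arrow p (i (lo s)) (i (hi s)) ∧ ¬ Arrow p (i (hi s)) (i (lo s)))) :
      Rel p q P T withPi (Sg ⟨s.1 + 1, hs⟩ * Sg s * Sg ⟨s.1 + 1, hs⟩ * E i)
        (Sg s * Sg ⟨s.1 + 1, hs⟩ * Sg s * E i)
  | braid_to (s : Fin (m - 1)) (hs : s.1 + 1 < m - 1) (i : Fin m → kˣ)
      (he : i (lo s) = i ⟨s.1 + 2, by omega⟩)
      (h1 : Arrow p (i (lo s)) (i (hi s))) (h2 : ¬ Arrow p (i (hi s)) (i (lo s))) :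
      Rel p q P T withPi (Sg ⟨s.1 + 1, hs⟩ * Sg s * Sg ⟨s.1 + 1, hs⟩ * E i)
        (Sg s * Sg ⟨s.1 + 1, hs⟩ * Sg s * E i + E i)
  | braid_from (s : Fin (m - 1)) (hs : s.1 + 1 < m - 1) (i : Fin m → kˣ)
      (he : i (lo s) = i ⟨s.1 + 2, by omega⟩)
      (h1 : Arrow p (i (hi s)) (i (lo s))) (h2 : ¬ Arrow p (i (lo s)) (i (hi s))) :
      Rel p q P T withPi (Sg ⟨s.1 + 1, hs⟩ * Sg s * Sg ⟨s.1 + 1, hs⟩ * E i)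
        (Sg s * Sg ⟨s.1 + 1, hs⟩ * Sg s * E i - E i)
  | braid_both (s : Fin (m - 1)) (hs : s.1 + 1 < m - 1) (i : Fin m → kˣ)
      (he : i (lo s) = i ⟨s.1 + 2, by omega⟩)
      (h1 : Arrow p (i (lo s)) (i (hi s))) (h2 : Arrow p (i (hi s)) (i (lo s))) :
      Rel p q P T withPi (Sg ⟨s.1 + 1, hs⟩ * Sg s * Sg ⟨s.1 + 1, hs⟩ * E i)
        (Sg s * Sg ⟨s.1 + 1, hs⟩ * Sg s * E i +
          ((2 : FA k m) * X (hi s) - X ⟨s.1 + 2, by omega⟩ - X (lo s)) * E i)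
  -- mixed relations for σ and x
  | sig_x_lo (s : Fin (m - 1)) (i : Fin m → kˣ) (h : i (lo s) = i (hi s)) :
      Rel p q P T withPi (Sg s * X (lo s) * E i) (X (hi s) * Sg s * E i - E i)
  | sig_x_hi (s : Fin (m - 1)) (i : Fin m → kˣ) (h : i (lo s) = i (hi s)) :
      Rel p q P T withPi (Sg s * X (hi s) * E i) (X (lo s) * Sg s * E i + E i)
  | sig_x (s : Fin (m - 1)) (l : Fin m) (i : Fin m → kˣ)
      (h : i (lo s) ≠ i (hi s) ∨ (l ≠ lo s ∧ l ≠ hi s)) :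
      Rel p q P T withPi (Sg s * X l * E i) (X (Equiv.swap (lo s) (hi s) l) * Sg s * E i)
  -- relations involving π (only for the VV algebra)
  | pi_idem (hw : withPi = true) (h0 : 0 < m) (i : Fin m → kˣ) :
      Rel p q P T withPi (Pg * E i) (E (Function.update i ⟨0, h0⟩ (i ⟨0, h0⟩)⁻¹) * Pg)
  | pi_sq_q (hw : withPi = true) (h0 : 0 < m) (i : Fin m → kˣ) (h : i ⟨0, h0⟩ = q) :
      Rel p q P T withPi (Pg * Pg * E i) (X ⟨0, h0⟩ * E i)
  | pi_sq_qinv (hw : withPi = true) (h0 : 0 < m) (i : Fin m → kˣ) (h : i ⟨0, h0⟩ = q⁻¹) :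
      Rel p q P T withPi (Pg * Pg * E i) (-(X ⟨0, h0⟩ * E i))
  | pi_sq_one (hw : withPi = true) (h0 : 0 < m) (i : Fin m → kˣ)
      (h1 : i ⟨0, h0⟩ ≠ q) (h2 : i ⟨0, h0⟩ ≠ q⁻¹) :
      Rel p q P T withPi (Pg * Pg * E i) (E i)
  | pi_x_zero (hw : withPi = true) (h0 : 0 < m) :
      Rel p q P T withPi (Pg * X ⟨0, h0⟩) (-(X ⟨0, h0⟩ * Pg))
  | pi_x (hw : withPi = true) (l : Fin m) (h : 0 < l.1) :
      Rel p q P T withPi (Pg * X l) (X l * Pg)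
  | pi_sig (hw : withPi = true) (s : Fin (m - 1)) (h : 0 < s.1) :
      Rel p q P T withPi (Pg * Sg s) (Sg s * Pg)
  | sig_pi_plus (hw : withPi = true) (h1 : 0 < m - 1) (i : Fin m → kˣ)
      (ha : i ⟨0, by omega⟩ = q) (hb : i ⟨1, by omega⟩ = q⁻¹) :
      Rel p q P T withPi (Sg ⟨0, h1⟩ * Pg * (Sg ⟨0, h1⟩ * Pg) * E i)
        (Pg * Sg ⟨0, h1⟩ * (Pg * Sg ⟨0, h1⟩) * E i + Sg ⟨0, h1⟩ * E i)
  | sig_pi_minus (hw : withPi = true) (h1 : 0 < m - 1) (i : Fin m → kˣ)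
      (ha : i ⟨0, by omega⟩ = q⁻¹) (hb : i ⟨1, by omega⟩ = q) :
      Rel p q P T withPi (Sg ⟨0, h1⟩ * Pg * (Sg ⟨0, h1⟩ * Pg) * E i)
        (Pg * Sg ⟨0, h1⟩ * (Pg * Sg ⟨0, h1⟩) * E i - Sg ⟨0, h1⟩ * E i)
  | sig_pi_zero (hw : withPi = true) (h1 : 0 < m - 1) (i : Fin m → kˣ)
      (hc : ¬ (i ⟨0, by omega⟩ = q ∧ i ⟨1, by omega⟩ = q⁻¹))
      (hc' : ¬ (i ⟨0, by omega⟩ = q⁻¹ ∧ i ⟨1, by omega⟩ = q)) :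
      Rel p q P T withPi (Sg ⟨0, h1⟩ * Pg * (Sg ⟨0, h1⟩ * Pg) * E i)
        (Pg * Sg ⟨0, h1⟩ * (Pg * Sg ⟨0, h1⟩) * E i)
  -- for the KLR algebra, there is no generator π
  | pi_zero (hw : withPi = false) : Rel p q P T withPi Pg 0

/-- The VV algebra `𝔚_ν` attached to `p`, `q` and a dimension vector `ν` of height `2m`. -/
@[reducible] def VV (k : Type) [Field k] (p q : kˣ) (ν : kˣ →₀ ℕ) (m : ℕ) : Type :=
  RingQuot (Rel p q (IsThetaSeq ν) (thetaSeqs ν m) true)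

/-- The KLR algebra `R_ν̃` attached to `p` and a dimension vector `ν̃` of height `m`. -/
@[reducible] def KLR (k : Type) [Field k] (p : kˣ) (ν : kˣ →₀ ℕ) (m : ℕ) : Type :=
  RingQuot (Rel p 1 (IsSeq ν) (seqs ν m) false)

/-- The canonical map from the free algebra onto the VV algebra. -/
def vmk (p q : kˣ) (ν : kˣ →₀ ℕ) (m : ℕ) : FA k m →ₐ[k] VV k p q ν m :=
  RingQuot.mkAlgHom k _

/-- The canonical map from the free algebra onto the KLR algebra. -/
def kmk (p : kˣ) (ν : kˣ →₀ ℕ) (m : ℕ) : FA k m →ₐ[k] KLR k p ν m :=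
  RingQuot.mkAlgHom k _

/-- Two `k`-algebras are Morita equivalent if there is a `k`-linear equivalence between their
categories of (left) modules. -/
def MoritaEquiv (k : Type) [Field k] (A B : Type) [Ring A] [Ring B]
    [Algebra k A] [Algebra k B] : Prop :=
  ∃ (e : ModuleCat.{0} A ≌ ModuleCat.{0} B) (_ : e.functor.Additive), e.functor.Linear k

end VVPaper

set_option synthInstance.maxHeartbeats 1000000
set_option maxHeartbeats 1600000

namespace VVPaper

/-! ## Affine cellularity (after Koenig–Xi) -/

/-- A `k`-involution of a `k`-algebra: a `k`-linear anti-automorphism of order two. -/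
structure IsKInvolution {k A : Type} [Field k] [Ring A] [Algebra k A] (ω : A →ₗ[k] A) :
    Prop where
  map_mul : ∀ a b : A, ω (a * b) = ω b * ω a
  map_one : ω 1 = 1
  involutive : ∀ a : A, ω (ω a) = a

/-- An affine cell ideal of `(H, ω)`: a two-sided ideal `J` with `ω(J) = J` such that for some
finite-rank free `k`-module `V = k^{nV}` and some affine commutative `k`-algebra `B`
(a quotient of a polynomial ring in finitely many variables) with involution `iB`, the
free module `Δ := V ⊗_k B ≅ (Fin nV → B)` carries a left `H`-action commuting with the
`B`-action (an `H`-`B`-bimodule), and there is an isomorphism `α : J ≅ Δ ⊗_B Δ'`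
(`Δ' = B ⊗_k V ≅ Δ`) of `H`-`H`-bimodules, where the right `H`-action on `Δ'` is induced by
the left action via `ω`, intertwining `ω` with the switch map
`v ⊗ b ⊗ b' ⊗ w ↦ w ⊗ iB(b') ⊗ iB(b) ⊗ v`. -/
def IsAffineCellIdeal (k : Type) [Field k] (H : Type) [Ring H] [Algebra k H]
    (ω : H →ₗ[k] H) (J : TwoSidedIdeal H) : Prop :=
  (∀ x : H, x ∈ J ↔ ω x ∈ J) ∧
  ∃ (nV N : ℕ) (Id : Ideal (MvPolynomial (Fin N) k))
    (iB : (MvPolynomial (Fin N) k ⧸ Id) ≃ₐ[k] (MvPolynomial (Fin N) k ⧸ Id)),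
    (∀ b, iB (iB b) = b) ∧
    ∃ (act : H →ₐ[k] Module.End (MvPolynomial (Fin N) k ⧸ Id)
        (Fin nV → MvPolynomial (Fin N) k ⧸ Id))
      (α : (Submodule.restrictScalars k
          (TwoSidedIdeal.asIdeal J : Ideal H)) ≃ₗ[k]
        TensorProduct (MvPolynomial (Fin N) k ⧸ Id)
          (Fin nV → MvPolynomial (Fin N) k ⧸ Id) (Fin nV → MvPolynomial (Fin N) k ⧸ Id)),
      (∀ (h : H) (x y : (Submodule.restrictScalars k (TwoSidedIdeal.asIdeal J : Ideal H))),
        (y : H) = h * (x : H) →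
          α y = LinearMap.rTensor (Fin nV → MvPolynomial (Fin N) k ⧸ Id) (act h) (α x)) ∧
      (∀ (h : H) (x y : (Submodule.restrictScalars k (TwoSidedIdeal.asIdeal J : Ideal H))),
        (y : H) = (x : H) * h →
          α y = LinearMap.lTensor (Fin nV → MvPolynomial (Fin N) k ⧸ Id) (act (ω h)) (α x)) ∧
      ∃ sw : TensorProduct (MvPolynomial (Fin N) k ⧸ Id)
            (Fin nV → MvPolynomial (Fin N) k ⧸ Id) (Fin nV → MvPolynomial (Fin N) k ⧸ Id)
          →ₗ[k] TensorProduct (MvPolynomial (Fin N) k ⧸ Id)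
            (Fin nV → MvPolynomial (Fin N) k ⧸ Id) (Fin nV → MvPolynomial (Fin N) k ⧸ Id),
        (∀ d d' : Fin nV → MvPolynomial (Fin N) k ⧸ Id,
          sw (TensorProduct.tmul _ d d') =
            TensorProduct.tmul _ (fun j => iB (d' j)) (fun j => iB (d j))) ∧
        (∀ x y : (Submodule.restrictScalars k (TwoSidedIdeal.asIdeal J : Ideal H)),
          (y : H) = ω (x : H) → α y = sw (α x))

/-- `H` admits an affine cell chain of length `n` with respect to the involution `ω`
(formulated recursively: there is an affine cell ideal `J` of `H` and the induced involution
on `H/J` admits a chain of length `n - 1`). -/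
def AffineCellularChain (k : Type) [Field k] :
    ℕ → ∀ (H : Type) [Ring H] [Algebra k H], (H →ₗ[k] H) → Prop
  | 0 => fun H _ _ _ => Subsingleton H
  | n + 1 => fun H _ _ ω =>
    ∃ J : TwoSidedIdeal H, IsAffineCellIdeal k H ω J ∧
      ∃ ω' : J.ringCon.Quotient →ₗ[k] J.ringCon.Quotient,
        (∀ h : H, ω' (RingCon.mk' J.ringCon h) = RingCon.mk' J.ringCon (ω h)) ∧
        AffineCellularChain k n J.ringCon.Quotient ω'

/-- A `k`-algebra `H` is affine cellular with respect to the `k`-involution `ω` if it admits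
a finite affine cell chain. -/
def IsAffineCellular (k : Type) [Field k] (H : Type) [Ring H] [Algebra k H]
    (ω : H →ₗ[k] H) : Prop :=
  IsKInvolution ω ∧ ∃ n : ℕ, AffineCellularChain k n H ω

end VVPaper

namespace VVPaper

/-! ## Affine cellularity from structure constants -/

/-- The structure constant attached to three sets of features: the product of the weights `t f`
over those `f` on which the outer sets agree while the middle one differs. -/
def structConst {R F : Type} [CommRing R] [Fintype F] [DecidableEq F] (t : F → R)
    (u v w : Finset F) : R :=
  ∏ f, if (f ∈ u ↔ f ∈ w) ∧ ¬ (f ∈ v ↔ f ∈ u) then t f else 1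

section structConst

variable {R F : Type} [CommRing R] [Fintype F] [DecidableEq F] (t : F → R)

theorem structConst_symm (u v w : Finset F) : structConst t u v w = structConst t w v u := by
  refine Finset.prod_congr rfl fun f _ => ?_
  by_cases h1 : f ∈ u <;> by_cases h2 : f ∈ v <;> by_cases h3 : f ∈ w <;> simp [h1, h2, h3]

theorem structConst_assoc (u v w x : Finset F) :
    structConst t u v w * structConst t u w x = structConst t u v x * structConst t v w x := by
  simp only [structConst, ← Finset.prod_mul_distrib]
  refine Finset.prod_congr rfl fun f _ => ?_
  by_cases h1 : f ∈ u <;> by_cases h2 : f ∈ v <;> by_cases h3 : f ∈ w <;>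
    by_cases h4 : f ∈ x <;> simp [h1, h2, h3, h4]

theorem structConst_left (u v : Finset F) : structConst t u u v = 1 :=
  Finset.prod_eq_one fun f _ => by simp

theorem structConst_right (u v : Finset F) : structConst t u v v = 1 :=
  Finset.prod_eq_one fun f _ => by
    by_cases h1 : f ∈ u <;> by_cases h2 : f ∈ v <;> simp [h1, h2]

theorem dvd_structConst {u v w : Finset F} {f : F} (h : f ∈ u ↔ f ∈ w) (h' : ¬ (f ∈ v ↔ f ∈ u)) :
    t f ∣ structConst t u v w := by
  have := Finset.dvd_prod_of_mem
    (fun f => if (f ∈ u ↔ f ∈ w) ∧ ¬ (f ∈ v ↔ f ∈ u) then t f else 1) (Finset.mem_univ f)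
  rwa [if_pos (And.intro h h')] at this

theorem structConst_erase_dvd {u v w : Finset F} {f : F} (h : ¬ (f ∈ u ∧ f ∈ w)) :
    structConst t u (v.erase f) w ∣ structConst t u v w := by
  refine Finset.prod_dvd_prod_of_dvd _ _ fun g _ => ?_
  by_cases hg : g = f
  · subst hg
    have : ¬ ((g ∈ u ↔ g ∈ w) ∧ ¬ (g ∈ v.erase g ↔ g ∈ u)) := by
      simp only [Finset.mem_erase]; tauto
    rw [if_neg this]
    exact one_dvd _
  · simp [hg]

theorem structConst_erase_mul {u v w : Finset F} {f : F} (hu : f ∈ u) (hw : f ∈ w) (hv : f ∈ v) :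
    structConst t u (v.erase f) w = t f * structConst t u v w := by
  have : t f = ∏ g, if g = f then t g else 1 := by simp
  rw [this, structConst, structConst, ← Finset.prod_mul_distrib]
  refine Finset.prod_congr rfl fun g _ => ?_
  by_cases hg : g = f
  · subst hg; simp [hu, hw, hv]
  · simp [hg]

end structConst

/-- The ideal generated by the weights of a set of features. -/
abbrev weightIdeal {R F : Type} [CommRing R] (t : F → R) (v : Finset F) : Ideal R :=
  Ideal.span (t '' (v : Set F))

/-- An algebra with involution which has a matrix-unit-like basis with structure constants
`structConst t`. -/
structure CellData (k A T F : Type) (N : ℕ) [Field k] [Ring A] [Algebra k A] [Fintype T]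
    [DecidableEq T] [Fintype F] [DecidableEq F] where
  ω : A →ₗ[k] A
  isInv : IsKInvolution ω
  t : F → MvPolynomial (Fin N) k
  regular : ∀ (v : Finset F) (f : F), f ∉ v → ∀ r, t f * r ∈ weightIdeal t v → r ∈ weightIdeal t v
  φ : T → Finset F
  exists_erase : ∀ i, ∀ f ∈ φ i, ∃ j, φ j = (φ i).erase f
  β : A ≃ₗ[k] (T → T → MvPolynomial (Fin N) k)
  β_mul : ∀ a b i l,
    β (a * b) i l = ∑ j, structConst t (φ i) (φ j) (φ l) * β a i j * β b j l
  β_one : ∀ i j, β 1 i j = if i = j then 1 else 0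
  β_inv : ∀ a i j, β (ω a) i j = β a j i

namespace CellData

variable {k A T F : Type} {N : ℕ} [Field k] [Ring A] [Algebra k A] [Fintype T]
    [DecidableEq T] [Fintype F] [DecidableEq F] (S : CellData k A T F N)

/-- The structure constants. -/
abbrev c (u v w : Finset F) : MvPolynomial (Fin N) k := structConst S.t u v w

/-- The ideal of possible `(i, j)`-coefficients of elements of `S.cellIdeal D`. -/
abbrev coefIdeal (D : Set (Finset F)) (i j : T) : Ideal (MvPolynomial (Fin N) k) :=
  Ideal.span ((fun w => S.c (S.φ i) w (S.φ j)) '' D)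

/-- The ideal spanned by all products of matrix units passing through features in `D`. -/
def cellIdeal (D : Set (Finset F)) : Submodule k A where
  carrier := {a | ∀ i j, S.β a i j ∈ S.coefIdeal D i j}
  add_mem' ha hb i j := by simpa using add_mem (ha i j) (hb i j)
  zero_mem' i j := by simp
  smul_mem' r a ha i j := by
    simpa [MvPolynomial.smul_eq_C_mul] using Ideal.mul_mem_left _ _ (ha i j)

theorem mem_cellIdeal {D : Set (Finset F)} {a : A} :
    a ∈ S.cellIdeal D ↔ ∀ i j, S.β a i j ∈ S.coefIdeal D i j := Iff.rfl

theorem cellIdeal_mono {D E : Set (Finset F)} (h : D ⊆ E) : S.cellIdeal D ≤ S.cellIdeal E :=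
  fun _ ha i j => Ideal.span_mono (Set.image_mono h) (ha i j)

theorem inv_mem_cellIdeal {D : Set (Finset F)} {a : A} (ha : a ∈ S.cellIdeal D) :
    S.ω a ∈ S.cellIdeal D := fun i j => by
  rw [S.β_inv]
  have : S.coefIdeal D i j = S.coefIdeal D j i := by
    simp only [coefIdeal, c, structConst_symm S.t (S.φ i) _ (S.φ j)]
  rw [this]
  exact ha j i

theorem mul_mem_coefIdeal {D : Set (Finset F)} {i j l : T} {r s : MvPolynomial (Fin N) k}
    (h : s ∈ S.coefIdeal D j l) :
    S.c (S.φ i) (S.φ j) (S.φ l) * r * s ∈ S.coefIdeal D i l := by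
  rw [mul_right_comm]
  refine Ideal.mul_mem_right _ _ ?_
  have : S.coefIdeal D j l ≤
      Submodule.comap
        (LinearMap.mulLeft (MvPolynomial (Fin N) k) (S.c (S.φ i) (S.φ j) (S.φ l)))
        (S.coefIdeal D i l) := by
    refine Ideal.span_le.2 ?_
    rintro _ ⟨w, hw, rfl⟩
    change S.c (S.φ i) (S.φ j) (S.φ l) * S.c (S.φ j) w (S.φ l) ∈ S.coefIdeal D i l
    rw [← structConst_assoc]
    exact Ideal.mul_mem_left _ _ (Ideal.subset_span ⟨w, hw, rfl⟩)
  exact this h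

theorem mul_mem_cellIdeal {D : Set (Finset F)} (a : A) {x : A} (hx : x ∈ S.cellIdeal D) :
    a * x ∈ S.cellIdeal D := fun i l => by
  rw [S.β_mul]
  exact Ideal.sum_mem _ fun j _ => S.mul_mem_coefIdeal (hx j l)

theorem mem_mul_cellIdeal {D : Set (Finset F)} {x : A} (a : A) (hx : x ∈ S.cellIdeal D) :
    x * a ∈ S.cellIdeal D := by
  have := S.inv_mem_cellIdeal (S.mul_mem_cellIdeal (S.ω a) (S.inv_mem_cellIdeal hx))
  rwa [S.isInv.map_mul, S.isInv.involutive, S.isInv.involutive] at this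

/-- The coefficient ring of the cell with features `v`. -/
abbrev B (v : Finset F) : Type := MvPolynomial (Fin N) k ⧸ weightIdeal S.t v

/-- The index set of the cell module with features `v`. -/
abbrev Idx (v : Finset F) : Type := {i : T // v ⊆ S.φ i}

theorem dvd_mem_weightIdeal {u v w x : Finset F} (hu : v ⊆ u) (hw : v ⊆ w) (hx : ¬ v ⊆ x) :
    S.c u x w ∈ weightIdeal S.t v := by
  obtain ⟨f, hf, hfx⟩ := Finset.not_subset.1 hx
  refine Ideal.mem_of_dvd _ (dvd_structConst S.t (f := f) ?_ ?_)
    (Ideal.subset_span ⟨f, hf, rfl⟩)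
  · simp [hu hf, hw hf]
  · simp [hfx, hu hf]

theorem sum_idx {M : Type} [AddCommMonoid M] (v : Finset F) (g : T → M)
    (hg : ∀ j, ¬ v ⊆ S.φ j → g j = 0) : ∑ j, g j = ∑ j : S.Idx v, g j := by
  rw [← Finset.sum_subset (Finset.filter_subset (fun j => v ⊆ S.φ j) Finset.univ)
    (fun j _ hj => hg j (by simpa using hj))]
  exact Finset.sum_subtype _ (by simp) _

/-- Matrices of the action on the cell module with features `v`. -/
def cellMatrix (v : Finset F) : A →ₐ[k] Matrix (S.Idx v) (S.Idx v) (S.B v) :=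
  AlgHom.ofLinearMap
    { toFun := fun a => Matrix.of fun i j =>
        Ideal.Quotient.mk _ (S.c (S.φ i) (S.φ j) v * S.β a i j)
      map_add' := fun a b => by ext i j; simp [mul_add]
      map_smul' := fun r a => by
        ext i j
        simp only [map_smul, Pi.smul_apply, mul_smul_comm, Matrix.of_apply, Matrix.smul_apply,
          RingHom.id_apply]
        rfl }
    (by
      ext i j
      by_cases h : i = j
      · subst h; simp [S.β_one, structConst_left]
      · have : (i : T) ≠ j := fun h' => h (Subtype.ext h')
        simp [S.β_one, h, this])
    (fun a b => by
      ext i l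
      simp only [LinearMap.coe_mk, AddHom.coe_mk, Matrix.of_apply, Matrix.mul_apply, S.β_mul,
        Finset.mul_sum, ← map_mul, map_sum]
      have key : ∀ j : T, S.c (S.φ i) (S.φ l) v * (S.c (S.φ i) (S.φ j) (S.φ l) * S.β a i j *
          S.β b j l) =
          S.c (S.φ i) (S.φ j) v * S.β a i j * (S.c (S.φ j) (S.φ l) v * S.β b j l) := fun j => by
        linear_combination (S.β a i j * S.β b j l) *
          structConst_assoc S.t (S.φ i) (S.φ j) (S.φ l) v
      rw [Finset.sum_congr rfl fun j _ => congrArg _ (key j)]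
      refine S.sum_idx v _ fun j hj => Ideal.Quotient.eq_zero_iff_mem.2 ?_
      exact Ideal.mul_mem_right _ _ (Ideal.mul_mem_right _ _
        (S.dvd_mem_weightIdeal i.2 subset_rfl hj)))

theorem cellMatrix_apply (v : Finset F) (a : A) (i j : S.Idx v) :
    S.cellMatrix v a i j = Ideal.Quotient.mk _ (S.c (S.φ i) (S.φ j) v * S.β a i j) := rfl

section Layer

variable {S} {D : Set (Finset F)} {v : Finset F} (hD : ∀ w ∈ D, ¬ v ⊆ w)
  (hv : ∀ f ∈ v, v.erase f ∈ D)

include hD in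
theorem coefIdeal_le {i j : T} (hi : v ⊆ S.φ i) (hj : v ⊆ S.φ j) :
    S.coefIdeal D i j ≤ weightIdeal S.t v := by
  refine Ideal.span_le.2 ?_
  rintro _ ⟨w, hw, rfl⟩
  exact S.dvd_mem_weightIdeal hi hj (hD w hw)

include hD in
theorem cellMatrix_eq_zero {a : A} (ha : a ∈ S.cellIdeal D) : S.cellMatrix v a = 0 := by
  ext i j
  rw [cellMatrix_apply, Matrix.zero_apply, Ideal.Quotient.eq_zero_iff_mem]
  exact Ideal.mul_mem_left _ _ (coefIdeal_le hD i.2 j.2 (ha i j))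

include hv in
theorem structConst_mem_coefIdeal {i j : T} (h : ¬ (v ⊆ S.φ i ∧ v ⊆ S.φ j)) :
    S.c (S.φ i) v (S.φ j) ∈ S.coefIdeal D i j := by
  obtain ⟨f, hf, hf'⟩ : ∃ f ∈ v, ¬ (f ∈ S.φ i ∧ f ∈ S.φ j) := by
    by_contra! h'
    exact h ⟨fun f hf => (h' f hf).1, fun f hf => (h' f hf).2⟩
  exact Ideal.mem_of_dvd _ (structConst_erase_dvd S.t hf') (Ideal.subset_span ⟨_, hv f hf, rfl⟩)

include hv in
theorem structConst_mul_mem_coefIdeal {i j : T} (hi : v ⊆ S.φ i) (hj : v ⊆ S.φ j)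
    {r : MvPolynomial (Fin N) k} (hr : r ∈ weightIdeal S.t v) :
    S.c (S.φ i) v (S.φ j) * r ∈ S.coefIdeal D i j := by
  have : weightIdeal S.t v ≤ Submodule.comap
      (LinearMap.mulLeft (MvPolynomial (Fin N) k) (S.c (S.φ i) v (S.φ j)))
      (S.coefIdeal D i j) := by
    refine Ideal.span_le.2 ?_
    rintro _ ⟨f, hf, rfl⟩
    change S.c (S.φ i) v (S.φ j) * S.t f ∈ S.coefIdeal D i j
    rw [mul_comm, c, ← structConst_erase_mul S.t (hi hf) (hj hf) hf]
    exact Ideal.subset_span ⟨_, hv f hf, rfl⟩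
  exact this hr

theorem mem_weightIdeal_of_structConst_mul {u w : Finset F} (hu : v ⊆ u)
    {r : MvPolynomial (Fin N) k} (hr : S.c u v w * r ∈ weightIdeal S.t v) :
    r ∈ weightIdeal S.t v := by
  refine Finset.prod_induction (fun f => if (f ∈ u ↔ f ∈ w) ∧ ¬ (f ∈ v ↔ f ∈ u) then S.t f else 1)
    (fun x => ∀ r, x * r ∈ weightIdeal S.t v → r ∈ weightIdeal S.t v) (s := Finset.univ)
    ?_ ?_ ?_ r hr
  · intro x y hx hy r h
    exact hy _ (hx _ (by rwa [← mul_assoc]))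
  · intro r h
    simpa using h
  · intro f _ r h
    by_cases hf : f ∈ v
    · simpa [hf, hu hf] using h
    · split_ifs at h
      · exact S.regular v f hf r h
      · simpa using h

variable (S v) in
/-- Extension of a matrix by zero. -/
def extend (M : S.Idx v → S.Idx v → MvPolynomial (Fin N) k) (i j : T) : MvPolynomial (Fin N) k :=
  if h : v ⊆ S.φ i ∧ v ⊆ S.φ j then M ⟨i, h.1⟩ ⟨j, h.2⟩ else 0

theorem extend_coe (M : S.Idx v → S.Idx v → MvPolynomial (Fin N) k) (i j : S.Idx v) :
    extend S v M i j = M i j := dif_pos ⟨i.2, j.2⟩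

theorem extend_of_not (M : S.Idx v → S.Idx v → MvPolynomial (Fin N) k) {i j : T}
    (h : ¬ (v ⊆ S.φ i ∧ v ⊆ S.φ j)) : extend S v M i j = 0 := dif_neg h

variable (S v) in
/-- The combination of the products of matrix units passing through `v` with given
coefficients. -/
def layer : (S.Idx v → S.Idx v → MvPolynomial (Fin N) k) →ₗ[k] A :=
  S.β.symm.toLinearMap ∘ₗ
    { toFun := fun M i j => S.c (S.φ i) v (S.φ j) * extend S v M i j
      map_add' := fun M M' => by
        funext i j
        by_cases h : v ⊆ S.φ i ∧ v ⊆ S.φ j <;> simp [extend, h, mul_add]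
      map_smul' := fun r M => by
        funext i j
        by_cases h : v ⊆ S.φ i ∧ v ⊆ S.φ j <;> simp [extend, h] }

theorem β_layer (M : S.Idx v → S.Idx v → MvPolynomial (Fin N) k) (i j : T) :
    S.β (layer S v M) i j = S.c (S.φ i) v (S.φ j) * extend S v M i j := by
  simp [layer]

theorem layer_mem (M : S.Idx v → S.Idx v → MvPolynomial (Fin N) k) :
    layer S v M ∈ S.cellIdeal (insert v D) := fun i j => by
  rw [β_layer]
  exact Ideal.mul_mem_right _ _ (Ideal.subset_span ⟨v, Set.mem_insert _ _, rfl⟩)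

include hv in
theorem exists_layer {a : A} (ha : a ∈ S.cellIdeal (insert v D)) :
    ∃ M, a - layer S v M ∈ S.cellIdeal D := by
  have h : ∀ i j, ∃ r, S.β a i j - S.c (S.φ i) v (S.φ j) * r ∈ S.coefIdeal D i j := by
    intro i j
    have := ha i j
    rw [coefIdeal, Set.image_insert_eq, Ideal.mem_span_insert] at this
    obtain ⟨r, z, hz, h⟩ := this
    exact ⟨r, by rw [h]; convert hz using 1; ring⟩
  choose r hr using h
  refine ⟨fun i j => r i j, fun i j => ?_⟩
  rw [map_sub, Pi.sub_apply, Pi.sub_apply, β_layer]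
  by_cases h : v ⊆ S.φ i ∧ v ⊆ S.φ j
  · simpa [extend, h] using hr i j
  · rw [extend_of_not _ h, mul_zero, sub_zero]
    have := add_mem (hr i j) (Ideal.mul_mem_right (r i j) _ (structConst_mem_coefIdeal hv h))
    simpa using this

include hD hv in
theorem layer_mem_iff {M : S.Idx v → S.Idx v → MvPolynomial (Fin N) k} :
    layer S v M ∈ S.cellIdeal D ↔ ∀ i j, M i j ∈ weightIdeal S.t v := by
  constructor
  · intro h i j
    have := coefIdeal_le hD i.2 j.2 (h i j)
    rw [β_layer, extend_coe] at this
    exact mem_weightIdeal_of_structConst_mul i.2 this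
  · intro h i j
    rw [β_layer]
    by_cases h' : v ⊆ S.φ i ∧ v ⊆ S.φ j
    · simpa [extend, h'] using structConst_mul_mem_coefIdeal hv h'.1 h'.2 (h ⟨i, h'.1⟩ ⟨j, h'.2⟩)
    · rw [extend_of_not _ h', mul_zero]
      exact zero_mem _

include hv in
theorem mul_layer (a : A) (M : S.Idx v → S.Idx v → MvPolynomial (Fin N) k) :
    a * layer S v M - layer S v
      (fun i j => ∑ l : S.Idx v, S.c (S.φ i) (S.φ l) v * S.β a i l * M l j) ∈
      S.cellIdeal D := fun i j => by
  rw [map_sub, Pi.sub_apply, Pi.sub_apply, β_layer, S.β_mul]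
  by_cases hj : v ⊆ S.φ j
  · have hsum : ∑ l, S.c (S.φ i) (S.φ l) (S.φ j) * S.β a i l * S.β (layer S v M) l j =
        S.c (S.φ i) v (S.φ j) *
          ∑ l : S.Idx v, S.c (S.φ i) (S.φ l) v * S.β a i l * M l ⟨j, hj⟩ := by
      rw [S.sum_idx v, Finset.mul_sum]
      · refine Finset.sum_congr rfl fun l _ => ?_
        have : extend S v M l j = M l ⟨j, hj⟩ := extend_coe M l ⟨j, hj⟩
        rw [β_layer, this]
        linear_combination (-S.β a i l * M l ⟨j, hj⟩) *
          structConst_assoc S.t (S.φ i) (S.φ l) v (S.φ j)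
      · intro l hl
        rw [β_layer, extend_of_not _ fun h => hl h.1, mul_zero, mul_zero]
    rw [hsum]
    by_cases hi : v ⊆ S.φ i
    · have := extend_coe (S := S) (v := v)
        (fun i j => ∑ l : S.Idx v, S.c (S.φ i) (S.φ l) v * S.β a i l * M l j) ⟨i, hi⟩ ⟨j, hj⟩
      rw [this, sub_self]
      exact zero_mem _
    · rw [extend_of_not _ fun h => hi h.1, mul_zero, sub_zero]
      exact Ideal.mul_mem_right _ _ (structConst_mem_coefIdeal hv fun h => hi h.1)
  · rw [extend_of_not _ fun h => hj h.2, mul_zero, sub_zero]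
    refine Ideal.sum_mem _ fun l _ => ?_
    rw [β_layer, extend_of_not _ fun h => hj h.2, mul_zero, mul_zero]
    exact zero_mem _

theorem inv_layer (M : S.Idx v → S.Idx v → MvPolynomial (Fin N) k) :
    S.ω (layer S v M) = layer S v fun i j => M j i := by
  apply S.β.injective
  funext i j
  rw [S.β_inv, β_layer, β_layer, c, structConst_symm]
  congr 1
  by_cases h : v ⊆ S.φ i ∧ v ⊆ S.φ j
  · simp [extend, h]
  · rw [extend_of_not _ h, extend_of_not _ fun h' => h h'.symm]

end Layer

end CellData

/-! ### Tensor squares of free modules -/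

section TensorSquare

variable {B ι : Type} [CommRing B] [Fintype ι] [DecidableEq ι]

/-- Coordinates on the tensor square of a free module. -/
def tensorCoord (B ι : Type) [CommRing B] [Fintype ι] [DecidableEq ι] :
    TensorProduct B (ι → B) (ι → B) ≃ₗ[B] (ι × ι → B) :=
  ((Pi.basisFun B ι).tensorProduct (Pi.basisFun B ι)).equivFun

theorem tensorCoord_tmul (d d' : ι → B) (a b : ι) :
    tensorCoord B ι (d ⊗ₜ d') (a, b) = d a * d' b := by
  simp [tensorCoord, mul_comm]

theorem tensorCoord_comm (z : TensorProduct B (ι → B) (ι → B)) (a b : ι) :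
    tensorCoord B ι (TensorProduct.comm B _ _ z) (a, b) = tensorCoord B ι z (b, a) := by
  induction z with
  | zero => simp
  | add x y hx hy => simp [hx, hy]
  | tmul d d' => simp [tensorCoord_tmul, mul_comm]

theorem tensorCoord_rTensor (M : Matrix ι ι B) (z : TensorProduct B (ι → B) (ι → B)) (a b : ι) :
    tensorCoord B ι (LinearMap.rTensor (ι → B) (Matrix.toLin' M) z) (a, b) =
      ∑ c, M a c * tensorCoord B ι z (c, b) := by
  induction z with
  | zero => simp
  | add x y hx hy => simp [hx, hy, mul_add, Finset.sum_add_distrib]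
  | tmul d d' =>
    simp [tensorCoord_tmul, Matrix.mulVec, dotProduct, Finset.sum_mul, mul_assoc]

theorem comm_lTensor (L : Module.End B (ι → B)) (z : TensorProduct B (ι → B) (ι → B)) :
    TensorProduct.comm B _ _ (LinearMap.lTensor (ι → B) L z) =
      LinearMap.rTensor (ι → B) L (TensorProduct.comm B _ _ z) := by
  induction z with
  | zero => simp
  | add x y hx hy => simp [hx, hy]
  | tmul d d' => simp

end TensorSquare

/-- Two surjective linear maps with the same kernel have isomorphic targets. -/
theorem exists_linearEquiv_of_ker_eq {k X Y Z : Type} [Field k] [AddCommGroup X] [AddCommGroup Y]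
    [AddCommGroup Z] [Module k X] [Module k Y] [Module k Z] (g : X →ₗ[k] Y) (h : X →ₗ[k] Z)
    (hg : Function.Surjective g) (hh : Function.Surjective h) (hk : ∀ x, g x = 0 ↔ h x = 0) :
    ∃ e : Y ≃ₗ[k] Z, ∀ x, e (g x) = h x := by
  have : LinearMap.ker g = LinearMap.ker h := by ext x; simpa using hk x
  refine ⟨(g.quotKerEquivOfSurjective hg).symm ≪≫ₗ Submodule.quotEquivOfEq _ _ this ≪≫ₗ
    h.quotKerEquivOfSurjective hh, fun x => ?_⟩
  have : (g.quotKerEquivOfSurjective hg).symm (g x) = Submodule.Quotient.mk x := by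
    rw [LinearEquiv.symm_apply_eq]; rfl
  simp only [LinearEquiv.trans_apply, this]
  rfl

/-- A linear map which vanishes on the kernel of a surjection descends. -/
theorem exists_linearMap_of_ker_le {k X Y Z : Type} [Field k] [AddCommGroup X] [AddCommGroup Y]
    [AddCommGroup Z] [Module k X] [Module k Y] [Module k Z] (g : X →ₗ[k] Y) (h : X →ₗ[k] Z)
    (hg : Function.Surjective g) (hk : ∀ x, g x = 0 → h x = 0) :
    ∃ e : Y →ₗ[k] Z, ∀ x, e (g x) = h x := by
  refine ⟨(LinearMap.ker g).liftQ h (fun x hx => by simpa using hk x hx) ∘ₗ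
    (g.quotKerEquivOfSurjective hg).symm.toLinearMap, fun x => ?_⟩
  have : (g.quotKerEquivOfSurjective hg).symm (g x) = Submodule.Quotient.mk x := by
    rw [LinearEquiv.symm_apply_eq]; rfl
  simp only [LinearMap.comp_apply, LinearEquiv.coe_coe, this]
  rfl

/-- An algebra homomorphism which vanishes on the kernel of a surjection descends. -/
theorem exists_algHom_of_ker_le {k X Y Z : Type} [Field k] [Ring X] [Ring Y] [Ring Z]
    [Algebra k X] [Algebra k Y] [Algebra k Z] (g : X →ₐ[k] Y) (h : X →ₐ[k] Z)
    (hg : Function.Surjective g) (hk : ∀ x, g x = 0 → h x = 0) :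
    ∃ e : Y →ₐ[k] Z, ∀ x, e (g x) = h x := by
  obtain ⟨e, he⟩ := exists_linearMap_of_ker_le g.toLinearMap h.toLinearMap hg hk
  replace he : ∀ x, e (g x) = h x := he
  refine ⟨AlgHom.ofLinearMap e (by rw [← map_one g, he, map_one]) fun a b => ?_, he⟩
  obtain ⟨a, rfl⟩ := hg a
  obtain ⟨b, rfl⟩ := hg b
  rw [← map_mul, he, he, he, map_mul]

namespace CellData

variable {k A T F : Type} {N : ℕ} [Field k] [Ring A] [Algebra k A] [Fintype T]
    [DecidableEq T] [Fintype F] [DecidableEq F] (S : CellData k A T F N)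

section Quotient

variable {H : Type} [Ring H] [Algebra k H] (ψ : A →ₐ[k] H) (hψ : Function.Surjective ψ)

/-- The image of `S.cellIdeal E` in a quotient of `A`. -/
def imageIdeal (E : Set (Finset F)) : TwoSidedIdeal H :=
  TwoSidedIdeal.mk' {y | ∃ x ∈ S.cellIdeal E, ψ x = y}
    ⟨0, zero_mem _, map_zero ψ⟩
    (by rintro _ _ ⟨x, hx, rfl⟩ ⟨y, hy, rfl⟩; exact ⟨x + y, add_mem hx hy, map_add _ _ _⟩)
    (by rintro _ ⟨x, hx, rfl⟩; exact ⟨-x, neg_mem hx, map_neg _ _⟩)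
    (by
      rintro a _ ⟨x, hx, rfl⟩
      obtain ⟨a, rfl⟩ := hψ a
      exact ⟨a * x, S.mul_mem_cellIdeal a hx, map_mul _ _ _⟩)
    (by
      rintro _ a ⟨x, hx, rfl⟩
      obtain ⟨a, rfl⟩ := hψ a
      exact ⟨x * a, S.mem_mul_cellIdeal a hx, map_mul _ _ _⟩)

theorem mem_imageIdeal {E : Set (Finset F)} {y : H} :
    y ∈ S.imageIdeal ψ hψ E ↔ ∃ x ∈ S.cellIdeal E, ψ x = y :=
  TwoSidedIdeal.mem_mk' _ _ _ _ _ _ _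

theorem apply_mem_imageIdeal {D E : Set (Finset F)} (hDE : D ⊆ E)
    (hker : ∀ a, ψ a = 0 ↔ a ∈ S.cellIdeal D) {a : A} :
    ψ a ∈ S.imageIdeal ψ hψ E ↔ a ∈ S.cellIdeal E := by
  rw [mem_imageIdeal]
  refine ⟨?_, fun h => ⟨a, h, rfl⟩⟩
  rintro ⟨x, hx, h⟩
  have : a - x ∈ S.cellIdeal D := (hker _).1 (by rw [map_sub, h, sub_self])
  simpa using add_mem (S.cellIdeal_mono hDE this) hx

include hψ in
theorem isAffineCellIdeal {D : Set (Finset F)} {v : Finset F} (hD : ∀ w ∈ D, ¬ v ⊆ w)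
    (hv : ∀ f ∈ v, v.erase f ∈ D) (hker : ∀ a, ψ a = 0 ↔ a ∈ S.cellIdeal D)
    (ω' : H →ₗ[k] H) (hω' : ∀ a, ω' (ψ a) = ψ (S.ω a)) :
    IsAffineCellIdeal k H ω' (S.imageIdeal ψ hψ (insert v D)) := by
  have hDE : D ⊆ insert v D := Set.subset_insert _ _
  have hmem := fun a => S.apply_mem_imageIdeal ψ hψ hDE hker (a := a)
  have hinv : ∀ x, ω' (ω' x) = x := fun x => by
    obtain ⟨a, rfl⟩ := hψ x
    rw [hω', hω', S.isInv.involutive]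
  have hanti : ∀ x y, ω' (x * y) = ω' y * ω' x := fun x y => by
    obtain ⟨a, rfl⟩ := hψ x
    obtain ⟨b, rfl⟩ := hψ y
    rw [← map_mul, hω', hω', hω', S.isInv.map_mul, map_mul]
  have hJ : ∀ x ∈ S.imageIdeal ψ hψ (insert v D), ω' x ∈ S.imageIdeal ψ hψ (insert v D) := by
    intro x hx
    obtain ⟨a, rfl⟩ := hψ x
    rw [hω', hmem]
    exact S.inv_mem_cellIdeal ((hmem a).1 hx)
  refine ⟨fun x => ⟨hJ x, fun h => by simpa [hinv] using hJ _ h⟩, ?_⟩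
  let e := (Fintype.equivFin (S.Idx v)).symm
  refine ⟨Fintype.card (S.Idx v), N, weightIdeal S.t v, AlgEquiv.refl, fun _ => rfl, ?_⟩
  let act₀ : A →ₐ[k] Module.End (S.B v) (Fin (Fintype.card (S.Idx v)) → S.B v) :=
    (((Matrix.toLinAlgEquiv' (R := S.B v)
      (n := Fin (Fintype.card (S.Idx v)))).restrictScalars k).toAlgHom.comp
      (Matrix.reindexAlgEquiv k (S.B v) e.symm).toAlgHom).comp (S.cellMatrix v)
  have hact₀ : ∀ a, act₀ a = Matrix.toLin' ((S.cellMatrix v a).submatrix e e) := fun a => rfl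
  obtain ⟨act, hact⟩ := exists_algHom_of_ker_le ψ act₀ hψ fun a ha => by
    rw [hact₀, cellMatrix_eq_zero hD ((hker a).1 ha)]
    simp
  let g : (S.Idx v → S.Idx v → MvPolynomial (Fin N) k) →ₗ[k]
      (Submodule.restrictScalars k
        (TwoSidedIdeal.asIdeal (S.imageIdeal ψ hψ (insert v D)) : Ideal H)) :=
    (ψ.toLinearMap ∘ₗ layer S v).codRestrict _ fun M => (hmem _).2 (layer_mem M)
  have hg : ∀ M, ((g M : _) : H) = ψ (layer S v M) := fun M => rfl
  let h : (S.Idx v → S.Idx v → MvPolynomial (Fin N) k) →ₗ[k]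
      TensorProduct (S.B v) (Fin (Fintype.card (S.Idx v)) → S.B v)
        (Fin (Fintype.card (S.Idx v)) → S.B v) :=
    ((tensorCoord (S.B v) (Fin (Fintype.card (S.Idx v)))).symm.restrictScalars k).toLinearMap ∘ₗ
      { toFun := fun M ab => Ideal.Quotient.mk _ (M (e ab.1) (e ab.2))
        map_add' := fun M M' => by funext; simp
        map_smul' := fun r M => by funext; rfl }
  have hh : ∀ M a b, tensorCoord _ _ (h M) (a, b) = Ideal.Quotient.mk _ (M (e a) (e b)) := by
    intro M a b
    simp [h]
  have hgs : Function.Surjective g := by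
    rintro ⟨y, hy⟩
    obtain ⟨a, ha, rfl⟩ := (S.mem_imageIdeal ψ hψ).1 hy
    obtain ⟨M, hM⟩ := exists_layer hv ha
    refine ⟨M, Subtype.ext ?_⟩
    have := (hker _).2 hM
    rw [map_sub, sub_eq_zero] at this
    exact this.symm
  have hhs : Function.Surjective h := by
    intro z
    choose r hr using fun b : S.B v => Ideal.Quotient.mk_surjective b
    refine ⟨fun i j => r (tensorCoord _ _ z (e.symm i, e.symm j)), ?_⟩
    apply (tensorCoord _ _).injective
    funext ⟨a, b⟩
    rw [hh, hr]
    simp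
  have hk : ∀ M, g M = 0 ↔ h M = 0 := by
    intro M
    rw [Subtype.ext_iff, hg]
    change ψ (layer S v M) = 0 ↔ _
    rw [hker, layer_mem_iff hD hv, ← (tensorCoord _ _).map_eq_zero_iff]
    constructor
    · intro h'
      funext ⟨a, b⟩
      rw [hh]
      exact Ideal.Quotient.eq_zero_iff_mem.2 (h' _ _)
    · intro h' i j
      have := congrFun h' (e.symm i, e.symm j)
      rw [hh] at this
      simpa using Ideal.Quotient.eq_zero_iff_mem.1 this
  obtain ⟨α, hα⟩ := exists_linearEquiv_of_ker_eq g h hgs hhs hk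
  have hleft : ∀ (b : H) (x y : (Submodule.restrictScalars k
      (TwoSidedIdeal.asIdeal (S.imageIdeal ψ hψ (insert v D)) : Ideal H))),
      (y : H) = b * (x : H) → α y = LinearMap.rTensor _ (act b) (α x) := by
    intro b x y hxy
    obtain ⟨a, rfl⟩ := hψ b
    obtain ⟨M, rfl⟩ := hgs x
    have hy : y = g fun i j => ∑ l : S.Idx v, S.c (S.φ i) (S.φ l) v * S.β a i l * M l j := by
      apply Subtype.ext
      have := (hker _).2 (mul_layer hv a M)
      rw [map_sub, sub_eq_zero, map_mul] at this
      rw [hxy, hg, hg, this]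
    rw [hy, hα, hα, hact, hact₀]
    apply (tensorCoord _ _).injective
    funext ⟨a', b'⟩
    rw [tensorCoord_rTensor, hh, map_sum, ← e.sum_comp]
    refine Finset.sum_congr rfl fun l _ => ?_
    rw [hh, map_mul]
    rfl
  have hsw : ∀ x y : (Submodule.restrictScalars k
      (TwoSidedIdeal.asIdeal (S.imageIdeal ψ hψ (insert v D)) : Ideal H)),
      (y : H) = ω' (x : H) → α y = TensorProduct.comm (S.B v) _ _ (α x) := by
    intro x y hxy
    obtain ⟨M, rfl⟩ := hgs x
    have hy : y = g fun i j => M j i := by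
      apply Subtype.ext
      rw [hxy, hg, hg, hω', inv_layer]
    rw [hy, hα, hα]
    apply (tensorCoord _ _).injective
    funext ⟨a', b'⟩
    rw [tensorCoord_comm, hh, hh]
  refine ⟨act, α, hleft, ?_,
    (TensorProduct.comm (S.B v) _ _).toLinearMap.restrictScalars k, fun d d' => rfl, hsw⟩
  intro b x y hxy
  have hx := hsw x ⟨ω' x, hJ _ x.2⟩ rfl
  have hy := hsw y ⟨ω' y, hJ _ y.2⟩ rfl
  have := hleft (ω' b) ⟨ω' x, hJ _ x.2⟩ ⟨ω' y, hJ _ y.2⟩ (by simp [hxy, hanti])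
  rw [hx, hy] at this
  apply (TensorProduct.comm (S.B v) _ _).injective
  rw [this]
  exact (comm_lTensor _ _).symm

end Quotient

open Classical in
theorem exists_affineCellularChain (n : ℕ) (D : Set (Finset F))
    (hn : (Finset.univ.filter fun i => S.φ i ∉ D).card = n)
    (hD : ∀ i, ∀ w ∈ D, S.φ i ⊆ w → S.φ i ∈ D)
    (H : Type) [Ring H] [Algebra k H] (ψ : A →ₐ[k] H) (hψ : Function.Surjective ψ)
    (hker : ∀ a, ψ a = 0 ↔ a ∈ S.cellIdeal D)
    (ω' : H →ₗ[k] H) (hω' : ∀ a, ω' (ψ a) = ψ (S.ω a)) :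
    ∃ n, AffineCellularChain k n H ω' := by
  induction n using Nat.strong_induction_on generalizing D H with
  | _ n ih =>
  by_cases hall : ∀ i, S.φ i ∈ D
  · refine ⟨0, ?_⟩
    refine subsingleton_of_zero_eq_one ?_
    rw [← map_one ψ]
    refine ((hker 1).2 fun i j => ?_).symm
    have : S.c (S.φ i) (S.φ i) (S.φ j) ∈ S.coefIdeal D i j :=
      Ideal.subset_span ⟨_, hall i, rfl⟩
    rw [c, structConst_left] at this
    simpa using Ideal.mul_mem_left _ (S.β 1 i j) this
  · push Not at hall
    have hne : (Finset.univ.filter fun i => S.φ i ∉ D).Nonempty := by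
      obtain ⟨i, hi⟩ := hall
      exact ⟨i, by simpa using hi⟩
    obtain ⟨r, hr, hmin⟩ := Finset.exists_min_image _ (fun i => (S.φ i).card) hne
    simp only [Finset.mem_filter, Finset.mem_univ, true_and] at hr hmin
    have hlt : ∀ i, S.φ i ⊂ S.φ r → S.φ i ∈ D := fun i hi => by
      by_contra h
      exact absurd (hmin i h) (not_le.2 (Finset.card_lt_card hi))
    have h1 : ∀ w ∈ D, ¬ S.φ r ⊆ w := fun w hw h => hr (hD r w hw h)
    have h2 : ∀ f ∈ S.φ r, (S.φ r).erase f ∈ D := fun f hf => by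
      obtain ⟨j, hj⟩ := S.exists_erase r f hf
      rw [← hj]
      exact hlt j (hj ▸ Finset.erase_ssubset hf)
    let J := S.imageIdeal ψ hψ (insert (S.φ r) D)
    have hmem := fun a => S.apply_mem_imageIdeal ψ hψ (Set.subset_insert (S.φ r) D) hker (a := a)
    have hcell := S.isAffineCellIdeal ψ hψ h1 h2 hker ω' hω'
    let mk : H →ₐ[k] J.ringCon.Quotient :=
      { RingCon.mk' J.ringCon with commutes' := fun _ => rfl }
    have hmk : Function.Surjective mk := RingCon.mk'_surjective _
    have hmk0 : ∀ x, mk x = 0 ↔ x ∈ J := fun x => by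
      rw [TwoSidedIdeal.mem_iff, ← RingCon.eq]; rfl
    obtain ⟨ω'', hω''⟩ := exists_linearMap_of_ker_le mk.toLinearMap (mk.toLinearMap ∘ₗ ω') hmk
      fun x hx => (hmk0 _).2 ((hcell.1 x).1 ((hmk0 _).1 hx))
    replace hω'' : ∀ x, ω'' (mk x) = mk (ω' x) := hω''
    obtain ⟨n', hn'⟩ := ih _ (by
        rw [← hn]
        refine Finset.card_lt_card ?_
        rw [Finset.ssubset_iff_of_subset]
        · exact ⟨r, by simpa using hr, by simp⟩
        · intro i
          simp only [Finset.mem_filter, Finset.mem_univ, true_and, Set.mem_insert_iff, not_or]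
          exact fun h => h.2)
      (insert (S.φ r) D) rfl
      (by
        rintro i w (rfl | hw) h
        · by_cases he : S.φ i = S.φ r
          · exact Or.inl he
          · exact Or.inr (hlt i (Finset.ssubset_iff_subset_ne.2 ⟨h, he⟩))
        · exact Or.inr (hD i w hw h))
      J.ringCon.Quotient (mk.comp ψ) (hmk.comp hψ)
      (fun a => by rw [← hmem]; exact hmk0 _) ω''
      (fun a => by
        change ω'' (mk (ψ a)) = mk (ψ (S.ω a))
        rw [hω'', hω'])
    exact ⟨n' + 1, J, hcell, ω'', hω'', hn'⟩

theorem isAffineCellular : IsAffineCellular k A S.ω := by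
  refine ⟨S.isInv, S.exists_affineCellularChain _ ∅ rfl (by simp) A (AlgHom.id k A)
    Function.surjective_id (fun a => ?_) S.ω fun _ => rfl⟩
  rw [S.mem_cellIdeal]
  simp only [coefIdeal, Set.image_empty, Ideal.span_empty, Ideal.mem_bot]
  constructor
  · rintro h
    have : a = 0 := h
    simp [this]
  · intro h
    apply S.β.injective
    funext i j
    simp [h i j]

end CellData

/-! ### Sequences of multiplicity one -/

section ThetaSeq

open scoped Classical

variable {k : Type} [Field k] {m : ℕ}

/-- Inversion of the first entry of a sequence, the action of `π` on sequences. -/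
def flipAt (h0 : 0 < m) (i : Fin m → kˣ) : Fin m → kˣ :=
  Function.update i ⟨0, h0⟩ (i ⟨0, h0⟩)⁻¹

theorem swapAt_swapAt {V : Type} (s : Fin (m - 1)) (i : Fin m → V) :
    swapAt s (swapAt s i) = i := by
  funext l; simp [swapAt]

theorem flipAt_flipAt (h0 : 0 < m) (i : Fin m → kˣ) : flipAt h0 (flipAt h0 i) = i := by
  funext l
  by_cases h : l = ⟨0, h0⟩
  · subst h; simp [flipAt]
  · simp [flipAt, h]

theorem flipAt_zero (h0 : 0 < m) (i : Fin m → kˣ) :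
    flipAt h0 i ⟨0, h0⟩ = (i ⟨0, h0⟩)⁻¹ := by simp [flipAt]

theorem flipAt_of_pos (h0 : 0 < m) (i : Fin m → kˣ) {l : Fin m} (hl : 0 < l.1) :
    flipAt h0 i l = i l := by
  have : l ≠ ⟨0, h0⟩ := fun h => by simp [h] at hl
  simp [flipAt, this]

theorem lo_ne_hi (s : Fin (m - 1)) : lo s ≠ hi s := by simp [lo, hi, Fin.ext_iff]

theorem swapAt_lo {V : Type} (s : Fin (m - 1)) (i : Fin m → V) : swapAt s i (lo s) = i (hi s) := by
  simp [swapAt]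

theorem swapAt_hi {V : Type} (s : Fin (m - 1)) (i : Fin m → V) : swapAt s i (hi s) = i (lo s) := by
  simp [swapAt]

theorem swapAt_of_ne {V : Type} (s : Fin (m - 1)) (i : Fin m → V) {l : Fin m}
    (h1 : l ≠ lo s) (h2 : l ≠ hi s) : swapAt s i l = i l := by
  simp [swapAt, Equiv.swap_apply_of_ne_of_ne h1 h2]

variable {ν : kˣ →₀ ℕ} {i j : Fin m → kˣ}

theorem isThetaSeq_iff_comp (e : Equiv.Perm (Fin m)) : IsThetaSeq ν (i ∘ e) ↔ IsThetaSeq ν i := by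
  have := Equiv.sum_comp e fun l => Finsupp.single (i l) 1 + Finsupp.single (i l)⁻¹ 1
  exact ⟨this.symm.trans, this.trans⟩

theorem IsThetaSeq.of_forall (hi : IsThetaSeq ν i) (h : ∀ l, j l = i l ∨ j l = (i l)⁻¹) :
    IsThetaSeq ν j := by
  unfold IsThetaSeq at *
  rw [← hi]
  refine Finset.sum_congr rfl fun l _ => ?_
  rcases h l with h | h <;> simp [h, add_comm]

theorem IsThetaSeq.swapAt (hi : IsThetaSeq ν i) (s : Fin (m - 1)) :
    IsThetaSeq ν (swapAt s i) := (isThetaSeq_iff_comp _).2 hi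

theorem IsThetaSeq.flipAt (hi : IsThetaSeq ν i) (h0 : 0 < m) : IsThetaSeq ν (flipAt h0 i) :=
  hi.of_forall fun l => by
    by_cases h : l = ⟨0, h0⟩
    · subst h; simp [VVPaper.flipAt]
    · simp [VVPaper.flipAt, h]

theorem IsThetaSeq.apply (hi : IsThetaSeq ν i) (a : kˣ) :
    ν a = ∑ l, ((if i l = a then 1 else 0) + if (i l)⁻¹ = a then 1 else 0) := by
  rw [← hi]
  simp [Finsupp.finsetSum_apply, Finsupp.single_apply]

theorem IsThetaSeq.ne_zero_iff (hi : IsThetaSeq ν i) (a : kˣ) :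
    ν a ≠ 0 ↔ ∃ l, i l = a ∨ (i l)⁻¹ = a := by
  rw [hi.apply, Ne, Finset.sum_eq_zero_iff]
  push Not
  simp only [Finset.mem_univ, true_and]
  refine exists_congr fun l => ?_
  split_ifs <;> simp_all

theorem IsThetaSeq.apply_ne_zero (hi : IsThetaSeq ν i) (l : Fin m) : ν (i l) ≠ 0 :=
  (hi.ne_zero_iff _).2 ⟨l, Or.inl rfl⟩

theorem IsThetaSeq.apply_inv (hi : IsThetaSeq ν i) (a : kˣ) : ν a⁻¹ = ν a := by
  rw [hi.apply, hi.apply]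
  refine Finset.sum_congr rfl fun l _ => ?_
  rw [add_comm]
  simp [inv_eq_iff_eq_inv]

variable (hν : ∀ a, ν a ≤ 1)

include hν

theorem IsThetaSeq.ne_inv_self (hi : IsThetaSeq ν i) (l : Fin m) : i l ≠ (i l)⁻¹ := by
  intro h
  have h1 := hν (i l)
  rw [hi.apply] at h1
  have := (Finset.single_le_sum (f := fun l' => ((if i l' = i l then 1 else 0) +
    if (i l')⁻¹ = i l then 1 else 0)) (fun _ _ => Nat.zero_le _) (Finset.mem_univ l)).trans h1
  simp [← h] at this

theorem IsThetaSeq.eq_of_apply_eq (hi : IsThetaSeq ν i) {l l' : Fin m} {a : kˣ}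
    (h : i l = a ∨ (i l)⁻¹ = a) (h' : i l' = a ∨ (i l')⁻¹ = a) : l = l' := by
  by_contra hne
  have h1 := hν a
  rw [hi.apply] at h1
  have h2 := (Finset.sum_le_univ_sum_of_nonneg (s := {l, l'})
    (f := fun l => ((if i l = a then 1 else 0) +
    if (i l)⁻¹ = a then 1 else 0)) (fun _ => Nat.zero_le _)).trans h1
  rw [Finset.sum_pair hne] at h2
  rcases h with h | h <;> rcases h' with h' | h' <;> simp [h, h'] at h2 <;> omega

theorem IsThetaSeq.injective (hi : IsThetaSeq ν i) : Function.Injective i := fun _ _ h =>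
  hi.eq_of_apply_eq hν (Or.inl h) (Or.inl rfl)

theorem IsThetaSeq.ne_inv (hi : IsThetaSeq ν i) (l l' : Fin m) : i l ≠ (i l')⁻¹ := by
  intro h
  have := hi.eq_of_apply_eq hν (Or.inl h) (Or.inr rfl)
  subst this
  exact hi.ne_inv_self hν l h

omit hν

/-- The signed position of the letter `a` in a sequence. -/
def signedPos (i : Fin m → kˣ) (a : kˣ) : ℤ :=
  ∑ l, ((if i l = a then ((l.1 : ℤ) + 1) else 0) - if (i l)⁻¹ = a then ((l.1 : ℤ) + 1) else 0)

theorem signedPos_inv (i : Fin m → kˣ) (a : kˣ) : signedPos i a⁻¹ = -signedPos i a := by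
  unfold signedPos
  rw [← Finset.sum_neg_distrib]
  refine Finset.sum_congr rfl fun l _ => ?_
  rw [neg_sub]
  simp [inv_eq_iff_eq_inv]

include hν

theorem IsThetaSeq.signedPos_apply (hi : IsThetaSeq ν i) (l : Fin m) :
    signedPos i (i l) = l.1 + 1 := by
  unfold signedPos
  rw [Finset.sum_eq_single l]
  · simp [(hi.ne_inv_self hν l).symm]
  · intro l' _ hl
    have h1 : i l' ≠ i l := fun h => hl (hi.injective hν h)
    have h2 : (i l')⁻¹ ≠ i l := (hi.ne_inv hν _ _).symm
    simp [h1, h2]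
  · simp

theorem IsThetaSeq.signedPos_apply_inv (hi : IsThetaSeq ν i) (l : Fin m) :
    signedPos i (i l)⁻¹ = -(l.1 + 1) := by
  rw [signedPos_inv, hi.signedPos_apply hν]

theorem IsThetaSeq.signedPos_injOn (hi : IsThetaSeq ν i) {a b : kˣ} (ha : ν a ≠ 0)
    (hb : ν b ≠ 0) (h : signedPos i a = signedPos i b) : a = b := by
  obtain ⟨l, rfl | rfl⟩ := (hi.ne_zero_iff a).1 ha <;>
  obtain ⟨l', rfl | rfl⟩ := (hi.ne_zero_iff b).1 hb <;>
  simp only [hi.signedPos_apply hν, hi.signedPos_apply_inv hν] at h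
  · rw [show l = l' from Fin.ext (by omega)]
  · omega
  · omega
  · rw [show l = l' from Fin.ext (by omega)]

theorem IsThetaSeq.signedPos_ne_zero (hi : IsThetaSeq ν i) {a : kˣ} (ha : ν a ≠ 0) :
    signedPos i a ≠ 0 := by
  obtain ⟨l, rfl | rfl⟩ := (hi.ne_zero_iff a).1 ha <;>
  simp only [hi.signedPos_apply hν, hi.signedPos_apply_inv hν] <;> omega

/-- The relative order of two letters changes under a swap only if these letters
(or their inverses) are the ones being swapped. -/
theorem IsThetaSeq.signedPos_swapAt_lt_iff (hi : IsThetaSeq ν i) (s : Fin (m - 1)) {a b : kˣ}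
    (ha : ν a ≠ 0) (hb : ν b ≠ 0)
    (h1 : ¬ (a = i (lo s) ∧ b = i (VVPaper.hi s))) (h2 : ¬ (b = i (lo s) ∧ a = i (VVPaper.hi s)))
    (h3 : ¬ (a = (i (lo s))⁻¹ ∧ b = (i (VVPaper.hi s))⁻¹))
    (h4 : ¬ (b = (i (lo s))⁻¹ ∧ a = (i (VVPaper.hi s))⁻¹)) :
    signedPos (VVPaper.swapAt s i) a < signedPos (VVPaper.swapAt s i) b ↔
      signedPos i a < signedPos i b := by
  have key : ∀ l, signedPos (VVPaper.swapAt s i) (i l) =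
      (Equiv.swap (lo s) (VVPaper.hi s) l).1 + 1 := fun l => by
    rw [← (hi.swapAt s).signedPos_apply hν]
    simp [VVPaper.swapAt]
  have hlo : (lo s).1 = s.1 := rfl
  have hhi : (VVPaper.hi s).1 = s.1 + 1 := rfl
  have hsw : ∀ l, (l = lo s ∧ (Equiv.swap (lo s) (VVPaper.hi s) l).1 = s.1 + 1) ∨
      (l = VVPaper.hi s ∧ (Equiv.swap (lo s) (VVPaper.hi s) l).1 = s.1) ∨
      (l.1 ≠ s.1 ∧ l.1 ≠ s.1 + 1 ∧ (Equiv.swap (lo s) (VVPaper.hi s) l).1 = l.1) := fun l => by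
    by_cases h1 : l = lo s
    · simp [h1, hhi]
    · by_cases h2 : l = VVPaper.hi s
      · simp [h2, hlo]
      · rw [Equiv.swap_apply_of_ne_of_ne h1 h2]
        exact Or.inr (Or.inr ⟨fun h => h1 (Fin.ext h), fun h => h2 (Fin.ext h), rfl⟩)
  obtain ⟨l, hl⟩ := (hi.ne_zero_iff a).1 ha
  obtain ⟨l', hl'⟩ := (hi.ne_zero_iff b).1 hb
  have hll : (i l = a ∧ i l' = b ∨ (i l)⁻¹ = a ∧ (i l')⁻¹ = b) →
      ¬ (l = lo s ∧ l' = VVPaper.hi s) ∧ ¬ (l' = lo s ∧ l = VVPaper.hi s) := by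
    rintro (⟨rfl, rfl⟩ | ⟨rfl, rfl⟩)
    · exact ⟨fun h => h1 (by simp [h.1, h.2]), fun h => h2 (by simp [h.1, h.2])⟩
    · exact ⟨fun h => h3 (by simp [h.1, h.2]), fun h => h4 (by simp [h.1, h.2])⟩
  have hl1 := hsw l
  have hl1' := hsw l'
  simp only [Fin.ext_iff, hlo, hhi] at hll hl1 hl1'
  rcases hl with rfl | rfl <;> rcases hl' with rfl | rfl <;>
  simp only [hi.signedPos_apply hν, hi.signedPos_apply_inv hν, signedPos_inv, key] <;>
  simp only [true_and, and_true, or_true, true_or, and_self, forall_const] at hll <;> omega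

/-- The relative order of two letters which are not inverse to each other is not affected
by an inversion of the first entry. -/
theorem IsThetaSeq.signedPos_flipAt_lt_iff (hi : IsThetaSeq ν i) (h0 : 0 < m) {a b : kˣ}
    (ha : ν a ≠ 0) (hb : ν b ≠ 0) (hab : a ≠ b⁻¹) :
    signedPos (VVPaper.flipAt h0 i) a < signedPos (VVPaper.flipAt h0 i) b ↔
      signedPos i a < signedPos i b := by
  have key : ∀ l, (l = ⟨0, h0⟩ ∧ signedPos (VVPaper.flipAt h0 i) (i l) = -1) ∨
      (0 < l.1 ∧ signedPos (VVPaper.flipAt h0 i) (i l) = l.1 + 1) := fun l => by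
    have h := (hi.flipAt h0).signedPos_apply hν l
    by_cases hl : l = ⟨0, h0⟩
    · subst hl
      rw [flipAt_zero, signedPos_inv] at h
      left
      simp at h
      exact ⟨rfl, by omega⟩
    · have hl : 0 < l.1 := Nat.pos_of_ne_zero fun h => hl (Fin.ext h)
      rw [flipAt_of_pos h0 i hl] at h
      exact Or.inr ⟨hl, h⟩
  obtain ⟨l, rfl | rfl⟩ := (hi.ne_zero_iff a).1 ha <;>
  obtain ⟨l', rfl | rfl⟩ := (hi.ne_zero_iff b).1 hb <;>
  simp only [hi.signedPos_apply hν, hi.signedPos_apply_inv hν, signedPos_inv] <;>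
  rcases key l with ⟨rfl, e⟩ | ⟨e1, e⟩ <;>
  rcases key l' with ⟨rfl, e'⟩ | ⟨e1', e'⟩ <;>
  simp only [e, e'] <;> simp_all <;> omega

theorem IsThetaSeq.signedPos_flipAt_pos_iff (hi : IsThetaSeq ν i) (h0 : 0 < m) {a : kˣ}
    (ha : ν a ≠ 0) (h1 : a ≠ i ⟨0, h0⟩) (h2 : a ≠ (i ⟨0, h0⟩)⁻¹) :
    0 < signedPos (VVPaper.flipAt h0 i) a ↔ 0 < signedPos i a := by
  obtain ⟨l, rfl | rfl⟩ := (hi.ne_zero_iff a).1 ha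
  all_goals
    have hl : 0 < l.1 := Nat.pos_of_ne_zero fun h => by
      have : l = ⟨0, h0⟩ := Fin.ext h
      subst this
      simp at h1 h2
    have h := (hi.flipAt h0).signedPos_apply hν l
    rw [flipAt_of_pos h0 i hl] at h
    simp only [hi.signedPos_apply hν, signedPos_inv, h]

theorem IsThetaSeq.signedPos_swapAt_pos_iff (hi : IsThetaSeq ν i) (s : Fin (m - 1)) {a : kˣ}
    (ha : ν a ≠ 0) :
    0 < signedPos (VVPaper.swapAt s i) a ↔ 0 < signedPos i a := by
  have key : ∀ l, signedPos (VVPaper.swapAt s i) (i l) =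
      (Equiv.swap (lo s) (VVPaper.hi s) l).1 + 1 := fun l => by
    rw [← (hi.swapAt s).signedPos_apply hν]
    simp [VVPaper.swapAt]
  obtain ⟨l, rfl | rfl⟩ := (hi.ne_zero_iff a).1 ha <;>
  simp only [hi.signedPos_apply hν, signedPos_inv, key] <;> omega

end ThetaSeq

/-! ### Coxeter relations for the action on sequences -/

section Coxeter

variable {k : Type} [Field k] {m : ℕ}

theorem swapAt_apply {V : Type} (s : Fin (m - 1)) (i : Fin m → V) (l : Fin m) :
    swapAt s i l = if l = lo s then i (hi s) else if l = hi s then i (lo s) else i l := by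
  rw [swapAt, Function.comp_apply, Equiv.swap_apply_def]
  split_ifs <;> rfl

theorem flipAt_apply (h0 : 0 < m) (i : Fin m → kˣ) (l : Fin m) :
    flipAt h0 i l = if l = ⟨0, h0⟩ then (i ⟨0, h0⟩)⁻¹ else i l := by
  rw [flipAt, Function.update_apply]

theorem swapAt_comm {V : Type} {s t : Fin (m - 1)} (h : s.1 + 1 < t.1) (i : Fin m → V) :
    swapAt s (swapAt t i) = swapAt t (swapAt s i) := by
  funext l
  simp only [swapAt_apply, Fin.ext_iff, lo, hi]
  split_ifs <;> first | rfl | omega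

theorem swapAt_braid {V : Type} {s t : Fin (m - 1)} (h : t.1 = s.1 + 1) (i : Fin m → V) :
    swapAt s (swapAt t (swapAt s i)) = swapAt t (swapAt s (swapAt t i)) := by
  funext l
  simp only [swapAt_apply, Fin.ext_iff, lo, hi, h]
  split_ifs <;> first | rfl | omega

theorem swapAt_flipAt (h0 : 0 < m) {s : Fin (m - 1)} (h : 0 < s.1) (i : Fin m → kˣ) :
    swapAt s (flipAt h0 i) = flipAt h0 (swapAt s i) := by
  funext l
  simp only [swapAt_apply, flipAt_apply, Fin.ext_iff, lo, hi]
  split_ifs <;> first | rfl | omega | simp_all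

theorem swapAt_flipAt_braid (h0 : 0 < m) {s : Fin (m - 1)} (h : s.1 = 0) (i : Fin m → kˣ) :
    swapAt s (flipAt h0 (swapAt s (flipAt h0 i))) =
      flipAt h0 (swapAt s (flipAt h0 (swapAt s i))) := by
  funext l
  simp only [swapAt_apply, flipAt_apply, Fin.ext_iff, lo, hi, h]
  split_ifs <;> first | rfl | omega | simp_all

end Coxeter

/-! ### Relations in the VV algebra -/

section Relations

variable {k : Type} [Field k] (p q : kˣ) (ν : kˣ →₀ ℕ) {m : ℕ}

theorem vmk_eq_of_rel {a b : FA k m} (h : Rel p q (IsThetaSeq ν) (thetaSeqs ν m) true a b) :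
    vmk p q ν m a = vmk p q ν m b :=
  RingQuot.mkAlgHom_rel k h

theorem vmk_idem_mul (i : Fin m → kˣ) :
    vmk p q ν m (E i) * vmk p q ν m (E i) = vmk p q ν m (E i) := by
  rw [← map_mul]; exact vmk_eq_of_rel p q ν (.idem_mul i)

theorem vmk_idem_orth {i j : Fin m → kˣ} (h : i ≠ j) :
    vmk p q ν m (E i) * vmk p q ν m (E j) = 0 := by
  rw [← map_mul, vmk_eq_of_rel p q ν (.idem_orth i j h), map_zero]

theorem vmk_idem_zero {i : Fin m → kˣ} (h : ¬ IsThetaSeq ν i) : vmk p q ν m (E i) = 0 := by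
  rw [vmk_eq_of_rel p q ν (.idem_zero i h), map_zero]

theorem vmk_idem_sum : ∑ i ∈ thetaSeqs ν m, vmk p q ν m (E i) = 1 := by
  rw [← map_sum, vmk_eq_of_rel p q ν .idem_sum, map_one]

theorem vmk_x_comm (a b : Fin m) :
    vmk p q ν m (X a) * vmk p q ν m (X b) = vmk p q ν m (X b) * vmk p q ν m (X a) := by
  simp only [← map_mul]; exact vmk_eq_of_rel p q ν (.x_mul_comm a b)

theorem vmk_x_idem (a : Fin m) (i : Fin m → kˣ) :
    vmk p q ν m (X a) * vmk p q ν m (E i) = vmk p q ν m (E i) * vmk p q ν m (X a) := by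
  simp only [← map_mul]; exact vmk_eq_of_rel p q ν (.x_idem a i)

theorem vmk_sig_idem (s : Fin (m - 1)) (i : Fin m → kˣ) :
    vmk p q ν m (Sg s) * vmk p q ν m (E i) =
      vmk p q ν m (E (swapAt s i)) * vmk p q ν m (Sg s) := by
  simp only [← map_mul]; exact vmk_eq_of_rel p q ν (.sig_idem s i)

theorem vmk_pi_idem (h0 : 0 < m) (i : Fin m → kˣ) :
    vmk p q ν m Pg * vmk p q ν m (E i) =
      vmk p q ν m (E (flipAt h0 i)) * vmk p q ν m Pg := by
  simp only [← map_mul]; exact vmk_eq_of_rel p q ν (.pi_idem rfl h0 i)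

theorem vmk_sig_comm {s t : Fin (m - 1)} (h : s.1 + 1 < t.1) :
    vmk p q ν m (Sg s) * vmk p q ν m (Sg t) = vmk p q ν m (Sg t) * vmk p q ν m (Sg s) := by
  simp only [← map_mul]; exact vmk_eq_of_rel p q ν (.sig_comm s t h)

theorem vmk_pi_sig {s : Fin (m - 1)} (h : 0 < s.1) :
    vmk p q ν m Pg * vmk p q ν m (Sg s) = vmk p q ν m (Sg s) * vmk p q ν m Pg := by
  simp only [← map_mul]; exact vmk_eq_of_rel p q ν (.pi_sig rfl s h)

theorem vmk_sig_braid (hν : ∀ a, ν a ≤ 1) {i : Fin m → kˣ} (hi : IsThetaSeq ν i)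
    {s t : Fin (m - 1)} (h : t.1 = s.1 + 1) :
    vmk p q ν m (Sg t) * (vmk p q ν m (Sg s) * (vmk p q ν m (Sg t) * vmk p q ν m (E i))) =
      vmk p q ν m (Sg s) * (vmk p q ν m (Sg t) * (vmk p q ν m (Sg s) * vmk p q ν m (E i))) := by
  have hs : s.1 + 1 < m - 1 := h ▸ t.2
  obtain rfl : t = ⟨s.1 + 1, hs⟩ := Fin.ext h
  simp only [← map_mul, ← mul_assoc]
  refine vmk_eq_of_rel p q ν (.braid_triv s _ i (Or.inl fun h => ?_))
  have := congrArg Fin.val (hi.injective hν h)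
  simp [lo] at this

theorem vmk_sig_pi_braid (hν : ∀ a, ν a ≤ 1) {i : Fin m → kˣ} (hi : IsThetaSeq ν i)
    {s : Fin (m - 1)} (h : s.1 = 0) :
    vmk p q ν m (Sg s) * (vmk p q ν m Pg * (vmk p q ν m (Sg s) *
        (vmk p q ν m Pg * vmk p q ν m (E i)))) =
      vmk p q ν m Pg * (vmk p q ν m (Sg s) * (vmk p q ν m Pg *
        (vmk p q ν m (Sg s) * vmk p q ν m (E i)))) := by
  obtain ⟨s, hs⟩ := s
  subst h
  simp only [← map_mul]
  have := vmk_eq_of_rel p q ν (.sig_pi_zero rfl hs i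
    (fun h => hi.ne_inv hν ⟨1, by omega⟩ ⟨0, by omega⟩ (by rw [h.1, h.2]))
    (fun h => hi.ne_inv hν ⟨0, by omega⟩ ⟨1, by omega⟩ (by rw [h.1, h.2])))
  simpa only [mul_assoc] using this

theorem vmk_sig_x (hν : ∀ a, ν a ≤ 1) {i : Fin m → kˣ} (hi : IsThetaSeq ν i)
    (s : Fin (m - 1)) (l : Fin m) :
    vmk p q ν m (Sg s) * vmk p q ν m (X l) * vmk p q ν m (E i) =
      vmk p q ν m (X (Equiv.swap (lo s) (VVPaper.hi s) l)) * vmk p q ν m (Sg s) *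
        vmk p q ν m (E i) := by
  simp only [← map_mul]
  exact vmk_eq_of_rel p q ν (.sig_x s l i (Or.inl fun h => lo_ne_hi s (hi.injective hν h)))

theorem vmk_pi_x_zero (h0 : 0 < m) :
    vmk p q ν m Pg * vmk p q ν m (X ⟨0, h0⟩) = -(vmk p q ν m (X ⟨0, h0⟩) * vmk p q ν m Pg) := by
  simp only [← map_mul, ← map_neg]; exact vmk_eq_of_rel p q ν (.pi_x_zero rfl h0)

theorem vmk_pi_x {l : Fin m} (h : 0 < l.1) :
    vmk p q ν m Pg * vmk p q ν m (X l) = vmk p q ν m (X l) * vmk p q ν m Pg := by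
  simp only [← map_mul]; exact vmk_eq_of_rel p q ν (.pi_x rfl l h)

end Relations

/-! ### Reduced paths between idempotents -/

section Paths

variable {k : Type} [Field k] {p q : kˣ} {ν : kˣ →₀ ℕ} {m : ℕ} {h0 : 0 < m}

/-- `ReducedPath p q ν h0 j i a` means that `a` is a product of generators `σ_s`, `π` obtained
by following a reduced path from the sequence `j` to the sequence `i`. -/
inductive ReducedPath (p q : kˣ) (ν : kˣ →₀ ℕ) {m : ℕ} (h0 : 0 < m) (j : Fin m → kˣ) :
    (Fin m → kˣ) → VV k p q ν m → Prop
  | refl : ReducedPath p q ν h0 j j (vmk p q ν m (E j))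
  | sig (s : Fin (m - 1)) (i : Fin m → kˣ) (a : VV k p q ν m)
      (h : ReducedPath p q ν h0 j (swapAt s i) a)
      (hlt : signedPos j (i (hi s)) < signedPos j (i (lo s))) :
      ReducedPath p q ν h0 j i (vmk p q ν m (Sg s) * a)
  | pi (i : Fin m → kˣ) (a : VV k p q ν m)
      (h : ReducedPath p q ν h0 j (flipAt h0 i) a)
      (hlt : signedPos j (i ⟨0, h0⟩) < 0) :
      ReducedPath p q ν h0 j i (vmk p q ν m Pg * a)

theorem ReducedPath.isThetaSeq {i j : Fin m → kˣ} {a : VV k p q ν m} (hj : IsThetaSeq ν j)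
    (h : ReducedPath p q ν h0 j i a) : IsThetaSeq ν i := by
  induction h with
  | refl => exact hj
  | sig s i a h hlt ih => simpa [swapAt_swapAt] using ih.swapAt s
  | pi i a h hlt ih => simpa [flipAt_flipAt] using ih.flipAt h0

theorem ReducedPath.idem_mul {i j : Fin m → kˣ} {a : VV k p q ν m}
    (h : ReducedPath p q ν h0 j i a) : vmk p q ν m (E i) * a = a := by
  induction h with
  | refl => exact vmk_idem_mul p q ν j
  | sig s i a h hlt ih =>
    conv_rhs => rw [← ih, ← mul_assoc, vmk_sig_idem, swapAt_swapAt, mul_assoc]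
  | pi i a h hlt ih =>
    conv_rhs => rw [← ih, ← mul_assoc, vmk_pi_idem _ _ _ h0, flipAt_flipAt, mul_assoc]

theorem ReducedPath.mul_idem {i j : Fin m → kˣ} {a : VV k p q ν m}
    (h : ReducedPath p q ν h0 j i a) : a * vmk p q ν m (E j) = a := by
  induction h with
  | refl => exact vmk_idem_mul p q ν j
  | sig s i a h hlt ih => rw [mul_assoc, ih]
  | pi i a h hlt ih => rw [mul_assoc, ih]

/-- A statistic on sequences which decreases along descents. -/
def descentWeight (j i : Fin m → kˣ) : ℤ := ∑ l : Fin m, ((l.1 : ℤ) + 1) * (m - signedPos j (i l))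

theorem descentWeight_swapAt_lt {i j : Fin m → kˣ} {s : Fin (m - 1)}
    (h : signedPos j (i (hi s)) < signedPos j (i (lo s))) :
    descentWeight j (swapAt s i) < descentWeight j i := by
  have h1 : descentWeight j (swapAt s i) = ∑ l : Fin m,
      (((Equiv.swap (lo s) (hi s) l).1 : ℤ) + 1) * (m - signedPos j (i l)) := by
    unfold descentWeight
    rw [← Equiv.sum_comp (Equiv.swap (lo s) (hi s))]
    simp [swapAt]
  have h2 : descentWeight j i - descentWeight j (swapAt s i) = ∑ l ∈ {lo s, hi s},
      ((l.1 : ℤ) - (Equiv.swap (lo s) (hi s) l).1) * (m - signedPos j (i l)) := by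
    rw [h1, descentWeight, ← Finset.sum_sub_distrib]
    symm
    refine (Finset.sum_subset (Finset.subset_univ _) fun l _ hl => ?_).trans
      (Finset.sum_congr rfl fun l _ => by ring)
    simp only [Finset.mem_insert, Finset.mem_singleton, not_or] at hl
    rw [Equiv.swap_apply_of_ne_of_ne hl.1 hl.2]
    simp
  rw [Finset.sum_pair (lo_ne_hi s)] at h2
  simp only [Equiv.swap_apply_left, Equiv.swap_apply_right, lo, hi] at h2 h
  push_cast at h2
  linarith

theorem descentWeight_flipAt_lt {i j : Fin m → kˣ} (h : signedPos j (i ⟨0, h0⟩) < 0) :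
    descentWeight j (flipAt h0 i) < descentWeight j i := by
  unfold descentWeight
  refine Finset.sum_lt_sum (fun l _ => ?_) ⟨⟨0, h0⟩, Finset.mem_univ _, ?_⟩
  · rw [flipAt_apply]
    split_ifs with hl
    · subst hl
      rw [signedPos_inv]
      simp
      omega
    · rfl
  · rw [flipAt_zero, signedPos_inv]
    simp
    omega

variable (hν : ∀ a, ν a ≤ 1)

include hν

theorem abs_signedPos_le {i j : Fin m → kˣ} (hi : IsThetaSeq ν i) (hj : IsThetaSeq ν j)
    (l : Fin m) : signedPos j (i l) ≤ m := by
  obtain ⟨l', h | h⟩ := (hj.ne_zero_iff _).1 (hi.apply_ne_zero l)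
  · rw [← h, hj.signedPos_apply hν]; omega
  · rw [← h, hj.signedPos_apply_inv hν]; omega

theorem descentWeight_nonneg {i j : Fin m → kˣ} (hi : IsThetaSeq ν i) (hj : IsThetaSeq ν j) :
    0 ≤ descentWeight j i :=
  Finset.sum_nonneg fun l _ => mul_nonneg (by omega)
    (sub_nonneg.2 (abs_signedPos_le hν hi hj l))

/-- A sequence without descents relative to `j` is equal to `j`. -/
theorem eq_of_no_descent {i j : Fin m → kˣ} (hi : IsThetaSeq ν i) (hj : IsThetaSeq ν j)
    (h1 : 0 ≤ signedPos j (i ⟨0, h0⟩))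
    (h2 : ∀ s : Fin (m - 1), signedPos j (i (lo s)) ≤ signedPos j (i (VVPaper.hi s))) :
    i = j := by
  have h2' : ∀ s : Fin (m - 1), signedPos j (i (lo s)) < signedPos j (i (VVPaper.hi s)) :=
    fun s => lt_of_le_of_ne (h2 s) fun h => lo_ne_hi s (hi.injective hν
      (hj.signedPos_injOn hν (hi.apply_ne_zero _) (hi.apply_ne_zero _) h))
  have h3 : ∀ n (hn : n < m), (n : ℤ) + 1 ≤ signedPos j (i ⟨n, hn⟩) := by
    intro n
    induction n with
    | zero =>
      intro hn
      have := hj.signedPos_ne_zero hν (hi.apply_ne_zero ⟨0, h0⟩)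
      push_cast
      omega
    | succ n ih =>
      intro hn
      have h := h2' ⟨n, by omega⟩
      have := ih (by omega)
      simp only [lo, VVPaper.hi] at h
      push_cast
      omega
  have h4 : ∀ n (hn : n < m), signedPos j (i ⟨m - 1 - n, by omega⟩) ≤ m - n := by
    intro n
    induction n with
    | zero =>
      intro hn
      have := abs_signedPos_le hν hi hj ⟨m - 1, by omega⟩
      simpa using this
    | succ n ih =>
      intro hn
      have h := h2' ⟨m - 1 - (n + 1), by omega⟩
      have h' := ih (by omega)
      simp only [lo, VVPaper.hi] at h
      have e : m - 1 - (n + 1) + 1 = m - 1 - n := by omega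
      simp only [e] at h
      push_cast
      omega
  funext l
  refine hj.signedPos_injOn hν (hi.apply_ne_zero _) (hj.apply_ne_zero _) ?_
  rw [hj.signedPos_apply hν]
  have h5 := h3 l.1 l.2
  have h6 := h4 (m - 1 - l.1) (by omega)
  have e : m - 1 - (m - 1 - l.1) = l.1 := by omega
  simp only [e, Fin.eta] at h5 h6
  omega

theorem ReducedPath.exists {i j : Fin m → kˣ} (hi : IsThetaSeq ν i) (hj : IsThetaSeq ν j) :
    ∃ a : VV k p q ν m, ReducedPath p q ν h0 j i a := by
  induction hn : (descentWeight j i).toNat using Nat.strong_induction_on generalizing i with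
  | _ n ih =>
  have hnn := descentWeight_nonneg hν hi hj
  by_cases h1 : signedPos j (i ⟨0, h0⟩) < 0
  · have := descentWeight_flipAt_lt h1
    have := descentWeight_nonneg hν (hi.flipAt h0) hj
    obtain ⟨a, ha⟩ := ih _ (by omega) (hi.flipAt h0) rfl
    exact ⟨_, .pi _ _ ha h1⟩
  by_cases h2 : ∃ s, signedPos j (i (VVPaper.hi s)) < signedPos j (i (lo s))
  · obtain ⟨s, hs⟩ := h2
    have := descentWeight_swapAt_lt hs
    have := descentWeight_nonneg hν (hi.swapAt s) hj
    obtain ⟨a, ha⟩ := ih _ (by omega) (hi.swapAt s) rfl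
    exact ⟨_, .sig _ _ _ ha hs⟩
  push Not at h1 h2
  obtain rfl := eq_of_no_descent hν hi hj h1 h2
  exact ⟨_, .refl⟩

end Paths

section PathUniqueness

variable {k : Type} [Field k] {p q : kˣ} {ν : kˣ →₀ ℕ} {m : ℕ} {h0 : 0 < m}
  (hν : ∀ a, ν a ≤ 1)

include hν

theorem sig_mul_eq_sig_mul {i j : Fin m → kˣ} (hi : IsThetaSeq ν i) (hj : IsThetaSeq ν j)
    (ih : ∀ i', IsThetaSeq ν i' → descentWeight j i' < descentWeight j i →
      ∀ a b : VV k p q ν m, ReducedPath p q ν h0 j i' a → ReducedPath p q ν h0 j i' b → a = b)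
    {s t : Fin (m - 1)} (hst : s.1 < t.1) {a b : VV k p q ν m}
    (ha : ReducedPath p q ν h0 j (swapAt s i) a) (hb : ReducedPath p q ν h0 j (swapAt t i) b)
    (hs : signedPos j (i (VVPaper.hi s)) < signedPos j (i (lo s)))
    (ht : signedPos j (i (VVPaper.hi t)) < signedPos j (i (lo t))) :
    vmk p q ν m (Sg s) * a = vmk p q ν m (Sg t) * b := by
  have iha := ih _ (hi.swapAt s) (descentWeight_swapAt_lt hs) a
  have ihb := ih _ (hi.swapAt t) (descentWeight_swapAt_lt ht) b
  have e1 : lo s ≠ lo t := fun h => by simp [lo] at h; omega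
  have e2 : lo s ≠ VVPaper.hi t := fun h => by simp [lo, VVPaper.hi] at h; omega
  have e3 : VVPaper.hi s ≠ VVPaper.hi t := fun h => by simp [VVPaper.hi] at h; omega
  rcases Nat.lt_or_ge (s.1 + 1) t.1 with hlt | hge
  · have e4 : VVPaper.hi s ≠ lo t := fun h => by simp [lo, VVPaper.hi] at h; omega
    obtain ⟨c, hc⟩ := ReducedPath.exists (p := p) (q := q) (h0 := h0) hν
      ((hi.swapAt s).swapAt t) hj
    rw [iha _ ha (.sig t _ c hc _), ihb _ hb (.sig s _ c _ _), ← mul_assoc, ← mul_assoc,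
      vmk_sig_comm p q ν hlt]
    · rwa [swapAt_comm hlt]
    · rwa [swapAt_of_ne t i e1 e2, swapAt_of_ne t i e4 e3]
    · rwa [swapAt_of_ne s i e1.symm e4.symm, swapAt_of_ne s i e2.symm e3.symm]
  · have hst : t.1 = s.1 + 1 := by omega
    have e4 : VVPaper.hi s = lo t := Fin.ext hst.symm
    rw [e4] at hs
    obtain ⟨c, hc⟩ := ReducedPath.exists (p := p) (q := q) (h0 := h0) hν
      (((hi.swapAt s).swapAt t).swapAt s) hj
    have h1 : swapAt s i (lo t) = i (lo s) := e4 ▸ swapAt_hi s i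
    have h2 : swapAt s i (VVPaper.hi t) = i (VVPaper.hi t) :=
      swapAt_of_ne s i e2.symm e3.symm
    have h3 : swapAt s i (lo s) = i (lo t) := by rw [swapAt_lo, e4]
    have h4 : swapAt t i (lo s) = i (lo s) := swapAt_of_ne t i e1 e2
    have h5 : swapAt t (swapAt s i) (lo s) = i (lo t) := by rw [swapAt_of_ne _ _ e1 e2, h3]
    have h6 : swapAt t (swapAt s i) (lo t) = i (VVPaper.hi t) := by rw [swapAt_lo, h2]
    have h7 : swapAt s (swapAt t i) (lo t) = i (lo s) := by rw [← e4, swapAt_hi, h4]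
    have h8 : swapAt s (swapAt t i) (VVPaper.hi t) = i (lo t) := by
      rw [swapAt_of_ne _ _ e2.symm e3.symm, swapAt_hi]
    have hc' := hc
    rw [swapAt_braid hst] at hc'
    rw [iha _ ha (.sig t _ _ (.sig s _ c hc _) _), ihb _ hb (.sig s _ _ (.sig t _ c hc' _) _)]
    · have := congrArg (· * c) (vmk_sig_braid p q ν hν
        (((hi.swapAt s).swapAt t).swapAt s) hst)
      simp only [mul_assoc, hc.idem_mul] at this
      exact this.symm
    · rwa [h7, h8]
    · rw [e4, swapAt_lo, h4]
      exact ht.trans hs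
    · rwa [e4, h5, h6]
    · rw [h1, h2]
      exact ht.trans hs

theorem sig_mul_eq_pi_mul {i j : Fin m → kˣ} (hi : IsThetaSeq ν i) (hj : IsThetaSeq ν j)
    (ih : ∀ i', IsThetaSeq ν i' → descentWeight j i' < descentWeight j i →
      ∀ a b : VV k p q ν m, ReducedPath p q ν h0 j i' a → ReducedPath p q ν h0 j i' b → a = b)
    {s : Fin (m - 1)} {a b : VV k p q ν m}
    (ha : ReducedPath p q ν h0 j (swapAt s i) a) (hb : ReducedPath p q ν h0 j (flipAt h0 i) b)
    (hs : signedPos j (i (VVPaper.hi s)) < signedPos j (i (lo s)))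
    (ht : signedPos j (i ⟨0, h0⟩) < 0) :
    vmk p q ν m (Sg s) * a = vmk p q ν m Pg * b := by
  have iha := ih _ (hi.swapAt s) (descentWeight_swapAt_lt hs) a
  have ihb := ih _ (hi.flipAt h0) (descentWeight_flipAt_lt ht) b
  rcases Nat.eq_zero_or_pos s.1 with hs0 | hs0
  · have e1 : lo s = ⟨0, h0⟩ := Fin.ext hs0
    have e2 : 0 < (VVPaper.hi s).1 := Nat.succ_pos _
    rw [e1] at hs
    obtain ⟨c, hc⟩ := ReducedPath.exists (p := p) (q := q) (h0 := h0) hν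
      ((((hi.swapAt s).flipAt h0).swapAt s).flipAt h0) hj
    have hc' := hc
    rw [← swapAt_flipAt_braid h0 hs0] at hc'
    have h1 : swapAt s i ⟨0, h0⟩ = i (VVPaper.hi s) := by rw [← e1, swapAt_lo]
    have h2 : swapAt s i (VVPaper.hi s) = i ⟨0, h0⟩ := by rw [swapAt_hi, e1]
    have h3 : flipAt h0 (swapAt s i) ⟨0, h0⟩ = (i (VVPaper.hi s))⁻¹ := by rw [flipAt_zero, h1]
    have h4 : flipAt h0 (swapAt s i) (VVPaper.hi s) = i ⟨0, h0⟩ := by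
      rw [flipAt_of_pos h0 _ e2, h2]
    have h5 : swapAt s (flipAt h0 (swapAt s i)) ⟨0, h0⟩ = i ⟨0, h0⟩ := by
      rw [← e1, swapAt_lo, h4, e1]
    have h6 : flipAt h0 i (VVPaper.hi s) = i (VVPaper.hi s) := flipAt_of_pos h0 _ e2
    have h7 : swapAt s (flipAt h0 i) ⟨0, h0⟩ = i (VVPaper.hi s) := by rw [← e1, swapAt_lo, h6]
    have h8 : swapAt s (flipAt h0 i) (VVPaper.hi s) = (i ⟨0, h0⟩)⁻¹ := by
      rw [swapAt_hi, e1, flipAt_zero]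
    have h9 : flipAt h0 (swapAt s (flipAt h0 i)) (VVPaper.hi s) = (i ⟨0, h0⟩)⁻¹ := by
      rw [flipAt_of_pos h0 _ e2, h8]
    have h10 : flipAt h0 (swapAt s (flipAt h0 i)) ⟨0, h0⟩ = (i (VVPaper.hi s))⁻¹ := by
      rw [flipAt_zero, h7]
    rw [iha _ ha (.pi _ _ (.sig s _ _ (.pi _ c hc _) _) _),
      ihb _ hb (.sig s _ _ (.pi _ _ (.sig s _ c hc' _) _) _)]
    · have := congrArg (· * c) (vmk_sig_pi_braid p q ν hν
        ((((hi.swapAt s).flipAt h0).swapAt s).flipAt h0) hs0)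
      simp only [mul_assoc, hc.idem_mul] at this
      exact this
    · rw [h9, e1, h10, signedPos_inv, signedPos_inv]
      omega
    · rw [h7]; omega
    · rw [h6, e1, flipAt_zero, signedPos_inv]
      omega
    · rwa [h5]
    · rw [h4, e1, h3, signedPos_inv]
      omega
    · rw [h1]; omega
  · have e1 : 0 < (lo s).1 := hs0
    have e2 : 0 < (VVPaper.hi s).1 := Nat.succ_pos _
    obtain ⟨c, hc⟩ := ReducedPath.exists (p := p) (q := q) (h0 := h0) hν
      ((hi.swapAt s).flipAt h0) hj
    rw [iha _ ha (.pi _ c hc _), ihb _ hb (.sig s _ c _ _), ← mul_assoc, ← mul_assoc,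
      vmk_pi_sig p q ν hs0]
    · rwa [swapAt_flipAt h0 hs0]
    · rwa [flipAt_of_pos h0 _ e1, flipAt_of_pos h0 _ e2]
    · rwa [swapAt_of_ne s i (fun h => by simp [← h] at e1) (fun h => by simp [← h] at e2)]

theorem ReducedPath.unique {i j : Fin m → kˣ} (hj : IsThetaSeq ν j) {a b : VV k p q ν m}
    (ha : ReducedPath p q ν h0 j i a) (hb : ReducedPath p q ν h0 j i b) : a = b := by
  induction hn : (descentWeight j i).toNat using Nat.strong_induction_on generalizing i a b with
  | _ n ih =>
  have hi := ha.isThetaSeq hj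
  replace ih : ∀ i', IsThetaSeq ν i' → descentWeight j i' < descentWeight j i →
      ∀ a b : VV k p q ν m, ReducedPath p q ν h0 j i' a → ReducedPath p q ν h0 j i' b →
        a = b := by
    intro i' hi' hlt a b ha hb
    have := descentWeight_nonneg hν hi' hj
    exact ih _ (by omega) ha hb rfl
  have hsig : ∀ s : Fin (m - 1), ¬ signedPos j (j (VVPaper.hi s)) < signedPos j (j (lo s)) := by
    intro s
    rw [hj.signedPos_apply hν, hj.signedPos_apply hν]
    simp [lo, VVPaper.hi]
  have hpi : ¬ signedPos j (j ⟨0, h0⟩) < 0 := by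
    rw [hj.signedPos_apply hν]
    simp
  cases ha with
  | refl =>
    cases hb with
    | refl => rfl
    | sig s _ b h hlt => exact absurd hlt (hsig s)
    | pi _ b h hlt => exact absurd hlt hpi
  | sig s _ a ha hlt =>
    cases hb with
    | refl => exact absurd hlt (hsig s)
    | sig t _ b hb hlt' =>
      rcases lt_trichotomy s.1 t.1 with h | h | h
      · exact sig_mul_eq_sig_mul hν hi hj ih h ha hb hlt hlt'
      · obtain rfl : s = t := Fin.ext h
        rw [ih _ (hi.swapAt s) (descentWeight_swapAt_lt hlt) _ _ ha hb]
      · exact (sig_mul_eq_sig_mul hν hi hj ih h hb ha hlt' hlt).symm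
    | pi _ b hb hlt' => exact sig_mul_eq_pi_mul hν hi hj ih ha hb hlt hlt'
  | pi _ a ha hlt =>
    cases hb with
    | refl => exact absurd hlt hpi
    | sig t _ b hb hlt' => exact (sig_mul_eq_pi_mul hν hi hj ih hb ha hlt' hlt).symm
    | pi _ b hb hlt' =>
      rw [ih _ (hi.flipAt h0) (descentWeight_flipAt_lt hlt) _ _ ha hb]

end PathUniqueness

/-! ### The polynomial representation -/

section PolynomialRepresentation

open scoped Classical

variable {k : Type} [Field k] {m : ℕ}

/-- The polynomial attached to a letter, relative to a choice of representatives for the letters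
up to inversion. -/
def letterPoly (base : Fin m → kˣ) (b : kˣ) : MvPolynomial (Fin m) k :=
  ∑ l, ((if base l = b then MvPolynomial.X l else 0) -
    if (base l)⁻¹ = b then MvPolynomial.X l else 0)

theorem letterPoly_inv (base : Fin m → kˣ) (b : kˣ) :
    letterPoly base b⁻¹ = -letterPoly base b := by
  unfold letterPoly
  rw [← Finset.sum_neg_distrib]
  refine Finset.sum_congr rfl fun l _ => ?_
  rw [neg_sub]
  simp [inv_eq_iff_eq_inv]

theorem letterPoly_base {ν : kˣ →₀ ℕ} (hν : ∀ a, ν a ≤ 1) {base : Fin m → kˣ}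
    (hb : IsThetaSeq ν base) (l : Fin m) : letterPoly base (base l) = MvPolynomial.X l := by
  unfold letterPoly
  rw [Finset.sum_eq_single l]
  · simp [(hb.ne_inv_self hν l).symm]
  · intro l' _ hl
    have h1 : base l' ≠ base l := fun h => hl (hb.injective hν h)
    have h2 : (base l')⁻¹ ≠ base l := (hb.ne_inv hν _ _).symm
    simp [h1, h2]
  · simp

theorem arrow_inv_iff {p a b : kˣ} : Arrow p b⁻¹ a⁻¹ ↔ Arrow p a b := by
  unfold Arrow
  rw [inv_eq_iff_eq_inv, mul_inv_rev, inv_inv, eq_mul_inv_iff_mul_eq, mul_comm, eq_comm]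

/-- The coefficient by which `σ` acts on a pair of adjacent letters. -/
def arrowPoly (p : kˣ) (base : Fin m → kˣ) (a b : kˣ) : MvPolynomial (Fin m) k :=
  if Arrow p a b then letterPoly base a - letterPoly base b else 1

theorem arrowPoly_inv (p : kˣ) (base : Fin m → kˣ) (a b : kˣ) :
    arrowPoly p base b⁻¹ a⁻¹ = arrowPoly p base a b := by
  simp only [arrowPoly, arrow_inv_iff, letterPoly_inv]
  congr 1
  ring

/-- The coefficient by which `π` acts on a letter. -/
def signPoly (q : kˣ) (base : Fin m → kˣ) (a : kˣ) : MvPolynomial (Fin m) k :=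
  if a = q then letterPoly base q else 1

theorem mem_thetaSeqs {ν : kˣ →₀ ℕ} {i : Fin m → kˣ} : i ∈ thetaSeqs ν m ↔ IsThetaSeq ν i := by
  unfold thetaSeqs
  rw [Finset.mem_filter, Fintype.mem_piFinset]
  exact ⟨fun h => h.2, fun h => ⟨fun l => Finsupp.mem_support_iff.2 (h.apply_ne_zero l), h⟩⟩

/-- The type of sequences in `ᶿI^ν`. -/
abbrev ThetaSeqs (ν : kˣ →₀ ℕ) (m : ℕ) : Type := {i : Fin m → kˣ // i ∈ thetaSeqs ν m}

namespace ThetaSeqs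

variable {ν : kˣ →₀ ℕ}

theorem isThetaSeq (i : ThetaSeqs ν m) : IsThetaSeq ν i.1 := mem_thetaSeqs.1 i.2

/-- The action of a simple transposition on `ᶿI^ν`. -/
def swap (s : Fin (m - 1)) (i : ThetaSeqs ν m) : ThetaSeqs ν m :=
  ⟨swapAt s i.1, mem_thetaSeqs.2 (i.isThetaSeq.swapAt s)⟩

/-- The action of `π` on `ᶿI^ν`. -/
def flip (h0 : 0 < m) (i : ThetaSeqs ν m) : ThetaSeqs ν m :=
  ⟨flipAt h0 i.1, mem_thetaSeqs.2 (i.isThetaSeq.flipAt h0)⟩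

@[simp] theorem coe_swap (s : Fin (m - 1)) (i : ThetaSeqs ν m) : (swap s i).1 = swapAt s i.1 := rfl

@[simp] theorem coe_flip (h0 : 0 < m) (i : ThetaSeqs ν m) : (flip h0 i).1 = flipAt h0 i.1 := rfl

@[simp] theorem swap_swap (s : Fin (m - 1)) (i : ThetaSeqs ν m) : swap s (swap s i) = i :=
  Subtype.ext (swapAt_swapAt _ _)

@[simp] theorem flip_flip (h0 : 0 < m) (i : ThetaSeqs ν m) : flip h0 (flip h0 i) = i :=
  Subtype.ext (flipAt_flipAt _ _)

end ThetaSeqs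

open ThetaSeqs

/-- Weighted pull-back operators on functions. -/
def pullOp {R T : Type} [CommRing R] (f : T → T) (g : T → R) : Module.End R (T → R) where
  toFun v a := g a * v (f a)
  map_add' v w := by funext a; simp [mul_add]
  map_smul' c v := by funext a; simp [mul_left_comm]

@[simp] theorem pullOp_apply {R T : Type} [CommRing R] (f : T → T) (g : T → R) (v : T → R)
    (a : T) : pullOp f g v a = g a * v (f a) := rfl

variable (p q : kˣ) (ν : kˣ →₀ ℕ) (h0 : 0 < m) (base : Fin m → kˣ)

/-- The action of the generators on the polynomial representation. -/
def genOp : Gen kˣ m → Module.End (MvPolynomial (Fin m) k)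
    (ThetaSeqs ν m → MvPolynomial (Fin m) k)
  | .x l => pullOp id fun a => letterPoly base (a.1 l)
  | .sig s => pullOp (swap s) fun a => arrowPoly p base (a.1 (hi s)) (a.1 (lo s))
  | .idem i => pullOp id fun a => if a.1 = i then 1 else 0
  | .pi => pullOp (flip h0) fun a => signPoly q base (a.1 ⟨0, h0⟩)⁻¹

/-- The polynomial representation of the free algebra. -/
def faRep : FA k m →ₐ[k] Module.End (MvPolynomial (Fin m) k)
    (ThetaSeqs ν m → MvPolynomial (Fin m) k) :=
  FreeAlgebra.lift k (genOp p q ν h0 base)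

@[simp] theorem faRep_X (l : Fin m) (v : ThetaSeqs ν m → MvPolynomial (Fin m) k)
    (a : ThetaSeqs ν m) :
    faRep p q ν h0 base (X l) v a = letterPoly base (a.1 l) * v a := by
  rw [faRep, X, FreeAlgebra.lift_ι_apply]; rfl

@[simp] theorem faRep_Sg (s : Fin (m - 1)) (v : ThetaSeqs ν m → MvPolynomial (Fin m) k)
    (a : ThetaSeqs ν m) :
    faRep p q ν h0 base (Sg s) v a =
      arrowPoly p base (a.1 (hi s)) (a.1 (lo s)) * v (swap s a) := by
  rw [faRep, Sg, FreeAlgebra.lift_ι_apply]; rfl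

@[simp] theorem faRep_E (i : Fin m → kˣ) (v : ThetaSeqs ν m → MvPolynomial (Fin m) k)
    (a : ThetaSeqs ν m) :
    faRep p q ν h0 base (E i) v a = if a.1 = i then v a else 0 := by
  rw [faRep, E, FreeAlgebra.lift_ι_apply]; simp [genOp]

@[simp] theorem faRep_Pg (v : ThetaSeqs ν m → MvPolynomial (Fin m) k)
    (a : ThetaSeqs ν m) :
    faRep p q ν h0 base Pg v a = signPoly q base (a.1 ⟨0, h0⟩)⁻¹ * v (flip h0 a) := by
  rw [faRep, Pg, FreeAlgebra.lift_ι_apply]; rfl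

theorem swap_eq_iff (s : Fin (m - 1)) (a : ThetaSeqs ν m) (i : Fin m → kˣ) :
    swapAt s a.1 = i ↔ a.1 = swapAt s i :=
  ⟨fun h => by rw [← h, swapAt_swapAt], fun h => by rw [h, swapAt_swapAt]⟩

theorem flip_eq_iff (a : ThetaSeqs ν m) (i : Fin m → kˣ) :
    flipAt h0 a.1 = i ↔ a.1 = flipAt h0 i :=
  ⟨fun h => by rw [← h, flipAt_flipAt], fun h => by rw [h, flipAt_flipAt]⟩

theorem faRep_rel (hν : ∀ a, ν a ≤ 1) (hq : q ≠ q⁻¹) {x y : FA k m}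
    (h : Rel p q (IsThetaSeq ν) (thetaSeqs ν m) true x y) :
    faRep p q ν h0 base x = faRep p q ν h0 base y := by
  have hne : ∀ {i : Fin m → kˣ}, ¬ IsThetaSeq ν i → ∀ a : ThetaSeqs ν m, a.1 ≠ i := by
    rintro i hi a rfl
    exact hi a.isThetaSeq
  have hE : ∀ {i : Fin m → kˣ}, ¬ IsThetaSeq ν i → ∀ v, faRep p q ν h0 base (E i) v = 0 :=
    fun hi v => funext fun a => by simp [hne hi]
  refine LinearMap.ext fun v => funext fun a => ?_
  cases h with
  | idem_mul i =>
    simp only [map_mul, Module.End.mul_apply, faRep_E]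
    split_ifs <;> rfl
  | idem_orth i j h =>
    simp only [map_mul, Module.End.mul_apply, faRep_E, map_zero, LinearMap.zero_apply,
      Pi.zero_apply]
    split_ifs <;> simp_all
  | idem_zero i h => simp [hne h]
  | idem_sum =>
    simp only [map_sum, LinearMap.coe_sum, Finset.sum_apply, faRep_E, map_one,
      Module.End.one_apply]
    simp
  | x_mul_comm b c =>
    simp only [map_mul, Module.End.mul_apply, faRep_X]
    ring
  | x_idem b i => simp [mul_comm]
  | sig_idem s i => simp [swap_eq_iff]
  | sig_sq_eq s i h =>
    have : ¬ IsThetaSeq ν i := fun hi => lo_ne_hi s (hi.injective hν h)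
    simp [hne this]
  | sig_sq_none s i hn h1 h2 =>
    simp only [map_mul, Module.End.mul_apply, faRep_Sg, faRep_E, ThetaSeqs.swap_swap, coe_swap, swapAt_lo,
      swapAt_hi]
    split_ifs with h
    · simp [h, arrowPoly, h1, h2]
    · simp
  | sig_sq_from s i h1 h2 =>
    simp only [map_mul, Module.End.mul_apply, faRep_Sg, faRep_E, ThetaSeqs.swap_swap, coe_swap, swapAt_lo,
      swapAt_hi, map_sub, LinearMap.sub_apply, Pi.sub_apply, faRep_X]
    split_ifs with h
    · simp [h, arrowPoly, h1, h2, sub_mul]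
    · simp
  | sig_sq_to s i h1 h2 =>
    simp only [map_mul, Module.End.mul_apply, faRep_Sg, faRep_E, ThetaSeqs.swap_swap, coe_swap, swapAt_lo,
      swapAt_hi, map_sub, LinearMap.sub_apply, Pi.sub_apply, faRep_X]
    split_ifs with h
    · simp [h, arrowPoly, h1, h2, sub_mul]
    · simp
  | sig_sq_both s i h1 h2 =>
    simp only [map_mul, Module.End.mul_apply, faRep_Sg, faRep_E, ThetaSeqs.swap_swap, coe_swap, swapAt_lo,
      swapAt_hi, map_sub, LinearMap.sub_apply, Pi.sub_apply, faRep_X]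
    split_ifs with h
    · simp only [h, arrowPoly, h1, h2, if_true]
      ring
    · simp
  | sig_comm s t h =>
    have e1 : lo s ≠ lo t := fun h => by simp [lo] at h; omega
    have e2 : lo s ≠ hi t := fun h => by simp [lo, hi] at h; omega
    have e3 : hi s ≠ hi t := fun h => by simp [hi] at h; omega
    have e4 : hi s ≠ lo t := fun h => by simp [lo, hi] at h; omega
    have e5 : swap t (swap s a) = swap s (swap t a) := Subtype.ext (swapAt_comm h _).symm
    simp only [map_mul, Module.End.mul_apply, faRep_Sg, e5, coe_swap, swapAt_of_ne t _ e1 e2,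
      swapAt_of_ne t _ e4 e3, swapAt_of_ne s _ e1.symm e4.symm, swapAt_of_ne s _ e2.symm e3.symm]
    ring
  | braid_triv s hs i h =>
    let t : Fin (m - 1) := ⟨s.1 + 1, hs⟩
    change faRep p q ν h0 base (Sg t * Sg s * Sg t * E i) v a =
      faRep p q ν h0 base (Sg s * Sg t * Sg s * E i) v a
    have e1 : lo s ≠ lo t := fun h => by simp [lo, t] at h
    have e2 : lo s ≠ hi t := fun h => by simp [lo, hi, t] at h; omega
    have e3 : hi s ≠ hi t := fun h => by simp [hi, t] at h
    have e4 : hi s = lo t := rfl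
    have e5 : swap t (swap s (swap t a)) = swap s (swap t (swap s a)) :=
      Subtype.ext (swapAt_braid rfl _).symm
    have h1 : swapAt s a.1 (lo t) = a.1 (lo s) := e4 ▸ swapAt_hi s a.1
    have h2 : swapAt s a.1 (hi t) = a.1 (hi t) := swapAt_of_ne s _ e2.symm e3.symm
    have h3 : swapAt t a.1 (lo s) = a.1 (lo s) := swapAt_of_ne t _ e1 e2
    have h4 : swapAt s (swapAt t a.1) (lo t) = a.1 (lo s) := by rw [← e4, swapAt_hi, h3]
    have h5 : swapAt s (swapAt t a.1) (hi t) = a.1 (lo t) := by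
      rw [swapAt_of_ne _ _ e2.symm e3.symm, swapAt_hi]
    have h6 : swapAt t (swapAt s a.1) (lo s) = a.1 (lo t) := by
      rw [swapAt_of_ne _ _ e1 e2, swapAt_lo, e4]
    have h7 : swapAt t (swapAt s a.1) (lo t) = a.1 (hi t) := by rw [swapAt_lo, h2]
    simp only [map_mul, Module.End.mul_apply, faRep_Sg, e5, coe_swap, faRep_E, e4, h1, h2, h3, h4,
      h5, h6, h7, swapAt_lo]
    ring
  | braid_to s hs i he h1 h2 =>
    have : ¬ IsThetaSeq ν i := fun hi => by
      have := congrArg Fin.val (hi.injective hν he)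
      simp [lo] at this
    simp [hE this]
  | braid_from s hs i he h1 h2 =>
    have : ¬ IsThetaSeq ν i := fun hi => by
      have := congrArg Fin.val (hi.injective hν he)
      simp [lo] at this
    simp [hE this]
  | braid_both s hs i he h1 h2 =>
    have : ¬ IsThetaSeq ν i := fun hi => by
      have := congrArg Fin.val (hi.injective hν he)
      simp [lo] at this
    simp [hE this]
  | sig_x_lo s i h =>
    have : ¬ IsThetaSeq ν i := fun hi => lo_ne_hi s (hi.injective hν h)
    simp [hE this]
  | sig_x_hi s i h =>
    have : ¬ IsThetaSeq ν i := fun hi => lo_ne_hi s (hi.injective hν h)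
    simp [hE this]
  | sig_x s l i h =>
    simp only [map_mul, Module.End.mul_apply, faRep_Sg, faRep_E, coe_swap, faRep_X]
    rw [show swapAt s a.1 l = a.1 (Equiv.swap (lo s) (hi s) l) from rfl]
    ring
  | pi_idem hw h0 i =>
    change faRep p q ν h0 base (Pg * E i) v a = faRep p q ν h0 base (E (flipAt h0 i) * Pg) v a
    simp [flip_eq_iff]
  | pi_sq_q hw h0 i h =>
    simp only [map_mul, Module.End.mul_apply, faRep_Pg, faRep_E, ThetaSeqs.flip_flip, coe_flip, flipAt_zero,
      inv_inv, faRep_X]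
    split_ifs with h'
    · simp [h', h, signPoly, hq.symm]
    · simp
  | pi_sq_qinv hw h0 i h =>
    simp only [map_mul, Module.End.mul_apply, faRep_Pg, faRep_E, ThetaSeqs.flip_flip, coe_flip, flipAt_zero,
      inv_inv, faRep_X, map_neg, LinearMap.neg_apply, Pi.neg_apply]
    split_ifs with h'
    · simp [h', h, signPoly, hq.symm, letterPoly_inv]
    · simp
  | pi_sq_one hw h0 i h1 h2 =>
    simp only [map_mul, Module.End.mul_apply, faRep_Pg, faRep_E, ThetaSeqs.flip_flip, coe_flip, flipAt_zero,
      inv_inv]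
    split_ifs with h'
    · simp [h', signPoly, h1, inv_eq_iff_eq_inv, h2]
    · simp
  | pi_x_zero hw h0 =>
    simp only [map_mul, Module.End.mul_apply, faRep_Pg, faRep_X, coe_flip, flipAt_zero,
      letterPoly_inv, map_neg, LinearMap.neg_apply, Pi.neg_apply]
    ring
  | pi_x hw l h =>
    simp only [map_mul, Module.End.mul_apply, faRep_Pg, faRep_X, coe_flip, flipAt_of_pos h0 _ h]
    ring
  | pi_sig hw s h =>
    have e1 : 0 < (lo s).1 := h
    have e2 : 0 < (hi s).1 := Nat.succ_pos _
    have e3 : swap s (flip h0 a) = flip h0 (swap s a) := Subtype.ext (swapAt_flipAt h0 h _)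
    simp only [map_mul, Module.End.mul_apply, faRep_Pg, faRep_Sg, coe_flip, coe_swap,
      flipAt_of_pos h0 _ e1, flipAt_of_pos h0 _ e2, e3]
    rw [swapAt_of_ne s a.1 (fun h => by simp [← h] at e1) (fun h => by simp [← h] at e2)]
    ring
  | sig_pi_plus hw h1 i ha hb =>
    have : ¬ IsThetaSeq ν i := fun hi =>
      hi.ne_inv hν ⟨1, by omega⟩ ⟨0, by omega⟩ (by rw [ha, hb])
    simp [hE this]
  | sig_pi_minus hw h1 i ha hb =>
    have : ¬ IsThetaSeq ν i := fun hi =>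
      hi.ne_inv hν ⟨0, by omega⟩ ⟨1, by omega⟩ (by rw [ha, hb])
    simp [hE this]
  | sig_pi_zero hw h1 i hc hc' =>
    let s : Fin (m - 1) := ⟨0, h1⟩
    change faRep p q ν h0 base (Sg s * Pg * (Sg s * Pg) * E i) v a =
      faRep p q ν h0 base (Pg * Sg s * (Pg * Sg s) * E i) v a
    have e1 : lo s = ⟨0, h0⟩ := rfl
    have e2 : 0 < (hi s).1 := Nat.succ_pos _
    have e3 : flip h0 (swap s (flip h0 (swap s a))) = swap s (flip h0 (swap s (flip h0 a))) :=
      Subtype.ext (swapAt_flipAt_braid h0 rfl _).symm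
    have h3 : ∀ b : Fin m → kˣ, swapAt s b ⟨0, h0⟩ = b (hi s) := swapAt_lo s
    have h4 : ∀ b : Fin m → kˣ, swapAt s b (hi s) = b ⟨0, h0⟩ := swapAt_hi s
    simp only [map_mul, Module.End.mul_apply, faRep_Pg, faRep_Sg, coe_flip, coe_swap, e3, faRep_E,
      e1, h3, h4, flipAt_zero, flipAt_of_pos h0 _ e2]
    have h5 : (arrowPoly p base (a.1 (hi s)) (a.1 ⟨0, h0⟩)⁻¹ : MvPolynomial (Fin m) k) =
        arrowPoly p base (a.1 ⟨0, h0⟩) (a.1 (hi s))⁻¹ := by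
      rw [← arrowPoly_inv, inv_inv]
    rw [h5, arrowPoly_inv p base (a.1 (hi s))]
    ring
  | pi_zero hw => exact absurd hw (by decide)

/-- The polynomial representation of the VV algebra. -/
def vvRep (hν : ∀ a, ν a ≤ 1) (hq : q ≠ q⁻¹) :
    VV k p q ν m →ₐ[k] Module.End (MvPolynomial (Fin m) k)
      (ThetaSeqs ν m → MvPolynomial (Fin m) k) :=
  RingQuot.liftAlgHom k ⟨faRep p q ν h0 base, fun _ _ h => faRep_rel p q ν h0 base hν hq h⟩

@[simp] theorem vvRep_vmk (hν : ∀ a, ν a ≤ 1) (hq : q ≠ q⁻¹) (x : FA k m) :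
    vvRep p q ν h0 base hν hq (vmk p q ν m x) = faRep p q ν h0 base x :=
  RingQuot.liftAlgHom_mkAlgHom_apply k _ _ _

end PolynomialRepresentation

/-! ### Central polynomials -/

section CentralPolynomials

open scoped Classical
open ThetaSeqs

variable {k : Type} [Field k] {m : ℕ} (p q : kˣ) (ν : kˣ →₀ ℕ) (base : Fin m → kˣ)

theorem vv_induction {P : VV k p q ν m → Prop} (hx : ∀ l, P (vmk p q ν m (X l)))
    (hs : ∀ s, P (vmk p q ν m (Sg s))) (hi : ∀ i, P (vmk p q ν m (E i)))
    (hp : P (vmk p q ν m Pg)) (hc : ∀ c, P (algebraMap k _ c))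
    (hadd : ∀ a b, P a → P b → P (a + b)) (hmul : ∀ a b, P a → P b → P (a * b))
    (a : VV k p q ν m) : P a := by
  obtain ⟨a, rfl⟩ := RingQuot.mkAlgHom_surjective k _ a
  change P (vmk p q ν m a)
  induction a using FreeAlgebra.induction with
  | grade0 c => rw [AlgHom.commutes]; exact hc c
  | grade1 g =>
    cases g with
    | x l => exact hx l
    | sig s => exact hs s
    | idem i => exact hi i
    | pi => exact hp
  | mul a b ha hb => rw [map_mul]; exact hmul _ _ ha hb
  | add a b ha hb => rw [map_add]; exact hadd _ _ ha hb

variable {p q ν} in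
theorem vv_neg_mul (a b : VV k p q ν m) : -a * b = -(a * b) := neg_mul a b

variable {p q ν} in
theorem vv_mul_neg (a b : VV k p q ν m) : a * -b = -(a * b) := mul_neg a b

variable {p q ν} in
theorem vv_neg_neg (a : VV k p q ν m) : - -a = a := neg_neg a

theorem sum_idem : ∑ i : ThetaSeqs ν m, vmk p q ν m (E i.1) = (1 : VV k p q ν m) := by
  rw [← vmk_idem_sum p q ν]
  exact Finset.sum_coe_sort (thetaSeqs ν m) fun i => vmk p q ν m (E i)

theorem eq_of_mul_idem {a b : VV k p q ν m}
    (h : ∀ i : ThetaSeqs ν m, a * vmk p q ν m (E i.1) = b * vmk p q ν m (E i.1)) : a = b := by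
  rw [← mul_one a, ← mul_one b, ← sum_idem p q ν, Finset.mul_sum, Finset.mul_sum]
  exact Finset.sum_congr rfl fun i _ => h i

theorem ThetaSeqs.idem_orth {i j : ThetaSeqs ν m} (h : i ≠ j) :
    vmk p q ν m (E i.1) * vmk p q ν m (E j.1) = (0 : VV k p q ν m) :=
  vmk_idem_orth p q ν fun h' => h (Subtype.ext h')

/-- The central element acting by the variable `x_l` on the polynomial representation. -/
def centralX (l : Fin m) : VV k p q ν m :=
  ∑ i : ThetaSeqs ν m, ∑ l', ((if i.1 l' = base l then vmk p q ν m (X l' * E i.1) else 0) -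
    if i.1 l' = (base l)⁻¹ then vmk p q ν m (X l' * E i.1) else 0)

theorem centralX_mul_idem (l : Fin m) (i : ThetaSeqs ν m) :
    centralX p q ν base l * vmk p q ν m (E i.1) =
      ∑ l', ((if i.1 l' = base l then vmk p q ν m (X l' * E i.1) else 0) -
        if i.1 l' = (base l)⁻¹ then vmk p q ν m (X l' * E i.1) else 0) := by
  rw [centralX, Finset.sum_mul, Finset.sum_eq_single i]
  · simp [Finset.sum_mul, sub_mul, ite_mul, mul_assoc, vmk_idem_mul]
  · intro j _ hj
    simp [Finset.sum_mul, sub_mul, ite_mul, mul_assoc, idem_orth p q ν hj]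
  · simp

theorem idem_mul_centralX (l : Fin m) (i : ThetaSeqs ν m) :
    vmk p q ν m (E i.1) * centralX p q ν base l =
      centralX p q ν base l * vmk p q ν m (E i.1) := by
  rw [centralX_mul_idem, centralX, Finset.mul_sum, Finset.sum_eq_single i]
  · simp [Finset.mul_sum, mul_sub, mul_ite, ← mul_assoc, ← vmk_x_idem]
    simp [mul_assoc, vmk_idem_mul]
  · intro j _ hj
    simp [Finset.mul_sum, mul_sub, mul_ite, ← mul_assoc, ← vmk_x_idem]
    simp [mul_assoc, idem_orth p q ν hj.symm]
  · simp

variable {p q ν base} (hν : ∀ a, ν a ≤ 1)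

include hν

theorem centralX_mul_idem_of_eq {l l' : Fin m} {i : ThetaSeqs ν m} (h : i.1 l' = base l) :
    centralX p q ν base l * vmk p q ν m (E i.1) =
      vmk p q ν m (X l') * vmk p q ν m (E i.1) := by
  rw [centralX_mul_idem, Finset.sum_eq_single l']
  · rw [if_pos h, if_neg, sub_zero, map_mul]
    rw [← h]
    exact i.isThetaSeq.ne_inv_self hν l'
  · intro c _ hc
    rw [if_neg, if_neg, sub_zero]
    · rw [← h]; exact i.isThetaSeq.ne_inv hν _ _
    · rw [← h]; exact fun h' => hc (i.isThetaSeq.injective hν h')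
  · simp

theorem centralX_mul_idem_of_eq_inv {l l' : Fin m} {i : ThetaSeqs ν m}
    (h : i.1 l' = (base l)⁻¹) :
    centralX p q ν base l * vmk p q ν m (E i.1) =
      -(vmk p q ν m (X l') * vmk p q ν m (E i.1)) := by
  rw [centralX_mul_idem, Finset.sum_eq_single l']
  · rw [if_pos h, if_neg, zero_sub, map_mul]
    rw [inv_eq_iff_eq_inv.1 h.symm]
    exact i.isThetaSeq.ne_inv_self hν l'
  · intro c _ hc
    rw [if_neg, if_neg, sub_zero]
    · rw [← h]; exact fun h' => hc (i.isThetaSeq.injective hν h')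
    · rw [inv_eq_iff_eq_inv.1 h.symm]; exact i.isThetaSeq.ne_inv hν _ _
  · simp

variable (hb : IsThetaSeq ν base)

include hb

omit hν in
theorem exists_eq_base_or (i : ThetaSeqs ν m) (l : Fin m) :
    ∃ l', i.1 l' = base l ∨ i.1 l' = (base l)⁻¹ := by
  obtain ⟨l', h⟩ := (i.isThetaSeq.ne_zero_iff _).1 (hb.apply_ne_zero l)
  exact ⟨l', h.imp_right inv_eq_iff_eq_inv.1⟩

theorem centralX_mul_x (l c : Fin m) :
    centralX p q ν base l * vmk p q ν m (X c) = vmk p q ν m (X c) * centralX p q ν base l := by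
  refine eq_of_mul_idem p q ν fun i => ?_
  rw [mul_assoc, vmk_x_idem, ← mul_assoc, mul_assoc (vmk p q ν m (X c))]
  obtain ⟨l', h | h⟩ := exists_eq_base_or hb i l
  · rw [centralX_mul_idem_of_eq hν h, mul_assoc, ← vmk_x_idem, ← mul_assoc, vmk_x_comm, mul_assoc]
  · rw [centralX_mul_idem_of_eq_inv hν h, vv_neg_mul, mul_assoc, ← vmk_x_idem, ← mul_assoc,
      vmk_x_comm, mul_assoc, vv_mul_neg]

theorem centralX_mul_sig (l : Fin m) (s : Fin (m - 1)) :
    centralX p q ν base l * vmk p q ν m (Sg s) =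
      vmk p q ν m (Sg s) * centralX p q ν base l := by
  refine eq_of_mul_idem p q ν fun i => ?_
  rw [mul_assoc, vmk_sig_idem, ← mul_assoc, mul_assoc (vmk p q ν m (Sg s))]
  obtain ⟨l', h⟩ := exists_eq_base_or hb i l
  have hs : (swap s i).1 (Equiv.swap (lo s) (hi s) l') = i.1 l' := by
    simp [swapAt]
  have key := vmk_sig_x p q ν hν i.isThetaSeq s l'
  rw [mul_assoc, mul_assoc, vmk_sig_idem] at key
  rcases h with h | h
  · rw [centralX_mul_idem_of_eq hν h, key, ← mul_assoc]
    exact congrArg (· * _) (centralX_mul_idem_of_eq (i := swap s i) hν (hs.trans h))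
  · rw [centralX_mul_idem_of_eq_inv hν h, vv_mul_neg, key, ← mul_assoc, ← vv_neg_mul]
    exact congrArg (· * _) (centralX_mul_idem_of_eq_inv (i := swap s i) hν (hs.trans h))

theorem centralX_mul_pi (h0 : 0 < m) (l : Fin m) :
    centralX p q ν base l * vmk p q ν m Pg = vmk p q ν m Pg * centralX p q ν base l := by
  refine eq_of_mul_idem p q ν fun i => ?_
  rw [mul_assoc, vmk_pi_idem p q ν h0, ← mul_assoc, mul_assoc (vmk p q ν m Pg)]
  obtain ⟨l', h⟩ := exists_eq_base_or hb i l
  rcases Nat.eq_zero_or_pos l'.1 with hl | hl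
  · obtain rfl : l' = ⟨0, h0⟩ := Fin.ext hl
    have hs : (flip h0 i).1 ⟨0, h0⟩ = (i.1 ⟨0, h0⟩)⁻¹ := flipAt_zero h0 _
    have key : vmk p q ν m Pg * (vmk p q ν m (X ⟨0, h0⟩) * vmk p q ν m (E i.1)) =
        -(vmk p q ν m (X ⟨0, h0⟩) * (vmk p q ν m (E (flipAt h0 i.1)) * vmk p q ν m Pg)) := by
      rw [← mul_assoc, vmk_pi_x_zero, vv_neg_mul, mul_assoc, vmk_pi_idem p q ν h0]
    rcases h with h | h
    · rw [centralX_mul_idem_of_eq hν h, key, ← mul_assoc, ← vv_neg_mul]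
      exact congrArg (· * _) (centralX_mul_idem_of_eq_inv (i := flip h0 i) hν (by rw [hs, h]))
    · rw [centralX_mul_idem_of_eq_inv hν h, vv_mul_neg, key, vv_neg_neg, ← mul_assoc]
      exact congrArg (· * _)
        (centralX_mul_idem_of_eq (i := flip h0 i) hν (by rw [hs, h, inv_inv]))
  · have hs : (flip h0 i).1 l' = i.1 l' := flipAt_of_pos h0 _ hl
    have key : vmk p q ν m Pg * (vmk p q ν m (X l') * vmk p q ν m (E i.1)) =
        vmk p q ν m (X l') * (vmk p q ν m (E (flipAt h0 i.1)) * vmk p q ν m Pg) := by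
      rw [← mul_assoc, vmk_pi_x p q ν hl, mul_assoc, vmk_pi_idem p q ν h0]
    rcases h with h | h
    · rw [centralX_mul_idem_of_eq hν h, key, ← mul_assoc]
      exact congrArg (· * _) (centralX_mul_idem_of_eq (i := flip h0 i) hν (hs.trans h))
    · rw [centralX_mul_idem_of_eq_inv hν h, vv_mul_neg, key, ← mul_assoc, ← vv_neg_mul]
      exact congrArg (· * _) (centralX_mul_idem_of_eq_inv (i := flip h0 i) hν (hs.trans h))

theorem centralX_mem_center (h0 : 0 < m) (l : Fin m) :
    centralX p q ν base l ∈ Subalgebra.center k (VV k p q ν m) := by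
  rw [Subalgebra.mem_center_iff]
  intro a
  induction a using vv_induction with
  | hx c => exact (centralX_mul_x hν hb l c).symm
  | hs s => exact (centralX_mul_sig hν hb l s).symm
  | hi i =>
    by_cases hi : IsThetaSeq ν i
    · exact idem_mul_centralX p q ν base l ⟨i, mem_thetaSeqs.2 hi⟩
    · rw [vmk_idem_zero p q ν hi, zero_mul, mul_zero]
  | hp => exact (centralX_mul_pi hν hb h0 l).symm
  | hc c => exact Algebra.commutes _ _
  | hadd a b ha hb => rw [add_mul, mul_add, ha, hb]
  | hmul a b ha hb => rw [mul_assoc, hb, ← mul_assoc, ha, mul_assoc]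

/-- The algebra of polynomials as a central subalgebra of the VV algebra. -/
def central (h0 : 0 < m) : MvPolynomial (Fin m) k →ₐ[k] VV k p q ν m :=
  (Subalgebra.center k (VV k p q ν m)).val.comp
    (MvPolynomial.aeval fun l => ⟨centralX p q ν base l, centralX_mem_center hν hb h0 l⟩)

theorem central_X (h0 : 0 < m) (l : Fin m) :
    central (p := p) (q := q) hν hb h0 (MvPolynomial.X l) = centralX p q ν base l := by
  simp [central]

theorem central_comm (h0 : 0 < m) (r : MvPolynomial (Fin m) k) (a : VV k p q ν m) :
    a * central hν hb h0 r = central hν hb h0 r * a :=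
  Subalgebra.mem_center_iff.1 (Subtype.prop (MvPolynomial.aeval (fun l =>
    (⟨centralX p q ν base l, centralX_mem_center hν hb h0 l⟩ :
      Subalgebra.center k (VV k p q ν m))) r)) a

theorem x_mul_idem_eq_central (h0 : 0 < m) (l : Fin m) (i : ThetaSeqs ν m) :
    vmk p q ν m (X l) * vmk p q ν m (E i.1) =
      central hν hb h0 (letterPoly base (i.1 l)) * vmk p q ν m (E i.1) := by
  obtain ⟨l', h | h⟩ := (hb.ne_zero_iff _).1 (i.isThetaSeq.apply_ne_zero l)
  · rw [← h, letterPoly_base hν hb, central_X, centralX_mul_idem_of_eq hν h.symm]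
  · rw [← h, letterPoly_inv, letterPoly_base hν hb, map_neg, central_X, vv_neg_mul,
      centralX_mul_idem_of_eq_inv hν h.symm, vv_neg_neg]

theorem sig_sq_mul_idem (h0 : 0 < m) (s : Fin (m - 1)) (i : ThetaSeqs ν m) :
    vmk p q ν m (Sg s) * (vmk p q ν m (Sg s) * vmk p q ν m (E i.1)) =
      central hν hb h0 (arrowPoly p base (i.1 (lo s)) (i.1 (hi s)) *
        arrowPoly p base (i.1 (hi s)) (i.1 (lo s))) * vmk p q ν m (E i.1) := by
  have hne : i.1 (lo s) ≠ i.1 (hi s) := fun h => lo_ne_hi s (i.isThetaSeq.injective hν h)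
  have hx := x_mul_idem_eq_central (p := p) (q := q) hν hb h0 (lo s) i
  have hy := x_mul_idem_eq_central (p := p) (q := q) hν hb h0 (hi s) i
  rw [← mul_assoc, ← map_mul, ← map_mul]
  by_cases h1 : Arrow p (i.1 (lo s)) (i.1 (hi s)) <;>
    by_cases h2 : Arrow p (i.1 (hi s)) (i.1 (lo s))
  · rw [vmk_eq_of_rel p q ν (.sig_sq_both s i.1 h1 h2), arrowPoly, arrowPoly, if_pos h1, if_pos h2]
    have hxy : ∀ c d, vmk p q ν m (X c - X d) * vmk p q ν m (E i.1) = central hν hb h0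
        (letterPoly base (i.1 c) - letterPoly base (i.1 d)) * vmk p q ν m (E i.1) := by
      intro c d
      rw [map_sub, map_sub, sub_mul, sub_mul, x_mul_idem_eq_central hν hb h0,
        x_mul_idem_eq_central hν hb h0]
    rw [map_mul, map_mul, mul_assoc, hxy, ← mul_assoc, central_comm, mul_assoc, hxy, ← mul_assoc,
      ← map_mul]
  · rw [vmk_eq_of_rel p q ν (.sig_sq_to s i.1 h1 h2), arrowPoly, arrowPoly, if_pos h1, if_neg h2]
    simp only [map_mul, map_sub, sub_mul, hx, hy, mul_one]
  · rw [vmk_eq_of_rel p q ν (.sig_sq_from s i.1 h2 h1), arrowPoly, arrowPoly, if_neg h1, if_pos h2]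
    simp only [map_mul, map_sub, sub_mul, hx, hy, one_mul]
  · rw [vmk_eq_of_rel p q ν (.sig_sq_none s i.1 hne h1 h2), arrowPoly, arrowPoly, if_neg h1,
      if_neg h2]
    simp

theorem pi_sq_mul_idem (h0 : 0 < m) (hq : q ≠ q⁻¹) (i : ThetaSeqs ν m) :
    vmk p q ν m Pg * (vmk p q ν m Pg * vmk p q ν m (E i.1)) =
      central hν hb h0 (signPoly q base (i.1 ⟨0, h0⟩) *
        signPoly q base (i.1 ⟨0, h0⟩)⁻¹) * vmk p q ν m (E i.1) := by
  have hx := x_mul_idem_eq_central (p := p) (q := q) hν hb h0 ⟨0, h0⟩ i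
  rw [← mul_assoc, ← map_mul, ← map_mul]
  by_cases h1 : i.1 ⟨0, h0⟩ = q
  · rw [vmk_eq_of_rel p q ν (.pi_sq_q rfl h0 i.1 h1), map_mul, hx, h1, signPoly, signPoly,
      if_pos rfl, if_neg hq.symm, mul_one]
  by_cases h2 : i.1 ⟨0, h0⟩ = q⁻¹
  · rw [vmk_eq_of_rel p q ν (.pi_sq_qinv rfl h0 i.1 h2), map_neg, map_mul, hx, h2, signPoly,
      signPoly, if_neg hq.symm, if_pos (inv_inv q), one_mul, letterPoly_inv, map_neg, vv_neg_mul,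
      vv_neg_neg]
  · rw [vmk_eq_of_rel p q ν (.pi_sq_one rfl h0 i.1 h1 h2), signPoly, signPoly, if_neg h1,
      if_neg (fun h => h2 (inv_eq_iff_eq_inv.1 h)), mul_one, map_one, one_mul]

theorem vvRep_central (h0 : 0 < m) (hq : q ≠ q⁻¹) (r : MvPolynomial (Fin m) k)
    (v : ThetaSeqs ν m → MvPolynomial (Fin m) k) :
    vvRep p q ν h0 base hν hq (central hν hb h0 r) v = r • v := by
  have : (vvRep p q ν h0 base hν hq).comp (central hν hb h0) =
      Algebra.lsmul k (MvPolynomial (Fin m) k) (ThetaSeqs ν m → MvPolynomial (Fin m) k) := by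
    refine MvPolynomial.algHom_ext fun l => LinearMap.ext fun v => funext fun i => ?_
    have hE : ∀ w, vvRep p q ν h0 base hν hq (vmk p q ν m (E i.1)) w i = w i := fun w => by simp
    refine (hE _).symm.trans ?_
    rw [AlgHom.comp_apply, central_X]
    change (_ * vvRep p q ν h0 base hν hq _) v i = MvPolynomial.X l * v i
    rw [← map_mul, idem_mul_centralX]
    obtain ⟨l', h | h⟩ := exists_eq_base_or hb i l
    · rw [centralX_mul_idem_of_eq hν h, ← map_mul, vvRep_vmk]
      simp [h, letterPoly_base hν hb]
    · rw [centralX_mul_idem_of_eq_inv hν h, ← map_mul, ← map_neg, vvRep_vmk]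
      simp [h, letterPoly_base hν hb, letterPoly_inv]
  exact LinearMap.congr_fun (AlgHom.congr_fun this r) v

end CentralPolynomials

/-! ### The path basis -/

section PathBasis

open scoped Classical
open ThetaSeqs

variable {k : Type} [Field k] {m : ℕ} {p q : kˣ} {ν : kˣ →₀ ℕ} {base : Fin m → kˣ}
  (hν : ∀ a, ν a ≤ 1) (h0 : 0 < m)

/-- The product of generators along a reduced path from `j` to `i`. -/
def pathElt (p q : kˣ) (i j : ThetaSeqs ν m) : VV k p q ν m :=
  (ReducedPath.exists (p := p) (q := q) (h0 := h0) hν i.isThetaSeq j.isThetaSeq).choose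

theorem reducedPath_pathElt (i j : ThetaSeqs ν m) :
    ReducedPath p q ν h0 j.1 i.1 (pathElt hν h0 p q i j) :=
  (ReducedPath.exists (p := p) (q := q) (h0 := h0) hν i.isThetaSeq j.isThetaSeq).choose_spec

theorem ReducedPath.eq_pathElt {i j : ThetaSeqs ν m} {a : VV k p q ν m}
    (h : ReducedPath p q ν h0 j.1 i.1 a) : a = pathElt hν h0 p q i j :=
  ReducedPath.unique hν j.isThetaSeq h (reducedPath_pathElt hν h0 i j)

theorem pathElt_self (i : ThetaSeqs ν m) : pathElt hν h0 p q i i = vmk p q ν m (E i.1) :=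
  (ReducedPath.eq_pathElt hν h0 .refl).symm

theorem idem_mul_pathElt (i j : ThetaSeqs ν m) :
    vmk p q ν m (E i.1) * pathElt hν h0 p q i j = pathElt hν h0 p q i j :=
  (reducedPath_pathElt hν h0 i j).idem_mul

theorem sig_mul_pathElt_of_lt {s : Fin (m - 1)} {i j : ThetaSeqs ν m}
    (h : signedPos j.1 (i.1 (lo s)) < signedPos j.1 (i.1 (hi s))) :
    vmk p q ν m (Sg s) * pathElt hν h0 p q i j = pathElt hν h0 p q (swap s i) j := by
  refine ReducedPath.eq_pathElt hν h0 (.sig s _ _ ?_ ?_)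
  · rw [coe_swap, swapAt_swapAt]
    exact reducedPath_pathElt hν h0 i j
  · rwa [coe_swap, swapAt_lo, swapAt_hi]

theorem pi_mul_pathElt_of_pos {i j : ThetaSeqs ν m} (h : 0 < signedPos j.1 (i.1 ⟨0, h0⟩)) :
    vmk p q ν m Pg * pathElt hν h0 p q i j = pathElt hν h0 p q (flip h0 i) j := by
  refine ReducedPath.eq_pathElt hν h0 (.pi _ _ ?_ ?_)
  · rw [coe_flip, flipAt_flipAt]
    exact reducedPath_pathElt hν h0 i j
  · rwa [coe_flip, flipAt_zero, signedPos_inv, neg_lt_zero]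

variable (hb : IsThetaSeq ν base)

theorem sig_mul_pathElt_of_gt {s : Fin (m - 1)} {i j : ThetaSeqs ν m}
    (h : signedPos j.1 (i.1 (hi s)) < signedPos j.1 (i.1 (lo s))) :
    vmk p q ν m (Sg s) * pathElt hν h0 p q i j =
      central hν hb h0 (arrowPoly p base (i.1 (hi s)) (i.1 (lo s)) *
        arrowPoly p base (i.1 (lo s)) (i.1 (hi s))) * pathElt hν h0 p q (swap s i) j := by
  have h1 : vmk p q ν m (Sg s) * pathElt hν h0 p q (swap s i) j = pathElt hν h0 p q i j := by
    have := sig_mul_pathElt_of_lt (p := p) (q := q) hν h0 (s := s) (i := swap s i) (j := j)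
      (by rwa [coe_swap, swapAt_lo, swapAt_hi])
    rwa [ThetaSeqs.swap_swap] at this
  have h2 := sig_sq_mul_idem (p := p) (q := q) hν hb h0 s (swap s i)
  rw [coe_swap, swapAt_lo, swapAt_hi] at h2
  rw [← h1, ← idem_mul_pathElt, ← mul_assoc, ← mul_assoc, ← mul_assoc, mul_assoc (vmk p q ν m _)]
  exact congrArg (· * _) h2

theorem pi_mul_pathElt_of_neg (hq : q ≠ q⁻¹) {i j : ThetaSeqs ν m}
    (h : signedPos j.1 (i.1 ⟨0, h0⟩) < 0) :
    vmk p q ν m Pg * pathElt hν h0 p q i j =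
      central hν hb h0 (signPoly q base (i.1 ⟨0, h0⟩)⁻¹ *
        signPoly q base (i.1 ⟨0, h0⟩)) * pathElt hν h0 p q (flip h0 i) j := by
  have h1 : vmk p q ν m Pg * pathElt hν h0 p q (flip h0 i) j = pathElt hν h0 p q i j := by
    have := pi_mul_pathElt_of_pos (p := p) (q := q) hν h0 (i := flip h0 i) (j := j)
      (by rwa [coe_flip, flipAt_zero, signedPos_inv, neg_pos])
    rwa [ThetaSeqs.flip_flip] at this
  have h2 := pi_sq_mul_idem (p := p) (q := q) hν hb h0 hq (flip h0 i)
  rw [coe_flip, flipAt_zero, inv_inv] at h2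
  rw [← h1, ← idem_mul_pathElt, ← mul_assoc, ← mul_assoc, ← mul_assoc, mul_assoc (vmk p q ν m _)]
  exact congrArg (· * _) h2

/-- The linear combination of path elements with given central coefficients. -/
def ofCoeffs (p q : kˣ) :
    (ThetaSeqs ν m → ThetaSeqs ν m → MvPolynomial (Fin m) k) →ₗ[k] VV k p q ν m where
  toFun M := ∑ i, ∑ j, central hν hb h0 (M i j) * pathElt hν h0 p q i j
  map_add' M N := by simp only [Pi.add_apply, map_add, add_mul, Finset.sum_add_distrib]
  map_smul' c M := by
    simp only [Pi.smul_apply, map_smul, smul_mul_assoc, Finset.smul_sum, RingHom.id_apply]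

theorem ofCoeffs_apply (M : ThetaSeqs ν m → ThetaSeqs ν m → MvPolynomial (Fin m) k) :
    ofCoeffs hν h0 hb p q M =
      ∑ i, ∑ j, central hν hb h0 (M i j) * pathElt hν h0 p q i j := rfl

theorem ofCoeffs_single (i j : ThetaSeqs ν m) (r : MvPolynomial (Fin m) k) :
    ofCoeffs hν h0 hb p q (Pi.single i (Pi.single j r)) =
      central hν hb h0 r * pathElt hν h0 p q i j := by
  rw [ofCoeffs_apply, Finset.sum_eq_single i, Finset.sum_eq_single j]
  · simp
  · intro b _ h
    simp [h]
  · simp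
  · intro b _ h
    simp [h]
  · simp

theorem ofCoeffs_diagonal (r : ThetaSeqs ν m → MvPolynomial (Fin m) k) :
    ofCoeffs hν h0 hb p q (fun i j => if i = j then r i else 0) =
      ∑ i, central hν hb h0 (r i) * vmk p q ν m (E i.1) := by
  rw [ofCoeffs_apply]
  refine Finset.sum_congr rfl fun i _ => ?_
  rw [Finset.sum_eq_single i]
  · simp [pathElt_self]
  · intro b _ h
    simp [h.symm]
  · simp

theorem ofCoeffs_one :
    ofCoeffs hν h0 hb p q (fun i j => if i = j then 1 else 0) = 1 := by
  rw [ofCoeffs_diagonal, ← sum_idem p q ν]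
  simp

theorem ofCoeffs_x (l : Fin m) :
    ofCoeffs hν h0 hb p q (fun i j => if i = j then letterPoly base (i.1 l) else 0) =
      vmk p q ν m (X l) := by
  rw [ofCoeffs_diagonal, ← mul_one (vmk p q ν m (X l)), ← sum_idem p q ν, Finset.mul_sum]
  exact Finset.sum_congr rfl fun i _ => (x_mul_idem_eq_central hν hb h0 l i).symm

theorem ofCoeffs_idem (a : Fin m → kˣ) :
    ofCoeffs hν h0 hb p q (fun i j => if i = j then (if i.1 = a then 1 else 0) else 0) =
      vmk p q ν m (E a) := by
  rw [ofCoeffs_diagonal, ← one_mul (vmk p q ν m (E a)), ← sum_idem p q ν, Finset.sum_mul]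
  refine Finset.sum_congr rfl fun i _ => ?_
  split_ifs with h
  · rw [h, vmk_idem_mul, map_one, one_mul]
  · rw [vmk_idem_orth p q ν h, map_zero, zero_mul]

theorem ofCoeffs_surjective (hq : q ≠ q⁻¹) :
    Function.Surjective (ofCoeffs (p := p) (q := q) hν h0 hb) := by
  have hmem : ∀ i j r, central hν hb h0 r * pathElt hν h0 p q i j ∈
      LinearMap.range (ofCoeffs (p := p) (q := q) hν h0 hb) := fun i j r =>
    ⟨_, ofCoeffs_single hν h0 hb i j r⟩
  have hmem' : ∀ i j, pathElt hν h0 p q i j ∈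
      LinearMap.range (ofCoeffs (p := p) (q := q) hν h0 hb) := fun i j => by
    simpa using hmem i j 1
  have key : ∀ a : VV k p q ν m, ∀ x ∈ LinearMap.range (ofCoeffs (p := p) (q := q) hν h0 hb),
      a * x ∈ LinearMap.range (ofCoeffs (p := p) (q := q) hν h0 hb) := by
    intro a
    have red : ∀ a : VV k p q ν m, (∀ i j, ∃ i' r, a * pathElt hν h0 p q i j =
        central hν hb h0 r * pathElt hν h0 p q i' j) →
        ∀ x ∈ LinearMap.range (ofCoeffs (p := p) (q := q) hν h0 hb),
          a * x ∈ LinearMap.range (ofCoeffs (p := p) (q := q) hν h0 hb) := by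
      rintro a ha _ ⟨M, rfl⟩
      rw [ofCoeffs_apply, Finset.mul_sum]
      refine Submodule.sum_mem _ fun i _ => ?_
      rw [Finset.mul_sum]
      refine Submodule.sum_mem _ fun j _ => ?_
      obtain ⟨i', r, h⟩ := ha i j
      rw [← mul_assoc, central_comm, mul_assoc, h, ← mul_assoc, ← map_mul]
      exact hmem _ _ _
    induction a using vv_induction with
    | hx l =>
      refine red _ fun i j => ⟨i, letterPoly base (i.1 l), ?_⟩
      rw [← idem_mul_pathElt, ← mul_assoc, x_mul_idem_eq_central hν hb h0, mul_assoc]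
    | hs s =>
      refine red _ fun i j => ?_
      rcases lt_trichotomy (signedPos j.1 (i.1 (lo s))) (signedPos j.1 (i.1 (hi s)))
        with h | h | h
      · exact ⟨swap s i, 1, by rw [sig_mul_pathElt_of_lt hν h0 h, map_one, one_mul]⟩
      · have h1 : ∀ l, ν (i.1 l) ≠ 0 := i.isThetaSeq.apply_ne_zero
        exact absurd (i.isThetaSeq.injective hν
          (j.isThetaSeq.signedPos_injOn hν (h1 _) (h1 _) h)) (lo_ne_hi s)
      · exact ⟨swap s i, _, sig_mul_pathElt_of_gt hν h0 hb h⟩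
    | hi a =>
      refine red _ fun i j => ⟨i, if a = i.1 then 1 else 0, ?_⟩
      rw [← idem_mul_pathElt, ← mul_assoc]
      split_ifs with h
      · rw [h, vmk_idem_mul, map_one, one_mul]
      · rw [vmk_idem_orth p q ν h, map_zero, zero_mul, zero_mul]
    | hp =>
      refine red _ fun i j => ?_
      rcases lt_trichotomy (signedPos j.1 (i.1 ⟨0, h0⟩)) 0 with h | h | h
      · exact ⟨flip h0 i, _, pi_mul_pathElt_of_neg hν h0 hb hq h⟩
      · exact absurd h (j.isThetaSeq.signedPos_ne_zero hν (i.isThetaSeq.apply_ne_zero _))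
      · exact ⟨flip h0 i, 1, by rw [pi_mul_pathElt_of_pos hν h0 h, map_one, one_mul]⟩
    | hc c =>
      intro x hx
      rw [← Algebra.smul_def]
      exact Submodule.smul_mem _ _ hx
    | hadd a b ha hb =>
      intro x hx
      rw [add_mul]
      exact Submodule.add_mem _ (ha x hx) (hb x hx)
    | hmul a b ha hb =>
      intro x hx
      rw [mul_assoc]
      exact ha _ (hb x hx)
  intro a
  have := key a 1 ⟨_, ofCoeffs_one hν h0 hb⟩
  rwa [mul_one] at this

end PathBasis

/-! ### Features of sequences and the structure constants of the path basis -/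

section Frames

open scoped Classical
open ThetaSeqs

variable {k : Type} [Field k] {m : ℕ}

/-- The set of the pairs `(src f, tgt f)` which occur in increasing order in a sequence. -/
def featureSet (src tgt : Fin m → kˣ) (i : Fin m → kˣ) : Finset (Fin m) :=
  Finset.univ.filter fun f => signedPos i (src f) < signedPos i (tgt f)

/-- A choice of pairs of letters, one for each variable, which contains `(q⁻¹, q)` and each
arrow between letters up to inversion, together with the corresponding weights. -/
structure Frame (p q : kˣ) (ν : kˣ →₀ ℕ) (h0 : 0 < m) where
  base : Fin m → kˣ
  isThetaSeq : IsThetaSeq ν base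
  src : Fin m → kˣ
  tgt : Fin m → kˣ
  t : Fin m → MvPolynomial (Fin m) k
  src_zero : src ⟨0, h0⟩ = q⁻¹
  tgt_zero : tgt ⟨0, h0⟩ = q
  t_zero : t ⟨0, h0⟩ = letterPoly base q
  src_mem : ∀ f, ν (src f) ≠ 0
  tgt_mem : ∀ f, ν (tgt f) ≠ 0
  ne_inv : ∀ f, f ≠ ⟨0, h0⟩ → src f ≠ (tgt f)⁻¹
  eq_or_arrow : ∀ f, f ≠ ⟨0, h0⟩ → src f = tgt f ∨
    (Arrow p (src f) (tgt f) ∧ t f = letterPoly base (src f) - letterPoly base (tgt f))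
  exists_unique : ∀ a b, ν a ≠ 0 → ν b ≠ 0 → a ≠ b⁻¹ → Arrow p a b →
    ∃ f, f ≠ ⟨0, h0⟩ ∧ (src f = a ∧ tgt f = b ∨ src f = b⁻¹ ∧ tgt f = a⁻¹) ∧
      ∀ f', f' ≠ ⟨0, h0⟩ → (src f' = a ∧ tgt f' = b ∨ src f' = b⁻¹ ∧ tgt f' = a⁻¹) → f' = f
  regular : ∀ (v : Finset (Fin m)) (f : Fin m), f ∉ v → ∀ r, t f * r ∈ weightIdeal t v →
    r ∈ weightIdeal t v
  exists_erase : ∀ i, IsThetaSeq ν i → ∀ f ∈ featureSet src tgt i,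
    ∃ j, IsThetaSeq ν j ∧ featureSet src tgt j = (featureSet src tgt i).erase f

namespace Frame

variable {p q : kˣ} {ν : kˣ →₀ ℕ} {h0 : 0 < m} (S : Frame p q ν h0)

/-- The features of a sequence. -/
def φ (i : ThetaSeqs ν m) : Finset (Fin m) := featureSet S.src S.tgt i.1

theorem mem_φ {i : ThetaSeqs ν m} {f : Fin m} :
    f ∈ S.φ i ↔ signedPos i.1 (S.src f) < signedPos i.1 (S.tgt f) := by
  simp [φ, featureSet]

/-- The coefficient by which a path element acts on the polynomial representation. -/
def γ (i j : ThetaSeqs ν m) : MvPolynomial (Fin m) k := ∏ f ∈ S.φ j \ S.φ i, S.t f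

theorem γ_self (i : ThetaSeqs ν m) : S.γ i i = 1 := by simp [γ]

theorem t_ne_zero (f : Fin m) : S.t f ≠ 0 := by
  intro h
  have := S.regular ∅ f (Finset.notMem_empty f) 1 (by rw [h, zero_mul]; exact zero_mem _)
  simp [weightIdeal] at this

theorem γ_ne_zero (i j : ThetaSeqs ν m) : S.γ i j ≠ 0 :=
  Finset.prod_ne_zero_iff.2 fun f _ => S.t_ne_zero f

theorem γ_mul (i j l : ThetaSeqs ν m) :
    S.γ i j * S.γ j l = structConst S.t (S.φ i) (S.φ j) (S.φ l) * S.γ i l := by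
  have : ∀ u v : ThetaSeqs ν m, S.γ u v = ∏ f, if f ∈ S.φ v ∧ f ∉ S.φ u then S.t f else 1 := by
    intro u v
    rw [γ, ← Finset.prod_filter]
    congr 1
    ext f
    simp
  rw [this, this, this, structConst, ← Finset.prod_mul_distrib, ← Finset.prod_mul_distrib]
  refine Finset.prod_congr rfl fun f _ => ?_
  by_cases h1 : f ∈ S.φ i <;> by_cases h2 : f ∈ S.φ j <;> by_cases h3 : f ∈ S.φ l <;>
    simp [h1, h2, h3]

theorem γ_eq_of_iff {i i' j : ThetaSeqs ν m} (h : ∀ f ∈ S.φ j, f ∈ S.φ i' ↔ f ∈ S.φ i) :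
    S.γ i' j = S.γ i j := by
  unfold γ
  congr 1
  ext f
  simp only [Finset.mem_sdiff]
  exact and_congr_right fun hf => not_congr (h f hf)

theorem γ_eq_mul {i i' j : ThetaSeqs ν m} {f₀ : Fin m} (h1 : f₀ ∈ S.φ j) (h2 : f₀ ∈ S.φ i)
    (h3 : f₀ ∉ S.φ i') (h : ∀ f ∈ S.φ j, f ≠ f₀ → (f ∈ S.φ i' ↔ f ∈ S.φ i)) :
    S.γ i' j = S.t f₀ * S.γ i j := by
  unfold γ
  rw [← Finset.prod_insert (by simp [h2])]
  congr 1
  ext f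
  simp only [Finset.mem_sdiff, Finset.mem_insert]
  by_cases hf : f = f₀
  · subst hf; simp [h1, h3]
  · simp only [hf, false_or]
    exact and_congr_right fun hj => not_congr (h f hj hf)

variable (hν : ∀ a, ν a ≤ 1)

include hν

theorem γ_swap {i j : ThetaSeqs ν m} {s : Fin (m - 1)}
    (h : signedPos j.1 (i.1 (lo s)) < signedPos j.1 (i.1 (hi s))) :
    S.γ (swap s i) j = arrowPoly p S.base (i.1 (lo s)) (i.1 (hi s)) * S.γ i j := by
  have hi := i.isThetaSeq
  have hne : i.1 (lo s) ≠ i.1 (VVPaper.hi s) := fun h' => lo_ne_hi s (hi.injective hν h')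
  have key : ∀ f ∈ S.φ j,
      ¬ (S.src f = i.1 (lo s) ∧ S.tgt f = i.1 (VVPaper.hi s) ∨
        S.src f = (i.1 (VVPaper.hi s))⁻¹ ∧ S.tgt f = (i.1 (lo s))⁻¹) →
      (f ∈ S.φ (swap s i) ↔ f ∈ S.φ i) := by
    intro f hf hf'
    rw [mem_φ] at hf
    rw [mem_φ, mem_φ, coe_swap]
    refine hi.signedPos_swapAt_lt_iff hν s (S.src_mem f) (S.tgt_mem f)
      (fun h' => hf' (.inl h')) ?_ ?_ (fun h' => hf' (.inr ⟨h'.2, h'.1⟩))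
    · rintro ⟨h1, h2⟩
      rw [h1, h2] at hf
      exact lt_asymm h hf
    · rintro ⟨h1, h2⟩
      rw [h1, h2, signedPos_inv, signedPos_inv, neg_lt_neg_iff] at hf
      exact lt_asymm h hf
  have hzero : ∀ f, (S.src f = i.1 (lo s) ∧ S.tgt f = i.1 (VVPaper.hi s) ∨
      S.src f = (i.1 (VVPaper.hi s))⁻¹ ∧ S.tgt f = (i.1 (lo s))⁻¹) → f ≠ ⟨0, h0⟩ := by
    rintro f h1 rfl
    rw [S.src_zero, S.tgt_zero] at h1
    rcases h1 with ⟨h1, h2⟩ | ⟨h1, h2⟩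
    · exact hi.ne_inv hν _ _ (h1.symm.trans (congrArg _ h2))
    · exact hi.ne_inv hν (lo s) (VVPaper.hi s) (by rw [← h1, h2, inv_inv])
  by_cases hA : Arrow p (i.1 (lo s)) (i.1 (VVPaper.hi s))
  · obtain ⟨f, hf0, hf, huniq⟩ := S.exists_unique _ _ (hi.apply_ne_zero _) (hi.apply_ne_zero _)
      (hi.ne_inv hν _ _) hA
    have hlo : signedPos (swap s i).1 (i.1 (lo s)) = (VVPaper.hi s).1 + 1 := by
      rw [← (swap s i).isThetaSeq.signedPos_apply hν, coe_swap, swapAt_hi]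
    have hhi : signedPos (swap s i).1 (i.1 (VVPaper.hi s)) = (lo s).1 + 1 := by
      rw [← (swap s i).isThetaSeq.signedPos_apply hν, coe_swap, swapAt_lo]
    have hval : (VVPaper.hi s).1 = (lo s).1 + 1 := rfl
    have ht : S.t f = letterPoly S.base (i.1 (lo s)) - letterPoly S.base (i.1 (VVPaper.hi s)) := by
      rcases S.eq_or_arrow f hf0 with h1 | h1
      · rcases hf with hf | hf
        · exact absurd (hf.1.symm.trans (h1.trans hf.2)) hne
        · exact absurd (inv_injective (hf.1.symm.trans (h1.trans hf.2))).symm hne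
      · rw [h1.2]
        rcases hf with hf | hf
        · rw [hf.1, hf.2]
        · rw [hf.1, hf.2, letterPoly_inv, letterPoly_inv]; ring
    rw [arrowPoly, if_pos hA, ← ht]
    refine S.γ_eq_mul ?_ ?_ ?_ fun f' hf' hne' => key f' hf' fun h' =>
      hne' (huniq f' (hzero f' h') h')
    all_goals
      rw [mem_φ]
      rcases hf with ⟨h1, h2⟩ | ⟨h1, h2⟩
    · rwa [h1, h2]
    · rwa [h1, h2, signedPos_inv, signedPos_inv, neg_lt_neg_iff]
    · rw [h1, h2, hi.signedPos_apply hν, hi.signedPos_apply hν]; omega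
    · rw [h1, h2, hi.signedPos_apply_inv hν, hi.signedPos_apply_inv hν]; omega
    · rw [h1, h2, hlo, hhi]; omega
    · rw [h1, h2, signedPos_inv, signedPos_inv, hlo, hhi]; omega
  · rw [arrowPoly, if_neg hA, one_mul]
    refine S.γ_eq_of_iff fun f hf => key f hf fun h' => ?_
    rcases S.eq_or_arrow f (hzero f h') with h1 | h1
    · rcases h' with h' | h'
      · exact hne (h'.1.symm.trans (h1.trans h'.2))
      · exact hne (inv_injective (h'.1.symm.trans (h1.trans h'.2))).symm
    · rcases h' with h' | h'
      · rw [h'.1, h'.2] at h1; exact hA h1.1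
      · rw [h'.1, h'.2, arrow_inv_iff] at h1; exact hA h1.1

theorem γ_flip {i j : ThetaSeqs ν m} (h : 0 < signedPos j.1 (i.1 ⟨0, h0⟩)) :
    S.γ (flip h0 i) j = signPoly q S.base (i.1 ⟨0, h0⟩) * S.γ i j := by
  have hi := i.isThetaSeq
  have key : ∀ f ∈ S.φ j, f ≠ ⟨0, h0⟩ → (f ∈ S.φ (flip h0 i) ↔ f ∈ S.φ i) := by
    intro f _ hf
    rw [mem_φ, mem_φ, coe_flip]
    exact hi.signedPos_flipAt_lt_iff hν h0 (S.src_mem f) (S.tgt_mem f) (S.ne_inv f hf)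
  have hzero : ∀ i : ThetaSeqs ν m, ⟨0, h0⟩ ∈ S.φ i ↔ 0 < signedPos i.1 q := by
    intro i
    rw [mem_φ, S.src_zero, S.tgt_zero, signedPos_inv]
    omega
  by_cases hq : i.1 ⟨0, h0⟩ = q
  · rw [signPoly, if_pos hq, ← S.t_zero]
    refine S.γ_eq_mul ?_ ?_ ?_ key
    · rwa [hzero, ← hq]
    · rw [hzero, ← hq, hi.signedPos_apply hν]; simp
    · have := (flip h0 i).isThetaSeq.signedPos_apply hν ⟨0, h0⟩
      rw [coe_flip, flipAt_zero, signedPos_inv, hq] at this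
      rw [hzero, coe_flip]
      simp at this
      omega
  · rw [signPoly, if_neg hq, one_mul]
    refine S.γ_eq_of_iff fun f hf => ?_
    by_cases hf0 : f = ⟨0, h0⟩
    · subst hf0
      rw [hzero] at hf
      rw [hzero, hzero, coe_flip]
      refine hi.signedPos_flipAt_pos_iff hν h0 (S.tgt_zero ▸ S.tgt_mem ⟨0, h0⟩) (Ne.symm hq) ?_
      rintro rfl
      rw [signedPos_inv] at hf
      omega
    · exact key f hf hf0

theorem vvRep_reducedPath (hq : q ≠ q⁻¹) {i : Fin m → kˣ} {j : ThetaSeqs ν m}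
    {a : VV k p q ν m} (h : ReducedPath p q ν h0 j.1 i a) (hi : i ∈ thetaSeqs ν m) :
    vvRep p q ν h0 S.base hν hq a (Pi.single j 1) = Pi.single ⟨i, hi⟩ (S.γ ⟨i, hi⟩ j) := by
  induction h with
  | refl =>
    funext l
    rw [vvRep_vmk, faRep_E, S.γ_self]
    by_cases h : l = j
    · subst h; simp
    · simp [h]
  | sig s i a h hlt ih =>
    have ih' := ih (swap s ⟨i, hi⟩).2
    rw [map_mul, Module.End.mul_apply, ih', vvRep_vmk]
    have key := S.γ_swap hν (i := swap s ⟨i, hi⟩) (j := j) (s := s)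
      (by rwa [coe_swap, swapAt_lo, swapAt_hi])
    rw [ThetaSeqs.swap_swap, coe_swap, swapAt_lo, swapAt_hi] at key
    funext l
    rw [faRep_Sg]
    by_cases h : l = ⟨i, hi⟩
    · subst h
      rw [Pi.single_eq_same, key]
      exact congrArg (_ * ·) (Pi.single_eq_same (M := fun _ => MvPolynomial (Fin m) k) _ _)
    · rw [Pi.single_eq_of_ne h, Pi.single_eq_of_ne, mul_zero]
      intro h'
      exact h (by rw [← ThetaSeqs.swap_swap s l, h']; exact ThetaSeqs.swap_swap s ⟨i, hi⟩)
  | pi i a h hlt ih =>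
    have ih' := ih (flip h0 ⟨i, hi⟩).2
    rw [map_mul, Module.End.mul_apply, ih', vvRep_vmk]
    have key := S.γ_flip hν (i := flip h0 ⟨i, hi⟩) (j := j)
      (by rwa [coe_flip, flipAt_zero, signedPos_inv, neg_pos])
    rw [ThetaSeqs.flip_flip, coe_flip, flipAt_zero] at key
    funext l
    rw [faRep_Pg]
    by_cases h : l = ⟨i, hi⟩
    · subst h
      rw [Pi.single_eq_same, key]
      exact congrArg (_ * ·) (Pi.single_eq_same (M := fun _ => MvPolynomial (Fin m) k) _ _)
    · rw [Pi.single_eq_of_ne h, Pi.single_eq_of_ne, mul_zero]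
      intro h'
      exact h (by rw [← ThetaSeqs.flip_flip h0 l, h']; exact ThetaSeqs.flip_flip h0 ⟨i, hi⟩)

theorem vvRep_pathElt (hq : q ≠ q⁻¹) (i j : ThetaSeqs ν m) :
    vvRep p q ν h0 S.base hν hq (pathElt hν h0 p q i j) (Pi.single j 1) =
      Pi.single i (S.γ i j) :=
  S.vvRep_reducedPath hν hq (reducedPath_pathElt hν h0 i j) i.2

theorem vvRep_pathElt_of_ne (hq : q ≠ q⁻¹) (i : ThetaSeqs ν m) {j l : ThetaSeqs ν m}
    (h : l ≠ j) : vvRep p q ν h0 S.base hν hq (pathElt hν h0 p q i j) (Pi.single l 1) = 0 := by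
  rw [← (reducedPath_pathElt hν h0 i j).mul_idem, map_mul, Module.End.mul_apply, vvRep_vmk]
  have : faRep p q ν h0 S.base (E j.1) (Pi.single l 1) = 0 := by
    funext a
    rw [faRep_E]
    split_ifs with h'
    · rw [Pi.single_eq_of_ne]
      · rfl
      · rintro rfl
        exact h (Subtype.ext h')
    · rfl
  rw [this, map_zero]

theorem vvRep_ofCoeffs (hq : q ≠ q⁻¹)
    (M : ThetaSeqs ν m → ThetaSeqs ν m → MvPolynomial (Fin m) k) (i j : ThetaSeqs ν m) :
    vvRep p q ν h0 S.base hν hq (ofCoeffs hν h0 S.isThetaSeq p q M) (Pi.single j 1) i =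
      S.γ i j * M i j := by
  have key : ∀ a b, vvRep p q ν h0 S.base hν hq
      (central hν S.isThetaSeq h0 (M a b) * pathElt hν h0 p q a b) (Pi.single j 1) i =
        if b = j then if a = i then S.γ i j * M i j else 0 else 0 := by
    intro a b
    rw [map_mul, Module.End.mul_apply, vvRep_central, Pi.smul_apply, smul_eq_mul]
    split_ifs with h1 h2
    · rw [h1, h2, vvRep_pathElt, Pi.single_eq_same, mul_comm]
    · rw [h1, vvRep_pathElt, Pi.single_eq_of_ne (Ne.symm h2), mul_zero]
    · rw [vvRep_pathElt_of_ne S hν hq a (Ne.symm h1), Pi.zero_apply, mul_zero]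
  rw [ofCoeffs_apply, map_sum, LinearMap.sum_apply, Finset.sum_apply]
  simp only [map_sum, LinearMap.sum_apply, Finset.sum_apply, key]
  simp

end Frame

end Frames

/-! ### The cellular structure attached to a frame -/

section CellStructure

open scoped Classical
open ThetaSeqs

variable {k : Type} [Field k] {m : ℕ} {p q : kˣ} {ν : kˣ →₀ ℕ} {h0 : 0 < m}

theorem ofCoeffs_permutation {base : Fin m → kˣ} (hν : ∀ a, ν a ≤ 1) (hb : IsThetaSeq ν base)
    (f : ThetaSeqs ν m → ThetaSeqs ν m) {a : VV k p q ν m}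
    (h : ∀ j, a * vmk p q ν m (E j.1) = pathElt hν h0 p q (f j) j) :
    ofCoeffs hν h0 hb p q (fun i j => if i = f j then 1 else 0) = a := by
  rw [ofCoeffs_apply, Finset.sum_comm, ← mul_one a, ← sum_idem p q ν, Finset.mul_sum]
  refine Finset.sum_congr rfl fun j _ => ?_
  rw [h, Finset.sum_eq_single (f j)]
  · rw [if_pos rfl, map_one, one_mul]
  · intro i _ hi
    rw [if_neg hi, map_zero, zero_mul]
  · intro hj
    exact absurd (Finset.mem_univ _) hj

theorem ofCoeffs_sig {base : Fin m → kˣ} (hν : ∀ a, ν a ≤ 1) (hb : IsThetaSeq ν base)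
    (s : Fin (m - 1)) :
    ofCoeffs hν h0 hb p q (fun i j => if i = swap s j then 1 else 0) = vmk p q ν m (Sg s) := by
  refine ofCoeffs_permutation hν hb _ fun j => ?_
  rw [← pathElt_self hν h0, sig_mul_pathElt_of_lt]
  rw [j.isThetaSeq.signedPos_apply hν, j.isThetaSeq.signedPos_apply hν]
  simp [lo, hi]

theorem ofCoeffs_pi {base : Fin m → kˣ} (hν : ∀ a, ν a ≤ 1) (hb : IsThetaSeq ν base) :
    ofCoeffs hν h0 hb p q (fun i j => if i = flip h0 j then 1 else 0) = vmk p q ν m Pg := by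
  refine ofCoeffs_permutation hν hb _ fun j => ?_
  rw [← pathElt_self hν h0, pi_mul_pathElt_of_pos]
  rw [j.isThetaSeq.signedPos_apply hν]
  simp

namespace Frame

variable (S : Frame p q ν h0) (hν : ∀ a, ν a ≤ 1) (hq : q ≠ q⁻¹)

/-- The coordinates with respect to the path basis. -/
def coeffs : VV k p q ν m ≃ₗ[k] (ThetaSeqs ν m → ThetaSeqs ν m → MvPolynomial (Fin m) k) :=
  (LinearEquiv.ofBijective (ofCoeffs hν h0 S.isThetaSeq p q) ⟨by
    intro M N hMN
    funext i j
    refine mul_left_cancel₀ (S.γ_ne_zero i j) ?_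
    rw [← S.vvRep_ofCoeffs hν hq, ← S.vvRep_ofCoeffs hν hq, hMN],
    ofCoeffs_surjective hν h0 S.isThetaSeq hq⟩).symm

theorem coeffs_ofCoeffs (M : ThetaSeqs ν m → ThetaSeqs ν m → MvPolynomial (Fin m) k) :
    S.coeffs hν hq (ofCoeffs hν h0 S.isThetaSeq p q M) = M :=
  LinearEquiv.ofBijective_symm_apply_apply _ _

theorem vvRep_apply_single (a : VV k p q ν m) (i j : ThetaSeqs ν m) :
    vvRep p q ν h0 S.base hν hq a (Pi.single j 1) i = S.γ i j * S.coeffs hν hq a i j := by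
  obtain ⟨M, rfl⟩ := ofCoeffs_surjective hν h0 S.isThetaSeq hq a
  rw [coeffs_ofCoeffs, S.vvRep_ofCoeffs hν hq]

theorem coeffs_mul (a b : VV k p q ν m) (i l : ThetaSeqs ν m) :
    S.coeffs hν hq (a * b) i l = ∑ j, structConst S.t (S.φ i) (S.φ j) (S.φ l) *
      S.coeffs hν hq a i j * S.coeffs hν hq b j l := by
  refine mul_left_cancel₀ (S.γ_ne_zero i l) ?_
  set v := vvRep p q ν h0 S.base hν hq b (Pi.single l 1) with hv
  have hsum : v = ∑ j, (S.γ j l * S.coeffs hν hq b j l) •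
      (Pi.single j 1 : ThetaSeqs ν m → MvPolynomial (Fin m) k) := by
    rw [← Finset.univ_sum_single v]
    refine Finset.sum_congr rfl fun j _ => ?_
    rw [hv, vvRep_apply_single, ← Pi.single_smul, smul_eq_mul, mul_one]
  rw [← vvRep_apply_single, map_mul, Module.End.mul_apply, ← hv, hsum, map_sum,
    Finset.sum_apply, Finset.mul_sum]
  refine Finset.sum_congr rfl fun j _ => ?_
  rw [map_smul, Pi.smul_apply, vvRep_apply_single, smul_eq_mul]
  linear_combination (S.coeffs hν hq a i j * S.coeffs hν hq b j l) * S.γ_mul i j l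

/-- The anti-automorphism which transposes coordinates. -/
def antiInvolution : VV k p q ν m →ₗ[k] VV k p q ν m where
  toFun a := ofCoeffs hν h0 S.isThetaSeq p q fun i j => S.coeffs hν hq a j i
  map_add' a b := by
    rw [← map_add]
    refine congrArg _ ?_
    funext i j
    simp
  map_smul' c a := by
    rw [RingHom.id_apply, ← map_smul]
    refine congrArg _ ?_
    funext i j
    simp

theorem coeffs_antiInvolution (a : VV k p q ν m) (i j : ThetaSeqs ν m) :
    S.coeffs hν hq (S.antiInvolution hν hq a) i j = S.coeffs hν hq a j i := by
  rw [antiInvolution, LinearMap.coe_mk, AddHom.coe_mk, coeffs_ofCoeffs]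

theorem antiInvolution_ofCoeffs {M : ThetaSeqs ν m → ThetaSeqs ν m → MvPolynomial (Fin m) k}
    (hM : ∀ i j, M i j = M j i) {a : VV k p q ν m}
    (ha : ofCoeffs hν h0 S.isThetaSeq p q M = a) : S.antiInvolution hν hq a = a := by
  refine (S.coeffs hν hq).injective ?_
  funext i j
  rw [coeffs_antiInvolution, ← ha, coeffs_ofCoeffs, hM]

theorem coeffs_one (i j : ThetaSeqs ν m) :
    S.coeffs hν hq 1 i j = if i = j then 1 else 0 := by
  rw [← ofCoeffs_one hν h0 S.isThetaSeq, coeffs_ofCoeffs]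

theorem isKInvolution : IsKInvolution (S.antiInvolution hν hq) where
  map_mul a b := by
    refine (S.coeffs hν hq).injective ?_
    funext i l
    rw [coeffs_antiInvolution, coeffs_mul, coeffs_mul]
    refine Finset.sum_congr rfl fun j _ => ?_
    rw [coeffs_antiInvolution, coeffs_antiInvolution, structConst_symm]
    ring
  map_one := antiInvolution_ofCoeffs S hν hq (fun i j => by simp only [eq_comm])
    (ofCoeffs_one hν h0 S.isThetaSeq)
  involutive a := by
    refine (S.coeffs hν hq).injective ?_
    funext i j
    rw [coeffs_antiInvolution, coeffs_antiInvolution]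

/-- The cellular structure attached to a frame. -/
def cellData : CellData k (VV k p q ν m) (ThetaSeqs ν m) (Fin m) m where
  ω := S.antiInvolution hν hq
  isInv := S.isKInvolution hν hq
  t := S.t
  regular := S.regular
  φ := S.φ
  exists_erase i f hf := by
    obtain ⟨j, hj, h⟩ := S.exists_erase i.1 i.isThetaSeq f hf
    exact ⟨⟨j, mem_thetaSeqs.2 hj⟩, h⟩
  β := S.coeffs hν hq
  β_mul := S.coeffs_mul hν hq
  β_one := S.coeffs_one hν hq
  β_inv := S.coeffs_antiInvolution hν hq

theorem isAffineCellular : IsAffineCellular k (VV k p q ν m) (S.antiInvolution hν hq) :=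
  (S.cellData hν hq).isAffineCellular

theorem antiInvolution_x (l : Fin m) :
    S.antiInvolution hν hq (vmk p q ν m (X l)) = vmk p q ν m (X l) :=
  S.antiInvolution_ofCoeffs hν hq
    (fun i j => by
      by_cases h : i = j
      · rw [h]
      · rw [if_neg h, if_neg (Ne.symm h)])
    (ofCoeffs_x hν h0 S.isThetaSeq l)

theorem antiInvolution_idem (a : Fin m → kˣ) :
    S.antiInvolution hν hq (vmk p q ν m (E a)) = vmk p q ν m (E a) :=
  S.antiInvolution_ofCoeffs hν hq
    (fun i j => by
      by_cases h : i = j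
      · rw [h]
      · rw [if_neg h, if_neg (Ne.symm h)])
    (ofCoeffs_idem hν h0 S.isThetaSeq a)

theorem antiInvolution_sig (s : Fin (m - 1)) :
    S.antiInvolution hν hq (vmk p q ν m (Sg s)) = vmk p q ν m (Sg s) := by
  refine S.antiInvolution_ofCoeffs hν hq (fun i j => ?_) (ofCoeffs_sig hν S.isThetaSeq s)
  have : i = swap s j ↔ j = swap s i :=
    ⟨fun h => by rw [h, ThetaSeqs.swap_swap], fun h => by rw [h, ThetaSeqs.swap_swap]⟩
  simp only [this]

theorem antiInvolution_pi :
    S.antiInvolution hν hq (vmk p q ν m Pg) = vmk p q ν m Pg := by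
  refine S.antiInvolution_ofCoeffs hν hq (fun i j => ?_) (ofCoeffs_pi hν S.isThetaSeq)
  have : i = flip h0 j ↔ j = flip h0 i :=
    ⟨fun h => by rw [h, ThetaSeqs.flip_flip], fun h => by rw [h, ThetaSeqs.flip_flip]⟩
  simp only [this]

end Frame

end CellStructure

/-! ### Frames attached to forests of letters -/

section ForestFrames

open scoped Classical

variable {k : Type} [Field k] {m : ℕ}

/-- Surjective endomorphisms of noetherian rings are injective. -/
theorem ringHom_injective_of_surjective {R : Type} [CommRing R] [IsNoetherianRing R] (f : R →+* R)
    (hf : Function.Surjective f) : Function.Injective f := by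
  have hle : ∀ n, RingHom.ker (f ^ n) ≤ RingHom.ker (f ^ (n + 1)) := by
    intro n x hx
    rw [RingHom.mem_ker] at hx ⊢
    rw [pow_succ', RingHom.mul_def, RingHom.comp_apply, hx, map_zero]
  obtain ⟨n, hn⟩ := monotone_stabilizes_iff_noetherian.2 ‹IsNoetherianRing R›
    ⟨_, monotone_nat_of_le_succ hle⟩
  rw [injective_iff_map_eq_zero]
  intro x hx
  obtain ⟨y, rfl⟩ := hf.iterate n x
  have h := hn (n + 1) n.le_succ
  simp only [OrderHom.coe_mk] at h
  rw [← RingHom.coe_pow, ← RingHom.mem_ker, h, RingHom.mem_ker, RingHom.coe_pow,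
    Function.iterate_succ_apply', hx]

theorem mem_weightIdeal_X_of_mul_mem (v : Finset (Fin m)) (f : Fin m) (hf : f ∉ v)
    (r : MvPolynomial (Fin m) k)
    (h : MvPolynomial.X f * r ∈ weightIdeal (MvPolynomial.X (R := k)) v) :
    r ∈ weightIdeal (MvPolynomial.X (R := k)) v := by
  rw [weightIdeal, MvPolynomial.mem_ideal_span_X_image] at h ⊢
  intro d hd
  obtain ⟨i, hi, hd'⟩ := h (Finsupp.single f 1 + d) (by
    rwa [MvPolynomial.mem_support_iff, MvPolynomial.coeff_X_mul, ← MvPolynomial.mem_support_iff])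
  refine ⟨i, hi, ?_⟩
  have hif : f ≠ i := by rintro rfl; exact hf hi
  simpa [Finsupp.single_apply, hif] using hd'

/-- Weights which generate the polynomial ring form regular sequences in every order. -/
theorem mem_weightIdeal_of_mul_mem {t : Fin m → MvPolynomial (Fin m) k}
    (ht : Function.Surjective (MvPolynomial.aeval t : MvPolynomial (Fin m) k →ₐ[k] _))
    (v : Finset (Fin m)) (f : Fin m) (hf : f ∉ v) (r : MvPolynomial (Fin m) k)
    (h : t f * r ∈ weightIdeal t v) : r ∈ weightIdeal t v := by
  have hinj := ringHom_injective_of_surjective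
    (MvPolynomial.aeval t : MvPolynomial (Fin m) k →ₐ[k] _).toRingHom ht
  let e := RingEquiv.ofBijective (MvPolynomial.aeval t : MvPolynomial (Fin m) k →ₐ[k] _).toRingHom
    ⟨hinj, ht⟩
  have he : ∀ l, e (MvPolynomial.X l) = t l := fun l => MvPolynomial.aeval_X t l
  have hmap : weightIdeal t v = (weightIdeal (MvPolynomial.X (R := k)) v).map e := by
    rw [weightIdeal, weightIdeal, Ideal.map_span, Set.image_image]
    simp only [he]
  obtain ⟨r, rfl⟩ := e.surjective r
  rw [hmap] at h ⊢
  rw [← he, ← map_mul] at h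
  rw [Ideal.mem_map_iff_of_surjective _ e.surjective] at h ⊢
  obtain ⟨x, hx, hxe⟩ := h
  rw [e.injective hxe] at hx
  exact ⟨r, mem_weightIdeal_X_of_mul_mem v f hf r hx, rfl⟩

theorem aeval_surjective_of_triangular {t : Fin m → MvPolynomial (Fin m) k}
    (ht : ∀ f, t f = MvPolynomial.X f ∨
      (∃ l < f, t f = MvPolynomial.X f - MvPolynomial.X l) ∨
      ∃ l < f, t f = MvPolynomial.X l - MvPolynomial.X f) :
    Function.Surjective (MvPolynomial.aeval t : MvPolynomial (Fin m) k →ₐ[k] _) := by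
  have hX : ∀ f, MvPolynomial.X f ∈ (MvPolynomial.aeval t :
      MvPolynomial (Fin m) k →ₐ[k] MvPolynomial (Fin m) k).range := by
    intro f
    induction f using WellFoundedLT.induction with
    | ind f ih =>
      have hmem : t f ∈ (MvPolynomial.aeval t :
          MvPolynomial (Fin m) k →ₐ[k] MvPolynomial (Fin m) k).range :=
        ⟨MvPolynomial.X f, MvPolynomial.aeval_X t f⟩
      rcases ht f with h | ⟨l, hl, h⟩ | ⟨l, hl, h⟩
      · rwa [h] at hmem
      · have := add_mem hmem (ih l hl)
        rwa [h, sub_add_cancel] at this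
      · have := sub_mem (ih l hl) hmem
        rwa [h, sub_sub_cancel] at this
  rw [← AlgHom.range_eq_top, eq_top_iff, ← MvPolynomial.adjoin_range_X, Algebra.adjoin_le_iff]
  rintro _ ⟨f, rfl⟩
  exact hX f

variable {p q : kˣ} {ν : kˣ →₀ ℕ}

/-- Letters which form a forest rooted at their minimal elements have well-defined edges. -/
theorem exists_edge {base : Fin m → kˣ} (hp2 : p ^ 2 ≠ 1) (hp4 : p ^ 4 ≠ 1)
    (hpar : ∀ f l l', l < f → l' < f →
      (Arrow p (base f) (base l) ∨ Arrow p (base l) (base f)) →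
      (Arrow p (base f) (base l') ∨ Arrow p (base l') (base f)) → l = l') (f : Fin m) :
    ∃ e : Fin m × Fin m,
      (e.1 = f ∧ e.2 = f ∨ e.1 = f ∧ e.2 < f ∧ Arrow p (base e.1) (base e.2) ∨
        e.2 = f ∧ e.1 < f ∧ Arrow p (base e.1) (base e.2)) ∧
      ∀ a b, Arrow p (base a) (base b) → max a b = f → e = (a, b) := by
  have hloop : ∀ a : kˣ, ¬ Arrow p a a := fun a h => hp2 (mul_eq_right.1 h.symm)
  have hdouble : ∀ a b : kˣ, Arrow p a b → ¬ Arrow p b a := by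
    intro a b h h'
    rw [Arrow] at h h'
    rw [h', ← mul_assoc, ← pow_add] at h
    exact hp4 (mul_eq_right.1 h.symm)
  have hne : ∀ a b, Arrow p (base a) (base b) → a ≠ b := by
    rintro a _ h rfl
    exact hloop _ h
  by_cases h : ∃ e : Fin m × Fin m, Arrow p (base e.1) (base e.2) ∧ max e.1 e.2 = f
  · obtain ⟨⟨a, b⟩, h, rfl⟩ := h
    refine ⟨(a, b), ?_, ?_⟩
    · rcases lt_or_gt_of_ne (hne a b h) with hlt | hlt
      · exact Or.inr (Or.inr ⟨(max_eq_right hlt.le).symm, by simpa using hlt, h⟩)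
      · exact Or.inr (Or.inl ⟨(max_eq_left hlt.le).symm, by simpa using hlt, h⟩)
    · intro a' b' h' hmax
      dsimp only at h hmax
      rcases lt_or_gt_of_ne (hne a b h) with hlt | hlt <;>
        rcases lt_or_gt_of_ne (hne a' b' h') with hlt' | hlt'
      · rw [max_eq_right hlt.le, max_eq_right hlt'.le] at hmax
        subst hmax
        rw [hpar b' a a' hlt hlt' (Or.inr h) (Or.inr h')]
      · rw [max_eq_right hlt.le, max_eq_left hlt'.le] at hmax
        subst hmax
        rw [hpar a' a b' hlt hlt' (Or.inr h) (Or.inl h')] at h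
        exact absurd h' (hdouble _ _ h)
      · rw [max_eq_left hlt.le, max_eq_right hlt'.le] at hmax
        subst hmax
        rw [hpar b' b a' hlt hlt' (Or.inl h) (Or.inr h')] at h
        exact absurd h' (hdouble _ _ h)
      · rw [max_eq_left hlt.le, max_eq_left hlt'.le] at hmax
        subst hmax
        rw [hpar a' b b' hlt hlt' (Or.inl h) (Or.inl h')]
  · refine ⟨(f, f), Or.inl ⟨rfl, rfl⟩, fun a b hab hmax => absurd ⟨(a, b), hab, hmax⟩ h⟩

theorem nonempty_frame {h0 : 0 < m} {base : Fin m → kˣ} (hν : ∀ a, ν a ≤ 1)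
    (hb : IsThetaSeq ν base) (hp2 : p ^ 2 ≠ 1) (hp4 : p ^ 4 ≠ 1) (hq : base ⟨0, h0⟩ = q)
    (hpar : ∀ f l l', l < f → l' < f →
      (Arrow p (base f) (base l) ∨ Arrow p (base l) (base f)) →
      (Arrow p (base f) (base l') ∨ Arrow p (base l') (base f)) → l = l')
    (hcross : ∀ f l, f ≠ l →
      ¬ Arrow p (base f) (base l)⁻¹ ∧ ¬ Arrow p (base f)⁻¹ (base l)) :
    Nonempty (Frame p q ν h0) := by
  choose e he hcov using exists_edge hp2 hp4 hpar
  have hmin : ∀ l f : Fin m, l < f → f ≠ ⟨0, h0⟩ := by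
    rintro l f h rfl
    exact absurd h (Nat.not_lt_zero l.1)
  have he0 : e ⟨0, h0⟩ = (⟨0, h0⟩, ⟨0, h0⟩) := by
    rcases he ⟨0, h0⟩ with h | h | h
    · exact Prod.ext h.1 h.2
    · exact absurd rfl (hmin _ _ h.2.1)
    · exact absurd rfl (hmin _ _ h.2.1)
  let src : Fin m → kˣ := fun f => if f = ⟨0, h0⟩ then q⁻¹ else base (e f).1
  let tgt : Fin m → kˣ := fun f => base (e f).2
  let t : Fin m → MvPolynomial (Fin m) k := fun f =>
    if (e f).1 = (e f).2 then MvPolynomial.X f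
    else MvPolynomial.X (e f).1 - MvPolynomial.X (e f).2
  have hsrc0 : src ⟨0, h0⟩ = q⁻¹ := if_pos rfl
  have hsrc : ∀ f, f ≠ ⟨0, h0⟩ → src f = base (e f).1 := fun f hf => if_neg hf
  have htgt0 : tgt ⟨0, h0⟩ = q := by simp only [tgt, he0, hq]
  refine ⟨⟨base, hb, src, tgt, t, hsrc0, htgt0, ?_, ?_, fun f => hb.apply_ne_zero _, ?_, ?_, ?_,
    ?_, ?_⟩⟩
  · rw [← hq, letterPoly_base hν hb]
    simp only [t, he0, if_true]
  · intro f
    by_cases hf : f = ⟨0, h0⟩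
    · rw [hf, hsrc0, hb.apply_inv, ← hq]
      exact hb.apply_ne_zero _
    · rw [hsrc f hf]
      exact hb.apply_ne_zero _
  · intro f hf
    rw [hsrc f hf]
    exact hb.ne_inv hν _ _
  · intro f hf
    rw [hsrc f hf, letterPoly_base hν hb, letterPoly_base hν hb]
    rcases he f with h | h | h
    · exact Or.inl (by simp only [tgt, h.1, h.2])
    · exact Or.inr ⟨h.2.2, if_neg (by rw [h.1]; exact h.2.1.ne')⟩
    · exact Or.inr ⟨h.2.2, if_neg (by rw [h.1]; exact h.2.1.ne)⟩
  · have key : ∀ a b, Arrow p (base a) (base b) → a ≠ b → max a b ≠ ⟨0, h0⟩ ∧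
        src (max a b) = base a ∧ tgt (max a b) = base b ∧ ∀ f, f ≠ ⟨0, h0⟩ →
          src f = base a → tgt f = base b → f = max a b := by
      intro a b h hab
      have hm0 : max a b ≠ ⟨0, h0⟩ := by
        rcases lt_or_gt_of_ne hab with hlt | hlt
        · rw [max_eq_right hlt.le]; exact hmin _ _ hlt
        · rw [max_eq_left hlt.le]; exact hmin _ _ hlt
      refine ⟨hm0, by rw [hsrc _ hm0, hcov _ _ _ h rfl], by simp only [tgt, hcov _ _ _ h rfl], ?_⟩
      intro f hf hfa hfb
      rw [hsrc f hf] at hfa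
      have h1 := hb.injective hν hfa
      have h2 := hb.injective hν hfb
      rcases he f with h' | h' | h'
      · exact absurd (h1.symm.trans (h'.1.trans (h'.2.symm.trans h2))) hab
      · rw [← h1, ← h2, h'.1, max_eq_left h'.2.1.le]
      · rw [← h1, ← h2, h'.1, max_eq_right h'.2.1.le]
    have hinv : ∀ f, f ≠ ⟨0, h0⟩ → ∀ l, src f ≠ (base l)⁻¹ := by
      intro f hf l
      rw [hsrc f hf]
      exact hb.ne_inv hν _ _
    intro a b ha hb' hab h
    obtain ⟨x, hx⟩ := (hb.ne_zero_iff a).1 ha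
    obtain ⟨y, hy⟩ := (hb.ne_zero_iff b).1 hb'
    have hxy : x ≠ y := by
      rintro rfl
      rcases hx with rfl | rfl <;> rcases hy with rfl | rfl
      · exact hp2 (mul_eq_right.1 h.symm)
      · exact hab (inv_inv _).symm
      · exact hab rfl
      · exact hp2 (mul_eq_right.1 h.symm)
    rcases hx with rfl | rfl <;> rcases hy with rfl | rfl
    · obtain ⟨h1, h2, h3, h4⟩ := key x y h hxy
      refine ⟨_, h1, Or.inl ⟨h2, h3⟩, fun f hf hf' => ?_⟩
      rcases hf' with hf' | hf'
      · exact h4 f hf hf'.1 hf'.2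
      · exact absurd hf'.1 (hinv f hf _)
    · exact absurd h (hcross x y hxy).1
    · exact absurd h (hcross x y hxy).2
    · have h' : Arrow p (base y) (base x) := arrow_inv_iff.1 h
      obtain ⟨h1, h2, h3, h4⟩ := key y x h' hxy.symm
      refine ⟨_, h1, Or.inr ⟨by rw [inv_inv, h2], by rw [inv_inv, h3]⟩, fun f hf hf' => ?_⟩
      rw [inv_inv, inv_inv] at hf'
      rcases hf' with hf' | hf'
      · exact absurd hf'.1 (hinv f hf _)
      · exact h4 f hf hf'.1 hf'.2
  · refine mem_weightIdeal_of_mul_mem (aeval_surjective_of_triangular fun f => ?_)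
    rcases he f with h | h | h
    · exact Or.inl (if_pos (h.1.trans h.2.symm))
    · refine Or.inr (Or.inl ⟨_, h.2.1, ?_⟩)
      simp only [t]
      rw [if_neg (by rw [h.1]; exact h.2.1.ne'), h.1]
    · refine Or.inr (Or.inr ⟨_, h.2.1, ?_⟩)
      simp only [t]
      rw [if_neg (by rw [h.1]; exact h.2.1.ne), h.1]
  · intro i hi f hf
    set v := (featureSet src tgt i).erase f with hv
    let j : Fin m → kˣ := fun g => if g ∈ v ↔ (e g).2 = g then base g else (base g)⁻¹
    have hj : IsThetaSeq ν j := hb.of_forall fun g => by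
      by_cases h : g ∈ v ↔ (e g).2 = g
      · exact Or.inl (if_pos h)
      · exact Or.inr (if_neg h)
    have hpos : ∀ g, signedPos j (base g) = if g ∈ v ↔ (e g).2 = g then (g.1 : ℤ) + 1
        else -((g.1 : ℤ) + 1) := by
      intro g
      split_ifs with h
      · rw [← hj.signedPos_apply hν g]
        exact congrArg _ (if_pos h).symm
      · rw [← hj.signedPos_apply_inv hν g]
        exact congrArg _ (by rw [← inv_inv (base g)]; exact congrArg _ (if_neg h).symm)
    refine ⟨j, hj, ?_⟩
    ext g
    rw [featureSet, Finset.mem_filter]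
    simp only [Finset.mem_univ, true_and]
    by_cases hg : g = ⟨0, h0⟩
    · rw [hg, hsrc0, htgt0, signedPos_inv, ← hq, hpos, he0]
      simp only [iff_true]
      split_ifs with h <;> simp [h] <;> omega
    · rw [hsrc g hg]
      simp only [tgt]
      rw [hpos, hpos]
      rcases he g with h | h | h
      · have : g ∉ v := by
          intro hgv
          have := (Finset.mem_filter.1 (Finset.mem_of_mem_erase hgv)).2
          rw [hsrc g hg] at this
          simp only [tgt, h.1, h.2, lt_irrefl] at this
        simp [h.1, h.2, this]
      · have h1 := h.2.1
        rw [Fin.lt_def] at h1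
        have h2 : (e g).2 ≠ g := h.2.1.ne
        rw [h.1]
        by_cases hgv : g ∈ v <;> simp only [hgv, h2] <;> simp <;> split_ifs <;> omega
      · have h1 := h.2.1
        rw [Fin.lt_def] at h1
        rw [h.1]
        by_cases hgv : g ∈ v <;> simp only [hgv, h.1] <;> simp <;> split_ifs <;> omega

end ForestFrames

/-! ### Letters in the orbit of `q` -/

section OrbitLetters

variable {k : Type} [Field k] {p q : kˣ}

/-- The letter with the given exponent. -/
def letter (p q : kˣ) (n : ℤ) : kˣ := p ^ (2 * n) * q

theorem zpow_injective_of_pow_ne_one (hroot : ∀ n : ℕ, 0 < n → p ^ n ≠ 1) {a b : ℤ}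
    (h : p ^ a = p ^ b) : a = b := by
  refine injective_zpow_iff_not_isOfFinOrder.2 (fun h' => ?_) h
  obtain ⟨n, hn, h'⟩ := isOfFinOrder_iff_pow_eq_one.1 h'
  exact hroot n hn h'

theorem letter_injective (hroot : ∀ n : ℕ, 0 < n → p ^ n ≠ 1) :
    Function.Injective (letter p q) := by
  intro a b h
  have := zpow_injective_of_pow_ne_one hroot (mul_right_cancel h)
  omega

theorem arrow_letter_iff (hroot : ∀ n : ℕ, 0 < n → p ^ n ≠ 1) {a b : ℤ} :
    Arrow p (letter p q a) (letter p q b) ↔ a = b + 1 := by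
  have h : p ^ 2 * letter p q b = letter p q (b + 1) := by
    rw [letter, letter, ← mul_assoc, ← zpow_natCast, ← zpow_add]
    congr 2
    push_cast
    ring
  rw [Arrow, h, (letter_injective hroot).eq_iff]

theorem letter_mul_letter (a b : ℤ) :
    letter p q a * letter p q b = p ^ (2 * (a + b)) * q ^ 2 := by
  rw [letter, letter, mul_mul_mul_comm, ← zpow_add, ← sq, mul_add]

/-- A choice of exponents such that every letter of the orbit of `q` has, up to inversion, a
unique exponent, and such that the letters and their inverses are not connected by arrows. -/
theorem exists_exponents (hqp : ∀ n : ℤ, q ≠ p ^ n) (h1 : (-1 : kˣ) ∉ orbit p q)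
    (hroot : ∀ n : ℕ, 0 < n → p ^ n ≠ 1) :
    ∃ G : ℤ → Prop, G 0 ∧
      (∀ a ∈ orbit p q, ∃ n, G n ∧ (letter p q n = a ∨ (letter p q n)⁻¹ = a)) ∧
      ∀ n n' (e : ℤ), G n → G n' → letter p q n * letter p q n' = p ^ (2 * e) → -1 ≤ e → e ≤ 1 →
        e ≠ 0 ∧ n = n' := by
  by_cases hc : ∃ c : ℤ, q ^ 2 = p ^ (2 * c)
  · obtain ⟨c, hc⟩ := hc
    have hodd : c % 2 = 1 := by
      by_contra hc2
      have h : (q * p ^ (-c)) ^ 2 = 1 := by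
        rw [mul_pow, hc, ← zpow_natCast, ← zpow_mul, ← zpow_add]
        convert zpow_zero p using 2
        push_cast
        ring
      rw [sq, ← eq_inv_iff_mul_eq_one, eq_comm, Units.inv_eq_self_iff] at h
      rcases h with h | h
      · rw [zpow_neg, mul_inv_eq_one] at h
        exact hqp c h
      · refine h1 ⟨-(c / 2), Or.inl ?_⟩
        rw [← h, mul_comm]
        congr 2
        omega
    have hmul : ∀ a b, letter p q a * letter p q b = p ^ (2 * (a + b + c)) := by
      intro a b
      rw [letter_mul_letter, hc, ← zpow_add]
      congr 1
      ring
    have hinv : ∀ a, (letter p q a)⁻¹ = letter p q (-a - c) := by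
      intro a
      rw [inv_eq_iff_mul_eq_one, hmul]
      convert zpow_zero p using 2
      ring
    refine ⟨fun n => 0 < c ∧ 0 < 2 * n + c ∨ c < 0 ∧ 2 * n + c < 0, by omega, ?_, ?_⟩
    · have key : ∀ n, ∃ n', (0 < c ∧ 0 < 2 * n' + c ∨ c < 0 ∧ 2 * n' + c < 0) ∧
          (n' = n ∨ n' = - n - c) := by
        intro n
        by_cases h : 0 < c ∧ 0 < 2 * n + c ∨ c < 0 ∧ 2 * n + c < 0
        · exact ⟨n, h, Or.inl rfl⟩
        · exact ⟨-n - c, by omega, Or.inr rfl⟩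
      have key' : ∀ n, ∃ n', (0 < c ∧ 0 < 2 * n' + c ∨ c < 0 ∧ 2 * n' + c < 0) ∧
          (letter p q n' = letter p q n ∨ (letter p q n')⁻¹ = letter p q n) := by
        intro n
        obtain ⟨n', h, rfl | rfl⟩ := key n
        · exact ⟨_, h, Or.inl rfl⟩
        · exact ⟨_, h, Or.inr (by rw [← hinv, inv_inv])⟩
      rintro a ⟨n, rfl | rfl⟩
      · exact key' n
      · have : p ^ (2 * n) * q⁻¹ = letter p q (n - c) := by
          rw [letter, mul_sub, zpow_sub, ← hc, mul_assoc, sq, mul_inv, inv_mul_cancel_right]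
        rw [this]
        exact key' _
    · intro n n' e h h' he
      rw [hmul] at he
      have := zpow_injective_of_pow_ne_one hroot he
      omega
  · refine ⟨fun _ => True, trivial, ?_, ?_⟩
    · rintro a ⟨n, rfl | rfl⟩
      · exact ⟨n, trivial, Or.inl rfl⟩
      · refine ⟨-n, trivial, Or.inr ?_⟩
        rw [letter, mul_inv, ← zpow_neg]
        congr 2
        ring
    · intro n n' e _ _ he
      refine absurd ⟨e - (n + n'), ?_⟩ hc
      rw [letter_mul_letter] at he
      rw [mul_sub, zpow_sub, ← he, mul_comm, inv_mul_cancel_left]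

/-- An enumeration of the integers by increasing absolute value. -/
def zigzag (n : ℕ) : ℤ := if n % 2 = 0 then (n / 2 : ℕ) else -((n / 2 : ℕ) + 1)

theorem zigzag_injective : Function.Injective zigzag := by
  intro a b h
  simp only [zigzag] at h
  split_ifs at h <;> omega

theorem zigzag_surjective : Function.Surjective zigzag := by
  intro n
  by_cases h : 0 ≤ n
  · refine ⟨2 * n.toNat, ?_⟩
    simp only [zigzag]
    split_ifs <;> omega
  · refine ⟨2 * (-n - 1).toNat + 1, ?_⟩
    simp only [zigzag]
    split_ifs <;> omega

theorem zigzag_adjacent {a b c : ℕ} (hb : b < a) (hc : c < a)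
    (hab : zigzag a = zigzag b + 1 ∨ zigzag b = zigzag a + 1)
    (hac : zigzag a = zigzag c + 1 ∨ zigzag c = zigzag a + 1) : b = c := by
  simp only [zigzag] at hab hac
  split_ifs at hab hac <;> omega

open scoped Classical in
/-- A sequence which represents a multiplicity-free dimension vector by letters of the orbit of
`q` with increasing absolute values of the exponents. -/
theorem exists_base (hroot : ∀ n : ℕ, 0 < n → p ^ n ≠ 1) {G : ℤ → Prop} (hG0 : G 0)
    (hG : ∀ a ∈ orbit p q, ∃ n, G n ∧ (letter p q n = a ∨ (letter p q n)⁻¹ = a))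
    (hGe : ∀ n n' (e : ℤ), G n → G n' → letter p q n * letter p q n' = p ^ (2 * e) → -1 ≤ e → e ≤ 1 →
      e ≠ 0 ∧ n = n')
    {ν : kˣ →₀ ℕ} (hν : IsDimVec (orbit p q) ν) {m : ℕ} (hm : height ν = 2 * m)
    (hmult : ∀ a : kˣ, ν a ≤ 1) (hq : ν q = 1) (h0 : 0 < m) :
    ∃ c : Fin m → ℕ, StrictMono c ∧ c ⟨0, h0⟩ = 0 ∧ (∀ l, G (zigzag (c l))) ∧
      IsThetaSeq ν fun l => letter p q (zigzag (c l)) := by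
  have hinj : Function.Injective fun n => letter p q (zigzag n) :=
    (letter_injective hroot).comp zigzag_injective
  let K : Finset ℕ := (ν.support.preimage (fun n => letter p q (zigzag n))
    hinj.injOn).filter fun n => G (zigzag n)
  have hK : ∀ n, n ∈ K ↔ ν (letter p q (zigzag n)) ≠ 0 ∧ G (zigzag n) := by
    intro n
    simp [K]
  have hsum : ∑ n ∈ K, (Finsupp.single (letter p q (zigzag n)) 1 +
      Finsupp.single (letter p q (zigzag n))⁻¹ 1) = ν := by
    ext a
    simp only [Finsupp.finsetSum_apply, Finsupp.add_apply, Finsupp.single_apply]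
    by_cases ha : ν a = 0
    · rw [ha]
      refine Finset.sum_eq_zero fun n hn => ?_
      have hn' := ((hK n).1 hn).1
      rw [if_neg (by rintro rfl; exact hn' ha), if_neg (by rintro rfl; exact hn' (hν.2 _ ▸ ha)),
        add_zero]
    · have ha1 : ν a = 1 := le_antisymm (hmult a) (Nat.one_le_iff_ne_zero.2 ha)
      obtain ⟨n, hn, hna⟩ := hG a (hν.1 a ha)
      obtain ⟨n, rfl⟩ := zigzag_surjective n
      have hnK : n ∈ K := by
        rw [hK]
        refine ⟨?_, hn⟩
        rcases hna with rfl | rfl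
        · exact ha
        · rwa [hν.2] at ha
      have hne : ∀ n' ∈ K, letter p q (zigzag n') ≠ (letter p q (zigzag n))⁻¹ := by
        intro n' hn' h
        refine (hGe _ _ 0 ((hK n').1 hn').2 hn ?_ (by norm_num) (by norm_num)).1 rfl
        rw [h, inv_mul_cancel, mul_zero, zpow_zero]
      rw [ha1, Finset.sum_eq_single n]
      · rcases hna with rfl | rfl
        · rw [if_pos rfl, if_neg (hne n hnK).symm, add_zero]
        · rw [if_neg (hne n hnK), if_pos rfl, zero_add]
      · intro n' hn' hnn
        rcases hna with rfl | rfl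
        · have h : (letter p q (zigzag n'))⁻¹ ≠ letter p q (zigzag n) := fun h =>
            hne n' hn' (by rw [← h, inv_inv])
          rw [if_neg (fun h => hnn (hinj h)), if_neg h, add_zero]
        · rw [if_neg (hne n' hn'), if_neg (fun h => hnn (hinj (inv_injective h))), add_zero]
      · exact fun h => absurd hnK h
  have hcard : K.card = m := by
    have h : Finsupp.degree ν = 2 * m := hm
    rw [← hsum, map_sum] at h
    simp only [map_add, Finsupp.degree_single, Finset.sum_const, smul_eq_mul] at h
    omega
  refine ⟨K.orderEmbOfFin hcard, (K.orderEmbOfFin hcard).strictMono, ?_, fun l =>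
    ((hK _).1 (K.orderEmbOfFin_mem hcard l)).2, ?_⟩
  · have h0K : 0 ∈ K := by
      rw [hK]
      refine ⟨?_, hG0⟩
      simp [zigzag, letter, hq]
    rw [Finset.orderEmbOfFin_zero hcard h0]
    exact Nat.le_zero.1 (Finset.min'_le _ _ h0K)
  · rw [IsThetaSeq, ← hsum]
    conv_rhs => rw [← Finset.map_orderEmbOfFin_univ K hcard, Finset.sum_map]
    rfl

end OrbitLetters

/-- Corollary 2.26.  In case (A2) with `ν` of multiplicity one (`q ∈ I`,
`p ∉ I`, `p` not a root of unity, `ν_i ≤ 1`, `ν_q = 1`), the VV algebra `𝔚_ν` is affine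
cellular with respect to the `k`-involution fixing all the generators `x_j`, `σ_s`, `π`,
`e(i)` and reversing products. -/
theorem vv_affineCellular_case_A2_multOne
    (k : Type) [Field k] (hchar : (2 : k) ≠ 0)
    (p q : kˣ) (hp1 : p ≠ 1) (hp2 : p ≠ -1)
    (hpq : ∀ n : ℤ, p ≠ q ^ n) (hqp : ∀ n : ℤ, q ≠ p ^ n)
    (I : Set kˣ) (hI : I = orbit p q)
    (hI1 : (1 : kˣ) ∉ I) (hI1' : (-1 : kˣ) ∉ I)
    (hp : p ∉ I) (hroot : ∀ n : ℕ, 0 < n → p ^ n ≠ 1)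
    (ν : kˣ →₀ ℕ) (hν : IsDimVec I ν) (m : ℕ) (hm : height ν = 2 * m)
    (hmult : ∀ a : kˣ, ν a ≤ 1) (hq : ν q = 1) :
    ∃ ω : VV k p q ν m →ₗ[k] VV k p q ν m,
      IsKInvolution ω ∧
      (∀ j : Fin m, ω (vmk p q ν m (X j)) = vmk p q ν m (X j)) ∧
      (∀ s : Fin (m - 1), ω (vmk p q ν m (Sg s)) = vmk p q ν m (Sg s)) ∧
      ω (vmk p q ν m Pg) = vmk p q ν m Pg ∧
      (∀ i : Fin m → kˣ, ω (vmk p q ν m (E i)) = vmk p q ν m (E i)) ∧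
      IsAffineCellular k (VV k p q ν m) ω := by
  subst hI
  have h0 : 0 < m := by
    refine Nat.pos_of_ne_zero fun h => ?_
    have h' : Finsupp.degree ν = 0 := by
      rw [h, mul_zero] at hm
      exact hm
    rw [Finsupp.degree_eq_zero_iff] at h'
    rw [h', Finsupp.zero_apply] at hq
    exact zero_ne_one hq
  obtain ⟨G, hG0, hG, hGe⟩ := exists_exponents hqp hI1' hroot
  obtain ⟨c, hc, hc0, hGc, hb⟩ := exists_base hroot hG0 hG hGe hν hm hmult hq h0
  have hbase0 : letter p q (zigzag (c ⟨0, h0⟩)) = q := by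
    rw [hc0]
    simp [zigzag, letter]
  have hqq : q ≠ q⁻¹ := by
    have := hb.ne_inv_self hmult ⟨0, h0⟩
    rwa [hbase0] at this
  obtain ⟨S⟩ : Nonempty (Frame p q ν h0) := by
    refine nonempty_frame hmult hb (hroot 2 two_pos) (hroot 4 four_pos) hbase0 ?_ ?_
    · intro f l l' hl hl' h h'
      rw [arrow_letter_iff hroot, arrow_letter_iff hroot] at h h'
      exact hc.injective (zigzag_adjacent (hc hl) (hc hl') h h')
    · intro f l hfl
      have hne : ∀ e : ℤ, -1 ≤ e → e ≤ 1 →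
          letter p q (zigzag (c f)) * letter p q (zigzag (c l)) ≠ p ^ (2 * e) := fun e he he' h =>
        hfl (hc.injective (zigzag_injective (hGe _ _ e (hGc f) (hGc l) h he he').2))
      refine ⟨fun h => hne 1 (by norm_num) le_rfl ?_, fun h => hne (-1) le_rfl (by norm_num) ?_⟩
      · rw [Arrow, eq_mul_inv_iff_mul_eq] at h
        exact h
      · rw [Arrow, inv_eq_iff_mul_eq_one] at h
        rw [mul_neg, zpow_neg, ← mul_eq_one_iff_eq_inv, mul_comm, mul_left_comm]
        rw [mul_left_comm] at h
        exact (mul_left_comm _ _ _).trans h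
  exact ⟨S.antiInvolution hmult hqq, S.isKInvolution hmult hqq, S.antiInvolution_x hmult hqq,
    S.antiInvolution_sig hmult hqq, S.antiInvolution_pi hmult hqq,
    S.antiInvolution_idem hmult hqq, S.isAffineCellular hmult hqq⟩

end VVPaper
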